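/- Let l divide n and let χ be associated to the even nilpotent element of Q(n) all of whose Jordan blocks have size l. Then, under the Harish-Chandra embedding ϑ and the identification U(g_0) ≅ U(Q(n/l))^{⊗l}, the finite W-algebra W_χ maps isomorphically (as a C-superalgebra) onto the image of Y(Q(n/l)) under the homomorphism U^{⊗l}∘Δ_l^{op} : Y(Q(n/l)) → U(Q(n/l))^{⊗l}; that is, ϑ(W_χ) = U^{⊗l}∘Δ_l^{op}(Y(Q(n/l))). -/

import Mathlib

noncomputable section
open scoped Classical

/-! # The universal enveloping superalgebra `U(Q(n))` of the queer Lie superalgebra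

`U(Q(n))` is presented by even generators `e i j` and odd generators `f i j`
(`1 ≤ i,j ≤ n`) subject to the relations
`[e i j, e k l] = δ_{jk} e i l - δ_{li} e k j`,
`[e i j, f k l] = δ_{jk} f i l - δ_{li} f k j`,
`f i j * f k l + f k l * f i j = δ_{jk} e i l + δ_{li} e k j`. -/

/-- Generators of `U(Q(n))`: `E i j` (even) and `F i j` (odd). -/
inductive QGen (n : ℕ) : Type
  | E : Fin n → Fin n → QGen n
  | F : Fin n → Fin n → QGen n

/-- Kronecker delta. -/
def kd {n : ℕ} (i j : Fin n) : ℂ := if i = j then 1 else 0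

/-- The defining relations of `U(Q(n))`. -/
inductive QRel (n : ℕ) : FreeAlgebra ℂ (QGen n) → FreeAlgebra ℂ (QGen n) → Prop
  | ee (i j k l : Fin n) : QRel n
      (FreeAlgebra.ι ℂ (QGen.E i j) * FreeAlgebra.ι ℂ (QGen.E k l) -
        FreeAlgebra.ι ℂ (QGen.E k l) * FreeAlgebra.ι ℂ (QGen.E i j))
      (kd j k • FreeAlgebra.ι ℂ (QGen.E i l) - kd l i • FreeAlgebra.ι ℂ (QGen.E k j))
  | ef (i j k l : Fin n) : QRel n
      (FreeAlgebra.ι ℂ (QGen.E i j) * FreeAlgebra.ι ℂ (QGen.F k l) -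
        FreeAlgebra.ι ℂ (QGen.F k l) * FreeAlgebra.ι ℂ (QGen.E i j))
      (kd j k • FreeAlgebra.ι ℂ (QGen.F i l) - kd l i • FreeAlgebra.ι ℂ (QGen.F k j))
  | ff (i j k l : Fin n) : QRel n
      (FreeAlgebra.ι ℂ (QGen.F i j) * FreeAlgebra.ι ℂ (QGen.F k l) +
        FreeAlgebra.ι ℂ (QGen.F k l) * FreeAlgebra.ι ℂ (QGen.F i j))
      (kd j k • FreeAlgebra.ι ℂ (QGen.E i l) + kd l i • FreeAlgebra.ι ℂ (QGen.E k j))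

/-- The universal enveloping superalgebra `U(Q(n))`. -/
abbrev UQ (n : ℕ) := RingQuot (QRel n)

/-- The generator `e i j` of `U(Q(n))`. -/
def Ue {n : ℕ} (i j : Fin n) : UQ n :=
  RingQuot.mkAlgHom ℂ (QRel n) (FreeAlgebra.ι ℂ (QGen.E i j))

/-- The generator `f i j` of `U(Q(n))`. -/
def Uf {n : ℕ} (i j : Fin n) : UQ n :=
  RingQuot.mkAlgHom ℂ (QRel n) (FreeAlgebra.ι ℂ (QGen.F i j))

/-- Sergeev's elements `e_{ij}^{(m)}` and `f_{ij}^{(m)}` of `U(Q(n))`, defined recursively by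
`e^{(0)} = δ`, `f^{(0)} = 0`,
`e_{ij}^{(m)} = Σ_k e_{ik} e_{kj}^{(m-1)} + (-1)^{m+1} Σ_k f_{ik} f_{kj}^{(m-1)}`,
`f_{ij}^{(m)} = Σ_k e_{ik} f_{kj}^{(m-1)} + (-1)^{m+1} Σ_k f_{ik} e_{kj}^{(m-1)}`. -/
def efU (n : ℕ) : ℕ → (Fin n → Fin n → UQ n) × (Fin n → Fin n → UQ n)
  | 0 => (fun i j => algebraMap ℂ (UQ n) (kd i j), fun _ _ => 0)
  | m + 1 =>
      (fun i j => (∑ k, Ue i k * (efU n m).1 k j) +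
        (-1 : ℂ) ^ m • ∑ k, Uf i k * (efU n m).2 k j,
       fun i j => (∑ k, Ue i k * (efU n m).2 k j) +
        (-1 : ℂ) ^ m • ∑ k, Uf i k * (efU n m).1 k j)

/-- `e_{ij}^{(m)}`. -/
def eU {n : ℕ} (m : ℕ) (i j : Fin n) : UQ n := (efU n m).1 i j
/-- `f_{ij}^{(m)}`. -/
def fU {n : ℕ} (m : ℕ) (i j : Fin n) : UQ n := (efU n m).2 i j

/-- For `l ∣ n`, the index `l(p-1)+i` of `{1,…,n}` (0-based: block `p`, position `i`). -/
def bidx {n l : ℕ} (h : l ∣ n) (p : Fin (n / l)) (i : Fin l) : Fin n :=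
  ⟨l * p.val + i.val, by
    have h1 : i.val < l := i.isLt
    have h2 : p.val + 1 ≤ n / l := p.isLt
    have h3 : l * (p.val + 1) ≤ l * (n / l) := Nat.mul_le_mul_left l h2
    have h4 : n / l * l ≤ n := Nat.div_mul_le_self n l
    have h5 : l * (p.val + 1) = l * p.val + l := Nat.mul_succ l p.val
    have h6 : l * (n / l) = n / l * l := Nat.mul_comm l (n / l)
    omega⟩
set_option linter.unusedVariables false

/-! # The character `χ`, the left ideal `I_χ` and the finite W-algebra data

Here `l ∣ n` and `χ` corresponds to the even nilpotent element of `Q(n)` all of whose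
Jordan blocks have size `l`.  The subalgebra `m = ⊕_{j<0} g_j` is spanned by the
elements `e_{l(p-1)+i+k, l(q-1)+i}` and `f_{l(p-1)+i+k, l(q-1)+i}` (`k ≥ 1`), and
`χ(e_{l(p-1)+i+1, l(q-1)+i}) = δ_{pq}` and `χ = 0` on the other basis elements. -/

/-- The set of elements `a - χ(a)` for `a` ranging over the standard basis of `m`;
(rows/columns written 0-based: `a` is the position of the row inside its block `p`,
`b` the position of the column inside its block `q`, with `b < a`). -/
def mSet (n l : ℕ) (h : l ∣ n) : Set (UQ n) :=
  { x : UQ n | ∃ (p q : Fin (n / l)) (a b : Fin l), b.val < a.val ∧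
      (x = Ue (bidx h p a) (bidx h q b) -
            algebraMap ℂ (UQ n) (if a.val = b.val + 1 ∧ p = q then 1 else 0) ∨
       x = Uf (bidx h p a) (bidx h q b)) }

/-- The left ideal `I_χ` of `U(Q(n))` generated by the `a - χ(a)`, `a ∈ m`. -/
def Ichi (n l : ℕ) (h : l ∣ n) : Submodule (UQ n) (UQ n) :=
  Submodule.span (UQ n) (mSet n l h)

/-- The quotient `U(Q(n))/I_χ` (as a `ℂ`-vector space). -/
abbrev Wq (n l : ℕ) (h : l ∣ n) := UQ n ⧸ (Ichi n l h).restrictScalars ℂ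

/-- The quotient map `π : U(Q(n)) → U(Q(n))/I_χ`. -/
def piq (n l : ℕ) (h : l ∣ n) : UQ n →ₗ[ℂ] Wq n l h :=
  ((Ichi n l h).restrictScalars ℂ).mkQ

/-- `y` super-commutes with `m` into `I_χ`:  `[a, y] ∈ I_χ` for every `a` in the standard
basis of `m`.  Here the super-commutator of the odd element `f` with (the possibly
non-homogeneous) `y` is `f * y - σ(y) * f`, where `σ` is the parity involution of
`U(Q(n))` (the algebra automorphism fixing the `e`'s and negating the `f`'s). -/
def Wcond {n l : ℕ} (h : l ∣ n) (σ : UQ n →ₐ[ℂ] UQ n) (y : UQ n) : Prop :=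
  ∀ (p q : Fin (n / l)) (a b : Fin l), b.val < a.val →
    (Ue (bidx h p a) (bidx h q b) * y - y * Ue (bidx h p a) (bidx h q b) ∈ Ichi n l h) ∧
    (Uf (bidx h p a) (bidx h q b) * y - σ y * Uf (bidx h p a) (bidx h q b) ∈ Ichi n l h)

/-- The finite W-algebra `W_χ = {π(y) | [a, y] ∈ I_χ for all a ∈ m}`, as a subset of
`U(Q(n))/I_χ`.  (Its product is `π(y₁)·π(y₂) = π(y₁y₂)`.) -/
def WchiSet (n l : ℕ) (h : l ∣ n) (σ : UQ n →ₐ[ℂ] UQ n) : Set (Wq n l h) :=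
  { w : Wq n l h | ∃ y : UQ n, Wcond h σ y ∧ piq n l h y = w }

/-- The standard basis elements of the parabolic subalgebra `p = ⊕_{j≥0} g_j`. -/
def pSet (n l : ℕ) (h : l ∣ n) : Set (UQ n) :=
  { x : UQ n | ∃ (p q : Fin (n / l)) (a b : Fin l), a.val ≤ b.val ∧
      (x = Ue (bidx h p a) (bidx h q b) ∨ x = Uf (bidx h p a) (bidx h q b)) }

/-- The standard basis elements of the nilradical `n = ⊕_{j>0} g_j` of `p`. -/
def nSet (n l : ℕ) (h : l ∣ n) : Set (UQ n) :=
  { x : UQ n | ∃ (p q : Fin (n / l)) (a b : Fin l), a.val < b.val ∧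
      (x = Ue (bidx h p a) (bidx h q b) ∨ x = Uf (bidx h p a) (bidx h q b)) }

/-- The kernel of the Harish-Chandra projection `ϑ : U(p) → U(g₀)`, realized inside
`U(Q(n))`: the `ℂ`-span of `U(p)·n`.  (By the PBW theorem, `U(g) = U(p) ⊕ I_χ` and
`U(p) = U(g₀) ⊕ U(p)n`, so for `y ∈ U(g)`, `ϑ(pr(y)) = t` iff
`y - t ∈ I_χ + U(p)n`.) -/
def Lspan (n l : ℕ) (h : l ∣ n) : Submodule ℂ (UQ n) :=
  Submodule.span ℂ
    { x : UQ n | ∃ u ∈ Algebra.adjoin ℂ (pSet n l h), ∃ g ∈ nSet n l h, x = u * g }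

/-- A descriptor of a generator of `U(p)`:  `(b, p, q, a, c)` is
`e_{l(p-1)+(a+1), l(q-1)+(c+1)}` if `b = false` and `f_{…}` if `b = true`
(required: `a ≤ c`). -/
def pgElem {n l : ℕ} (h : l ∣ n) :
    Bool × Fin (n / l) × Fin (n / l) × Fin l × Fin l → UQ n
  | (b, p, q, a, c) => (if b then Uf else Ue) (bidx h p a) (bidx h q c)

/-- Kazhdan degree `2k+2` of a `p`-generator of block offset `k = c - a`. -/
def pgDeg {l m : ℕ} (d : Bool × Fin m × Fin m × Fin l × Fin l) : ℕ :=
  2 * (d.2.2.2.2.val - d.2.2.2.1.val) + 2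

/-- Weight `2k` of a `p`-generator of block offset `k = c - a`. -/
def pgWt {l m : ℕ} (d : Bool × Fin m × Fin m × Fin l × Fin l) : ℕ :=
  2 * (d.2.2.2.2.val - d.2.2.2.1.val)

/-- Monomials in the generators of `U(p)` which are "lower" than bidegree
(Kazhdan degree `D`, weight `W`): either of Kazhdan degree `< D`, or of Kazhdan
degree `≤ D` and weight `< W`. -/
def LowSet (n l : ℕ) (h : l ∣ n) (D W : ℕ) : Set (UQ n) :=
  { x : UQ n | ∃ L : List (Bool × Fin (n / l) × Fin (n / l) × Fin l × Fin l),
      (∀ d ∈ L, d.2.2.2.1.val ≤ d.2.2.2.2.val) ∧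
      x = (L.map (pgElem h)).prod ∧
      ((L.map pgDeg).sum < D ∨ ((L.map pgDeg).sum ≤ D ∧ (L.map pgWt).sum < W)) }

/-- The span of the "lower" monomials. -/
def LowSpan (n l : ℕ) (h : l ∣ n) (D W : ℕ) : Submodule ℂ (UQ n) :=
  Submodule.span ℂ (LowSet n l h D W)

/-! # The super tensor power `U(Q(m))^{⊗l}`

Modeled as the superalgebra with generators `x^i_{pq} = 1^{⊗(l-i)} ⊗ e_{pq} ⊗ 1^{⊗(i-1)}`
(even) and `ξ^i_{pq} = 1^{⊗(l-i)} ⊗ f_{pq} ⊗ 1^{⊗(i-1)}` (odd), subject to the `U(Q(m))`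
relations in each tensor slot and to (super-)commutation between different slots. -/

/-- Generators of `U(Q(m))^{⊗l}`: `X i p q` is `x^i_{pq}` and `Xi i p q` is `ξ^i_{pq}`
(`i : Fin l` is the 0-based tensor slot, counted from the right). -/
inductive TGen (m l : ℕ) : Type
  | X : Fin l → Fin m → Fin m → TGen m l
  | Xi : Fin l → Fin m → Fin m → TGen m l

/-- Kronecker delta on slots. -/
def kdl {l : ℕ} (i j : Fin l) : ℂ := if i = j then 1 else 0

/-- The defining relations of `U(Q(m))^{⊗l}`. -/
inductive TRel (m l : ℕ) : FreeAlgebra ℂ (TGen m l) → FreeAlgebra ℂ (TGen m l) → Prop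
  | xx (i i' : Fin l) (p q r s : Fin m) : TRel m l
      (FreeAlgebra.ι ℂ (TGen.X i p q) * FreeAlgebra.ι ℂ (TGen.X i' r s) -
        FreeAlgebra.ι ℂ (TGen.X i' r s) * FreeAlgebra.ι ℂ (TGen.X i p q))
      ((kdl i i' * kd q r) • FreeAlgebra.ι ℂ (TGen.X i p s) -
        (kdl i i' * kd s p) • FreeAlgebra.ι ℂ (TGen.X i' r q))
  | xxi (i i' : Fin l) (p q r s : Fin m) : TRel m l
      (FreeAlgebra.ι ℂ (TGen.X i p q) * FreeAlgebra.ι ℂ (TGen.Xi i' r s) -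
        FreeAlgebra.ι ℂ (TGen.Xi i' r s) * FreeAlgebra.ι ℂ (TGen.X i p q))
      ((kdl i i' * kd q r) • FreeAlgebra.ι ℂ (TGen.Xi i p s) -
        (kdl i i' * kd s p) • FreeAlgebra.ι ℂ (TGen.Xi i' r q))
  | xixi (i i' : Fin l) (p q r s : Fin m) : TRel m l
      (FreeAlgebra.ι ℂ (TGen.Xi i p q) * FreeAlgebra.ι ℂ (TGen.Xi i' r s) +
        FreeAlgebra.ι ℂ (TGen.Xi i' r s) * FreeAlgebra.ι ℂ (TGen.Xi i p q))
      ((kdl i i' * kd q r) • FreeAlgebra.ι ℂ (TGen.X i p s) +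
        (kdl i i' * kd s p) • FreeAlgebra.ι ℂ (TGen.X i' r q))

/-- The superalgebra `U(Q(m))^{⊗l}`. -/
abbrev TQ (m l : ℕ) := RingQuot (TRel m l)

/-- `x^i_{pq} := 1^{⊗(l-i)} ⊗ e_{pq} ⊗ 1^{⊗(i-1)} ∈ U(Q(m))^{⊗l}`. -/
def xT {m l : ℕ} (i : Fin l) (p q : Fin m) : TQ m l :=
  RingQuot.mkAlgHom ℂ (TRel m l) (FreeAlgebra.ι ℂ (TGen.X i p q))

/-- `ξ^i_{pq} := 1^{⊗(l-i)} ⊗ f_{pq} ⊗ 1^{⊗(i-1)} ∈ U(Q(m))^{⊗l}`. -/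
def xiT {m l : ℕ} (i : Fin l) (p q : Fin m) : TQ m l :=
  RingQuot.mkAlgHom ℂ (TRel m l) (FreeAlgebra.ι ℂ (TGen.Xi i p q))

/-! # The super-Yangian `Y(Q(n))` -/

/-- The index set `{±1, …, ±n}`:  `(false, a)` is the positive index `a` (even),
`(true, a)` is the negative index `-a` (odd). -/
abbrev QIdx (n : ℕ) := Bool × Fin n

/-- Negation `i ↦ -i` on indices. -/
def qneg {n : ℕ} (i : QIdx n) : QIdx n := (!i.1, i.2)

/-- The parity `p(i)`: `0` for positive `i`, `1` for negative `i`. -/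
def qpar {n : ℕ} (i : QIdx n) : ℕ := if i.1 then 1 else 0

/-- Kronecker delta on `{±1, …, ±n}`. -/
def kdq {n : ℕ} (i j : QIdx n) : ℂ := if i = j then 1 else 0

/-- Generators of `Y(Q(n))`: `T m i j` encodes `T^{(m+1)}_{i,j}`. -/
inductive YGen (n : ℕ) : Type
  | T : ℕ → QIdx n → QIdx n → YGen n

/-- `T^{(m)}_{i,j}` in the free algebra, with `T^{(0)}_{i,j} = δ_{ij}`. -/
def Tf {n : ℕ} : ℕ → QIdx n → QIdx n → FreeAlgebra ℂ (YGen n)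
  | 0, i, j => algebraMap ℂ _ (kdq i j)
  | m + 1, i, j => FreeAlgebra.ι ℂ (YGen.T m i j)

/-- The super-commutator `[T^{(a)}_{i,j}, T^{(b)}_{k,l}]` in the free algebra. -/
def ybr {n : ℕ} (a : ℕ) (i j : QIdx n) (b : ℕ) (k l : QIdx n) :
    FreeAlgebra ℂ (YGen n) :=
  Tf a i j * Tf b k l -
    ((-1 : ℂ) ^ ((qpar i + qpar j) * (qpar k + qpar l))) • (Tf b k l * Tf a i j)

/-- The defining relations of the super-Yangian `Y(Q(n))`: for `M, R ≥ 1`,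
`(-1)^{p(i)p(k)+p(i)p(l)+p(k)p(l)} ([T^{(M+1)}_{ij}, T^{(R-1)}_{kl}] - [T^{(M-1)}_{ij}, T^{(R+1)}_{kl}])
 = T^{(M)}_{kj}T^{(R-1)}_{il} + T^{(M-1)}_{kj}T^{(R)}_{il} - T^{(R-1)}_{kj}T^{(M)}_{il}
   - T^{(R)}_{kj}T^{(M-1)}_{il}
   + (-1)^{p(k)+p(l)} (-T^{(M)}_{-k,j}T^{(R-1)}_{-i,l} + T^{(M-1)}_{-k,j}T^{(R)}_{-i,l}
       + T^{(R-1)}_{k,-j}T^{(M)}_{i,-l} - T^{(R)}_{k,-j}T^{(M-1)}_{i,-l})`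
(here `M = m+1`, `R = r+1`), together with `T^{(m)}_{-i,-j} = (-1)^m T^{(m)}_{i,j}`. -/
inductive YRel (n : ℕ) : FreeAlgebra ℂ (YGen n) → FreeAlgebra ℂ (YGen n) → Prop
  | quad (m r : ℕ) (i j k l : QIdx n) : YRel n
      (((-1 : ℂ) ^ (qpar i * qpar k + qpar i * qpar l + qpar k * qpar l)) •
        (ybr (m + 2) i j r k l - ybr m i j (r + 2) k l))
      (Tf (m + 1) k j * Tf r i l + Tf m k j * Tf (r + 1) i l -
        Tf r k j * Tf (m + 1) i l - Tf (r + 1) k j * Tf m i l +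
        ((-1 : ℂ) ^ (qpar k + qpar l)) •
          (-(Tf (m + 1) (qneg k) j * Tf r (qneg i) l) +
            Tf m (qneg k) j * Tf (r + 1) (qneg i) l +
            Tf r k (qneg j) * Tf (m + 1) i (qneg l) -
            Tf (r + 1) k (qneg j) * Tf m i (qneg l)))
  | par (m : ℕ) (i j : QIdx n) : YRel n
      (Tf (m + 1) (qneg i) (qneg j)) (((-1 : ℂ) ^ (m + 1)) • Tf (m + 1) i j)

/-- The super-Yangian `Y(Q(n))`. -/
abbrev YQ (n : ℕ) := RingQuot (YRel n)

/-- The generator `T^{(m)}_{i,j}` of `Y(Q(n))` (with `T^{(0)}_{i,j} = δ_{ij}`). -/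
def TY {n : ℕ} (m : ℕ) (i j : QIdx n) : YQ n :=
  RingQuot.mkAlgHom ℂ (YRel n) (Tf m i j)

/-! # Values of the homomorphisms `U`, `ev`, `ēv` on the generators of `Y(Q(n))`,
and the explicit sums appearing in the main theorems. -/

/-- The value of the homomorphism `U : Y(Q(n)) → U(Q(n))` on the generator
`T^{(r)}_{i,j}`:  `U(T^{(r)}_{i,j}) = (-1)^r e^{(r)}_{j,i}`,
`U(T^{(r)}_{-i,j}) = (-1)^r f^{(r)}_{j,i}` for `i, j > 0`, and the values on the other
generators are forced by `T^{(r)}_{-i,-j} = (-1)^r T^{(r)}_{i,j}`. -/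
def Uval {n : ℕ} (r : ℕ) (i j : QIdx n) : UQ n :=
  (if j.1 then (-1 : ℂ) ^ r else 1) •
    ((-1 : ℂ) ^ r • (if xor i.1 j.1 then fU r j.2 i.2 else eU r j.2 i.2))

/-- The value of the evaluation homomorphism `ev : Y(Q(n)) → U(Q(n))` on `T^{(r)}_{i,j}`:
`ev(T^{(1)}_{i,j}) = -e_{j,i}`, `ev(T^{(1)}_{-i,j}) = -f_{j,i}` for `i, j > 0`,
`ev(T^{(0)}_{i,j}) = δ_{ij}` and `ev(T^{(r)}_{i,j}) = 0` for `r > 1` (with the values on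
the remaining generators forced by `T^{(r)}_{-i,-j} = (-1)^r T^{(r)}_{i,j}`). -/
def evval {n : ℕ} (r : ℕ) (i j : QIdx n) : UQ n :=
  (if j.1 then (-1 : ℂ) ^ r else 1) •
    (match r with
      | 0 => if xor i.1 j.1 then 0 else algebraMap ℂ (UQ n) (kd i.2 j.2)
      | 1 => -(if xor i.1 j.1 then Uf j.2 i.2 else Ue j.2 i.2)
      | _ + 2 => 0)

/-- The value of `ēv = α ∘ ev : Y(Q(n)) → U(Q(n))` on `T^{(r)}_{i,j}`, where `α` is the
principal anti-automorphism of `U(Q(n))`:  `ēv(T^{(1)}_{i,j}) = e_{j,i}`,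
`ēv(T^{(1)}_{-i,j}) = f_{j,i}` for `i, j > 0`, `ēv(T^{(0)}_{i,j}) = δ_{ij}`,
`ēv(T^{(r)}_{i,j}) = 0` for `r > 1`. -/
def bevval {n : ℕ} (r : ℕ) (i j : QIdx n) : UQ n :=
  (if j.1 then (-1 : ℂ) ^ r else 1) •
    (match r with
      | 0 => if xor i.1 j.1 then 0 else algebraMap ℂ (UQ n) (kd i.2 j.2)
      | 1 => (if xor i.1 j.1 then Uf j.2 i.2 else Ue j.2 i.2)
      | _ + 2 => 0)

/-- The sum `Σ_{p_1,…,p_{r-1}} Σ_{l ≥ i_1 ≥ i_2 ≥ … ≥ i_r ≥ 1}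
Π_{a=1}^r (x^{i_a}_{p_{a-1},p_a} + (-1)^{r-a} ξ^{i_a}_{p_{a-1},p_a})`
(with `p_0 = p`, `p_r = q`), an element of `U(Q(m))^{⊗l}`. -/
def chainProdDec (m l : ℕ) (r : ℕ) (p q : Fin m) : TQ m l :=
  ∑ c : Fin (r + 1) → Fin m, ∑ iv : Fin r → Fin l,
    (if c 0 = p ∧ c (Fin.last r) = q ∧ (∀ a b : Fin r, a ≤ b → iv b ≤ iv a)
      then (1 : ℂ) else 0) •
      (List.ofFn fun a : Fin r =>
        xT (iv a) (c a.castSucc) (c a.succ) +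
          ((-1 : ℂ) ^ (r - 1 - a.val)) • xiT (iv a) (c a.castSucc) (c a.succ)).prod

/-- The sum `Σ_{p_1,…,p_{r-1}} Σ_{1 ≤ i_1 < i_2 < … < i_r ≤ l}
Π_{a=1}^r (x^{i_a}_{p_{a-1},p_a} + (-1)^{r-a} ξ^{i_a}_{p_{a-1},p_a})`
(with `p_0 = p`, `p_r = q`), an element of `U(Q(m))^{⊗l}`. -/
def chainProdInc (m l : ℕ) (r : ℕ) (p q : Fin m) : TQ m l :=
  ∑ c : Fin (r + 1) → Fin m, ∑ iv : Fin r → Fin l,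
    (if c 0 = p ∧ c (Fin.last r) = q ∧ (∀ a b : Fin r, a < b → iv a < iv b)
      then (1 : ℂ) else 0) •
      (List.ofFn fun a : Fin r =>
        xT (iv a) (c a.castSucc) (c a.succ) +
          ((-1 : ℂ) ^ (r - 1 - a.val)) • xiT (iv a) (c a.castSucc) (c a.succ)).prod

/-- The elements `z^{(r)}_{±q,p}` of `U(Q(m))^{⊗l}`:  the even (`sgn = false`,
giving `z^{(r)}_{q,p}`) resp. odd (`sgn = true`, giving `z^{(r)}_{-q,p}`) component of
`chainProdDec`, computed using the parity involution `σT` of `U(Q(m))^{⊗l}`;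
`z^{(0)}_{q,p} = δ_{qp}`, `z^{(0)}_{-q,p} = 0`. -/
def zDec {m l : ℕ} (σT : TQ m l →ₐ[ℂ] TQ m l) :
    ℕ → Bool → Fin m → Fin m → TQ m l
  | 0, sgn, q, p => if sgn then 0 else algebraMap ℂ (TQ m l) (kd q p)
  | r + 1, sgn, q, p =>
      (2⁻¹ : ℂ) • (chainProdDec m l (r + 1) p q +
        (if sgn then (-1 : ℂ) else 1) • σT (chainProdDec m l (r + 1) p q))

/-- The elements `z̃^{(r)}_{±q,p}` of `U(Q(m))^{⊗l}` (as `zDec`, with increasing chains). -/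
def zInc {m l : ℕ} (σT : TQ m l →ₐ[ℂ] TQ m l) :
    ℕ → Bool → Fin m → Fin m → TQ m l
  | 0, sgn, q, p => if sgn then 0 else algebraMap ℂ (TQ m l) (kd q p)
  | r + 1, sgn, q, p =>
      (2⁻¹ : ℂ) • (chainProdInc m l (r + 1) p q +
        (if sgn then (-1 : ℂ) else 1) • σT (chainProdInc m l (r + 1) p q))

/-- The explicit formula for the antipode value `S(T^{(r)}_{i,j})` (`r ≥ 1`):
`S(T^{(r)}_{i,j}) = Σ_{m=1}^{r} (-1)^m Σ_{i_1,…,i_{m-1}} Σ_{r_1+⋯+r_m=r, r_a>0}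
(-1)^{ν(i,i_1,…,i_{m-1},j)} T^{(r_1)}_{i,i_1} ⋯ T^{(r_m)}_{i_{m-1},j}` where
`ν(i_0,…,i_m) = Σ_{0≤k<s≤m-1} (p(i_k)+p(i_{k+1}))(p(i_s)+p(i_{s+1}))`. -/
def STval {n : ℕ} (r : ℕ) (i j : QIdx n) : YQ n :=
  ∑ m : Fin r,
    ((-1 : ℂ) ^ (m.val + 1)) •
      ∑ ch : Fin (m.val + 2) → QIdx n, ∑ c : Fin (m.val + 1) → Fin (r + 1),
        (if ch 0 = i ∧ ch (Fin.last (m.val + 1)) = j ∧ (∀ a, 1 ≤ (c a).val) ∧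
              (∑ a, (c a).val) = r
          then ((-1 : ℂ) ^ (∑ a : Fin (m.val + 1), ∑ b : Fin (m.val + 1),
              if a < b then
                (qpar (ch a.castSucc) + qpar (ch a.succ)) *
                  (qpar (ch b.castSucc) + qpar (ch b.succ))
              else 0))
          else 0) •
        (List.ofFn fun a : Fin (m.val + 1) =>
          TY (c a).val (ch a.castSucc) (ch a.succ)).prod

namespace QW

/-! ## Part 1: uniform notation for generators and the adjoint relations -/

/-- Uniform notation for the generators. -/
def X {n : ℕ} (β : Bool) (i j : Fin n) : UQ n :=
  match β with
  | false => Ue i j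
  | true => Uf i j

/-- The sign `(-1)^{βγ}`. -/
def sg (β γ : Bool) : ℂ := if β && γ then -1 else 1

/-- The sign `(-1)^{sγ}`. -/
def pw (s : ℕ) (γ : Bool) : ℂ := if γ then (-1) ^ s else 1

@[simp] lemma sg_ff : sg false false = 1 := rfl
@[simp] lemma sg_ft : sg false true = 1 := rfl
@[simp] lemma sg_tf : sg true false = 1 := rfl
@[simp] lemma sg_tt : sg true true = -1 := rfl
@[simp] lemma pw_f (s : ℕ) : pw s false = 1 := rfl
@[simp] lemma pw_t (s : ℕ) : pw s true = (-1) ^ s := rfl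

lemma Xrel {n : ℕ} (β γ : Bool) (i j k m : Fin n) :
    X β i j * X γ k m = sg β γ • (X γ k m * X β i j) + kd j k • X (xor β γ) i m
      - (sg β γ * kd m i) • X (xor β γ) k j := by
  cases β <;> cases γ
  · have := RingQuot.mkAlgHom_rel ℂ (QRel.ee i j k m)
    simp only [map_sub, map_mul, map_smul] at this
    simp only [X, Ue, sg_ff, Bool.xor_false, one_smul, one_mul]
    rw [add_sub_assoc, ← this]; abel
  · have := RingQuot.mkAlgHom_rel ℂ (QRel.ef i j k m)
    simp only [map_sub, map_mul, map_smul] at this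
    simp only [X, Ue, Uf, sg_ft, Bool.false_xor, one_smul, one_mul]
    rw [add_sub_assoc, ← this]; abel
  · have := RingQuot.mkAlgHom_rel ℂ (QRel.ef k m i j)
    simp only [map_sub, map_mul, map_smul] at this
    simp only [X, Ue, Uf, sg_tf, Bool.xor_false, one_smul, one_mul]
    rw [add_sub_assoc, ← neg_sub ((kd m i) • _), ← this]; abel
  · have := RingQuot.mkAlgHom_rel ℂ (QRel.ff i j k m)
    simp only [map_add, map_mul, map_smul] at this
    simp only [X, Ue, Uf, sg_tt, Bool.xor_self]
    linear_combination (norm := module) this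

/-- Uniform notation for the Sergeev elements. -/
def T {n : ℕ} (s : ℕ) (β : Bool) (i j : Fin n) : UQ n :=
  match β with
  | false => eU s i j
  | true => fU s i j

lemma T_zero {n : ℕ} (β : Bool) (i j : Fin n) :
    T 0 β i j = algebraMap ℂ (UQ n) (if β then 0 else kd i j) := by
  cases β <;> simp [T, eU, fU, efU]

lemma T_succ {n : ℕ} (s : ℕ) (β : Bool) (i j : Fin n) :
    T (s + 1) β i j = ∑ γ : Bool, ∑ k, pw s γ • (X γ i k * T s (xor β γ) k j) := by
  cases β <;>
  simp [T, eU, fU, efU, X, Finset.smul_sum, add_comm]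

/-- The adjoint relation for the Sergeev elements. -/
lemma XT {n : ℕ} (s : ℕ) : ∀ (γ β : Bool) (a b i j : Fin n),
    X γ a b * T s β i j = sg γ β • (T s β i j * X γ a b)
      + (pw (s + 1) γ * kd b i) • T s (xor β γ) a j
      - (sg γ β * kd j a) • T s (xor β γ) i b := by
  induction s with
  | zero =>
    intro γ β a b i j
    have hc : ∀ (r : ℂ) (x : UQ n), x * algebraMap ℂ (UQ n) r = r • x := fun r x => by
      rw [← Algebra.commutes, Algebra.smul_def]
    have hc' : ∀ (r : ℂ) (x : UQ n), algebraMap ℂ (UQ n) r * x = r • x := fun r x => by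
      rw [Algebra.smul_def]
    have hk : ∀ i j : Fin n, kd i j = kd j i := fun i j => by simp [kd, eq_comm]
    cases β <;> cases γ <;> simp only [T_zero, hc, hc'] <;>
      simp only [Algebra.algebraMap_eq_smul_one, hk j a, hk b i, Bool.xor_false, Bool.xor_true,
        Bool.not_true, Bool.not_false, if_true, if_false, Bool.false_eq_true, sg_ff, sg_ft,
        sg_tf, sg_tt, pw_f, pw_t, pow_one, zero_add] <;> module
  | succ s ih =>
    intro γ β a b i j
    have key : ∀ (δ : Bool) (k : Fin n), X γ a b * (X δ i k * T s (xor β δ) k j) =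
        sg γ β • ((X δ i k * T s (xor β δ) k j) * X γ a b)
        - (sg γ β * kd j a) • (X δ i k * T s (xor (xor β γ) δ) k b)
        + kd b i • (X (xor γ δ) a k * T s (xor β δ) k j)
        + ((sg γ δ * pw (s + 1) γ) * kd b k) • (X δ i k * T s (xor (xor β γ) δ) a j)
        - (sg γ δ * kd k a) • (X (xor γ δ) i b * T s (xor β δ) k j) := by
      intro δ k
      rw [← mul_assoc, Xrel γ δ a b i k, sub_mul, add_mul, smul_mul_assoc, mul_assoc,
        ih γ (xor β δ) a b k j]
      have h1 : xor (xor β δ) γ = xor (xor β γ) δ := by cases β <;> cases γ <;> cases δ <;> rfl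
      have h2 : sg γ δ * sg γ (xor β δ) = sg γ β := by
        cases β <;> cases γ <;> cases δ <;> simp
      rw [h1, ← h2]
      simp only [mul_sub, mul_add, mul_smul_comm, smul_sub, smul_add, smul_smul, smul_mul_assoc,
        mul_assoc]
      module
    have sumd : ∀ (c : Fin n) (g : Fin n → UQ n) (r : ℂ),
        ∑ k, (r * kd c k) • g k = r • g c := by
      intro c g r
      rw [Finset.sum_eq_single c]
      · simp [kd]
      · intro k _ hk; simp [kd, hk.symm]
      · simp
    have sumd' : ∀ (c : Fin n) (g : Fin n → UQ n) (r : ℂ),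
        ∑ k, (r * kd k c) • g k = r • g c := by
      intro c g r
      rw [Finset.sum_eq_single c]
      · simp [kd]
      · intro k _ hk; simp [kd, hk]
      · simp
    have e1 : ∀ δ : Bool, ∑ k, pw s δ • (X γ a b * (X δ i k * T s (xor β δ) k j)) =
        pw s δ • (sg γ β • ((∑ k, X δ i k * T s (xor β δ) k j) * X γ a b)
        - (sg γ β * kd j a) • (∑ k, X δ i k * T s (xor (xor β γ) δ) k b)
        + kd b i • (∑ k, X (xor γ δ) a k * T s (xor β δ) k j)
        + (sg γ δ * pw (s + 1) γ) • (X δ i b * T s (xor (xor β γ) δ) a j)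
        - sg γ δ • (X (xor γ δ) i b * T s (xor β δ) a j)) := by
      intro δ
      rw [← Finset.smul_sum]
      congr 1
      simp only [key, Finset.sum_add_distrib, Finset.sum_sub_distrib, ← Finset.smul_sum,
        Finset.sum_mul]
      rw [sumd b (fun k => X δ i k * T s (xor (xor β γ) δ) a j),
        sumd' a (fun k => X (xor γ δ) i b * T s (xor β δ) k j)]
    simp only [T_succ, Finset.mul_sum, mul_smul_comm]
    rw [Finset.sum_congr rfl (fun δ _ => e1 δ)]
    simp only [Fintype.sum_bool, ← Finset.smul_sum]
    have hs := neg_one_pow_eq_or ℂ s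
    cases β <;> cases γ <;>
      simp only [add_mul, smul_add, smul_sub, smul_smul, pow_succ, sg_ff, sg_ft,
        sg_tf, sg_tt, pw_f, pw_t, Bool.xor_false, Bool.xor_true, Bool.not_true, Bool.not_false,
        smul_mul_assoc] <;>
      generalize (-1 : ℂ) ^ s = c at hs ⊢ <;> rcases hs with rfl | rfl <;> module

end QW

namespace QW

/-! ## Part 2: abstract data, the filtration -/

/-- The position inside its Jordan block. -/
def lev (l : ℕ) {n : ℕ} (i : Fin n) : ℕ := i.val % l

/-- The character `χ` on all generators (zero outside `m`). -/
def chi (l : ℕ) {n : ℕ} (β : Bool) (i j : Fin n) : ℂ :=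
  if β = false ∧ i.val = j.val + 1 ∧ lev l i = lev l j + 1 then 1 else 0

/-- Degree of a generator. -/
def dg (l : ℕ) {n : ℕ} (i j : Fin n) : ℤ := (lev l j : ℤ) - lev l i + 1

/-- Abstract data: an algebra with the relations of `U(Q(n))`. -/
structure Dat (n l : ℕ) (R : Type) [Ring R] [Algebra ℂ R] where
  hl : 0 < l
  hdvd : l ∣ n
  X : Bool → Fin n → Fin n → R
  T : ℕ → Bool → Fin n → Fin n → R
  rel : ∀ (β γ : Bool) (i j k m : Fin n),
    X β i j * X γ k m = sg β γ • (X γ k m * X β i j) + kd j k • X (xor β γ) i m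
      - (sg β γ * kd m i) • X (xor β γ) k j
  T_zero : ∀ (β : Bool) (i j : Fin n), T 0 β i j = algebraMap ℂ R (if β then 0 else kd i j)
  T_succ : ∀ (s : ℕ) (β : Bool) (i j : Fin n),
    T (s + 1) β i j = ∑ γ : Bool, ∑ k, pw s γ • (X γ i k * T s (xor β γ) k j)
  XT : ∀ (s : ℕ) (γ β : Bool) (a b i j : Fin n),
    X γ a b * T s β i j = sg γ β • (T s β i j * X γ a b)
      + (pw (s + 1) γ * kd b i) • T s (xor β γ) a j
      - (sg γ β * kd j a) • T s (xor β γ) i b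
  gen : Algebra.adjoin ℂ {x | ∃ β i j, x = X β i j} = ⊤

namespace Dat

variable {n l : ℕ} {R : Type} [Ring R] [Algebra ℂ R] (D : Dat n l R)

/-- `a - χ(a)`. -/
def M (β : Bool) (i j : Fin n) : R := D.X β i j - algebraMap ℂ R (chi l β i j)

/-- The left ideal. -/
def I : Submodule R R := Submodule.span R {x | ∃ β i j, lev l j < lev l i ∧ x = D.M β i j}

/-- The left ideal as a complex subspace. -/
def J : Submodule ℂ R := (D.I).restrictScalars ℂ

lemma J_mul (r : R) {x : R} (hx : x ∈ D.J) : r * x ∈ D.J := D.I.smul_mem r hx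

lemma M_mem (β : Bool) {i j : Fin n} (h : lev l j < lev l i) : D.M β i j ∈ D.J :=
  Submodule.subset_span ⟨β, i, j, h, rfl⟩

/-- Elements `y` with `I y ⊆ I`. -/
def Inv (y : R) : Prop := ∀ β i j, lev l j < lev l i → D.M β i j * y ∈ D.J

lemma Inv.J_mul {D : Dat n l R} {y : R} (hy : D.Inv y) {x : R} (hx : x ∈ D.J) :
    x * y ∈ D.J := by
  have hx' : x ∈ Submodule.span R {x | ∃ β i j, lev l j < lev l i ∧ x = D.M β i j} := hx
  induction hx' using Submodule.span_induction with
  | mem x h => obtain ⟨β, i, j, h, rfl⟩ := h; exact hy β i j h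
  | zero => rw [zero_mul]; exact D.J.zero_mem
  | add a b ha hb iha ihb => rw [add_mul]; exact D.J.add_mem (iha ha) (ihb hb)
  | smul a b hb ih => rw [smul_eq_mul, mul_assoc]; exact D.J_mul _ (ih hb)

lemma Inv.mul {D : Dat n l R} {y z : R} (hy : D.Inv y) (hz : D.Inv z) : D.Inv (y * z) := by
  intro β i j h; rw [← mul_assoc]; exact hz.J_mul (hy β i j h)

lemma Inv.one : D.Inv 1 := by
  intro β i j h; rw [mul_one]; exact D.M_mem β h

lemma Inv.add {D : Dat n l R} {y z : R} (hy : D.Inv y) (hz : D.Inv z) : D.Inv (y + z) := by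
  intro β i j h; rw [mul_add]; exact D.J.add_mem (hy β i j h) (hz β i j h)

lemma Inv.smul {D : Dat n l R} {y : R} (c : ℂ) (hy : D.Inv y) : D.Inv (c • y) := by
  intro β i j h; rw [mul_smul_comm]; exact D.J.smul_mem _ (hy β i j h)

lemma Inv.sub {D : Dat n l R} {y z : R} (hy : D.Inv y) (hz : D.Inv z) : D.Inv (y - z) := by
  intro β i j h; rw [mul_sub]; exact D.J.sub_mem (hy β i j h) (hz β i j h)

/-- Words. -/
abbrev Wd (n : ℕ) := List (Bool × Fin n × Fin n)

/-- Degree of a word. -/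
def wd (l : ℕ) (w : Wd n) : ℤ := (w.map fun d => dg l d.2.1 d.2.2).sum
/-- Product of a word. -/
def pr (w : Wd n) : R := (w.map fun d => D.X d.1 d.2.1 d.2.2).prod
/-- Words in generators of `p`. -/
def ok (l : ℕ) (w : Wd n) : Prop := ∀ d ∈ w, lev l d.2.1 ≤ lev l d.2.2

/-- The filtration. -/
def Fil (d : ℤ) (k : ℕ) : Submodule ℂ R :=
  Submodule.span ℂ {x | ∃ w : Wd n, ok l w ∧ x = D.pr w ∧
    ((wd l w ≤ d ∧ k ≤ w.length) ∨ wd l w ≤ d - 1)}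

/-- The filtration plus the left ideal. -/
def FJ (d : ℤ) (k : ℕ) : Submodule ℂ R := D.Fil d k ⊔ D.J

lemma Fil_mono {d d' : ℤ} {k k' : ℕ} (h : d ≤ d') (h' : k' ≤ k) : D.Fil d k ≤ D.Fil d' k' := by
  apply Submodule.span_mono
  rintro x ⟨w, hw, rfl, h1 | h1⟩
  · exact ⟨w, hw, rfl, Or.inl ⟨h1.1.trans h, h'.trans h1.2⟩⟩
  · exact ⟨w, hw, rfl, Or.inr (by omega)⟩

lemma Fil_lt {d d' : ℤ} {k k' : ℕ} (h : d < d') : D.Fil d k ≤ D.Fil d' k' := by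
  apply Submodule.span_mono
  rintro x ⟨w, hw, rfl, h1 | h1⟩
  · exact ⟨w, hw, rfl, Or.inr (by omega)⟩
  · exact ⟨w, hw, rfl, Or.inr (by omega)⟩

lemma FJ_mono {d d' : ℤ} {k k' : ℕ} (h : d ≤ d') (h' : k' ≤ k) : D.FJ d k ≤ D.FJ d' k' :=
  sup_le_sup_right (D.Fil_mono h h') _

lemma FJ_lt {d d' : ℤ} {k k' : ℕ} (h : d < d') : D.FJ d k ≤ D.FJ d' k' :=
  sup_le_sup_right (D.Fil_lt h) _

lemma Fil_le_FJ (d : ℤ) (k : ℕ) : D.Fil d k ≤ D.FJ d k := le_sup_left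
lemma J_le_FJ (d : ℤ) (k : ℕ) : D.J ≤ D.FJ d k := le_sup_right

lemma Fil_mul {d d' : ℤ} {k k' : ℕ} {x y : R} (hx : x ∈ D.Fil d k) (hy : y ∈ D.Fil d' k') :
    x * y ∈ D.Fil (d + d') (k + k') := by
  have : D.Fil d k * D.Fil d' k' ≤ D.Fil (d + d') (k + k') := by
    unfold Fil
    rw [Submodule.span_mul_span]
    apply Submodule.span_mono
    rintro _ ⟨_, ⟨w, hw, rfl, h⟩, _, ⟨w', hw', rfl, h'⟩, rfl⟩
    refine ⟨w ++ w', ?_, by simp [pr], ?_⟩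
    · intro d hd
      rcases List.mem_append.1 hd with h | h
      · exact hw d h
      · exact hw' d h
    · have e : wd l (w ++ w') = wd l w + wd l w' := by simp [wd]
      rw [e, List.length_append]
      omega
  exact this (Submodule.mul_mem_mul hx hy)

lemma FJ_mul {d d' : ℤ} {k k' : ℕ} {x y : R} (hx : x ∈ D.Fil d k) (hy : y ∈ D.FJ d' k') :
    x * y ∈ D.FJ (d + d') (k + k') := by
  obtain ⟨a, ha, b, hb, rfl⟩ := Submodule.mem_sup.1 hy
  rw [mul_add]
  exact add_mem (D.Fil_le_FJ _ _ (D.Fil_mul hx ha)) (D.J_le_FJ _ _ (D.J_mul _ hb))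

lemma X_Fil (β : Bool) {i j : Fin n} (h : lev l i ≤ lev l j) :
    D.X β i j ∈ D.Fil (dg l i j) 1 := by
  apply Submodule.subset_span
  refine ⟨[(β, i, j)], ?_, by simp [pr], Or.inl ⟨by simp [wd], by simp⟩⟩
  intro d hd
  simp only [List.mem_singleton] at hd
  subst hd; exact h

lemma one_Fil : (1 : R) ∈ D.Fil 0 0 := by
  apply Submodule.subset_span
  refine ⟨[], ?_, by simp [pr], Or.inl ⟨by simp [wd], by simp⟩⟩
  intro d hd; simp at hd

lemma wd_ge {w : Wd n} (hw : ok l w) : (w.length : ℤ) ≤ wd l w := by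
  induction w with
  | nil => simp [wd]
  | cons d w ih =>
    have h1 := hw d (by simp)
    have h2 := ih (fun d hd => hw d (by simp [hd]))
    have e : wd l (d :: w) = dg l d.2.1 d.2.2 + wd l w := by simp [wd]
    rw [e, List.length_cons]
    unfold dg
    push_cast
    omega

lemma Fil_neg {d : ℤ} (k : ℕ) (h : d < 0) : D.Fil d k = ⊥ := by
  rw [eq_bot_iff, Fil, Submodule.span_le]
  rintro x ⟨w, hw, rfl, h1 | h1⟩ <;> have := wd_ge hw <;> omega

lemma FJ_neg {d : ℤ} (k : ℕ) (h : d < 0) : D.FJ d k = D.J := by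
  rw [FJ, D.Fil_neg k h, bot_sup_eq]

lemma FJ_long {d : ℤ} {k : ℕ} (h : d < k) : D.FJ d k ≤ D.FJ (d - 1) 0 := by
  apply sup_le_sup_right
  apply Submodule.span_mono
  rintro x ⟨w, hw, rfl, h1 | h1⟩
  · have := wd_ge hw; omega
  · exact ⟨w, hw, rfl, Or.inl ⟨h1, by simp⟩⟩

lemma chi_eq_zero_of_le {β : Bool} {i j : Fin n} (h : lev l i ≤ lev l j) :
    chi l β i j = 0 := by
  unfold chi; rw [if_neg]; omega

lemma chi_true {i j : Fin n} : chi l true i j = 0 := by simp [chi]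

lemma M_mul_X (γ β : Bool) (a b i j : Fin n) (u : R) :
    D.M γ a b * (D.X β i j * u) = sg γ β • (D.X β i j * (D.M γ a b * u))
      + kd b i • (D.X (xor γ β) a j * u) - (sg γ β * kd j a) • (D.X (xor γ β) i b * u) := by
  have h := D.rel γ β a b i j
  have hc : sg γ β * chi l γ a b = chi l γ a b := by
    cases γ
    · simp [sg]
    · simp [chi_true]
  simp only [M, sub_mul, ← mul_assoc, h, add_mul, smul_mul_assoc, mul_sub,
    Algebra.algebraMap_eq_smul_one, one_mul, mul_smul_comm, smul_sub, smul_smul, hc, mul_one]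
  abel

/-- The bracket term. -/
lemma bracket_mem {u : R} {d : ℤ} {k : ℕ} (hu : u ∈ D.FJ d k)
    (hM : ∀ (γ : Bool) (a b : Fin n), lev l b < lev l a →
      D.M γ a b * u ∈ D.FJ (d - (lev l a - lev l b)) 0) (δ : Bool) (p q : Fin n) :
    D.X δ p q * u - chi l δ p q • u ∈ D.FJ (d + dg l p q) (k + 1) := by
  by_cases h : lev l p ≤ lev l q
  · rw [chi_eq_zero_of_le h, zero_smul, sub_zero]
    have := D.FJ_mul (D.X_Fil δ h) hu
    rwa [add_comm, add_comm 1 k] at this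
  · have := hM δ p q (by omega)
    rw [M, sub_mul, ← Algebra.smul_def] at this
    exact D.FJ_lt (by unfold dg; omega) this

lemma M_mul_X_mem {u : R} {d : ℤ} {k : ℕ} (hu : u ∈ D.FJ d k)
    (hM : ∀ (γ : Bool) (a b : Fin n), lev l b < lev l a →
      D.M γ a b * u ∈ D.FJ (d - (lev l a - lev l b)) 0) (γ β : Bool) (a b i j : Fin n) :
    D.M γ a b * (D.X β i j * u) - sg γ β • (D.X β i j * (D.M γ a b * u))
      - (kd b i * chi l (xor γ β) a j - sg γ β * kd j a * chi l (xor γ β) i b) • u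
      ∈ D.FJ (d + dg l i j - (lev l a - lev l b)) (k + 1) := by
  have e : D.M γ a b * (D.X β i j * u) - sg γ β • (D.X β i j * (D.M γ a b * u))
      - (kd b i * chi l (xor γ β) a j - sg γ β * kd j a * chi l (xor γ β) i b) • u =
      kd b i • (D.X (xor γ β) a j * u - chi l (xor γ β) a j • u)
      - (sg γ β * kd j a) • (D.X (xor γ β) i b * u - chi l (xor γ β) i b • u) := by
    rw [M_mul_X]; module
  rw [e]
  apply sub_mem
  · by_cases h : b = i
    · subst h
      apply Submodule.smul_mem
      have := D.bracket_mem hu hM (xor γ β) a j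
      refine D.FJ_mono (le_of_eq ?_) le_rfl this
      unfold dg; ring
    · simp [kd, h]
  · by_cases h : j = a
    · subst h
      apply Submodule.smul_mem
      have := D.bracket_mem hu hM (xor γ β) i b
      refine D.FJ_mono (le_of_eq ?_) le_rfl this
      unfold dg; ring
    · simp [kd, h]

lemma pr_mem {w : Wd n} (hw : ok l w) : D.pr w ∈ D.Fil (wd l w) w.length :=
  Submodule.subset_span ⟨w, hw, rfl, Or.inl ⟨le_rfl, le_rfl⟩⟩

lemma M_mul_pr {w : Wd n} (hw : ok l w) (γ : Bool) (a b : Fin n) (hab : lev l b < lev l a) :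
    D.M γ a b * D.pr w ∈ D.FJ (wd l w - (lev l a - lev l b)) (w.length - 1) := by
  induction w generalizing γ a b with
  | nil =>
    simp only [pr, List.map_nil, List.prod_nil, mul_one]
    exact D.J_le_FJ _ _ (D.M_mem γ hab)
  | cons x w ih =>
    have hw' : ok l w := fun d hd => hw d (by simp [hd])
    have hx := hw x (by simp)
    have e : D.pr (x :: w) = D.X x.1 x.2.1 x.2.2 * D.pr w := by simp [pr]
    have e' : wd l (x :: w) = dg l x.2.1 x.2.2 + wd l w := by simp [wd]
    have hu := D.Fil_le_FJ _ _ (D.pr_mem hw')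
    have key := D.M_mul_X_mem hu (fun γ a b h => D.FJ_mono le_rfl (Nat.zero_le _) (ih hw' γ a b h))
      γ x.1 a b x.2.1 x.2.2
    rw [e, e', List.length_cons, Nat.add_sub_cancel]
    have h1 := D.FJ_mul (D.X_Fil x.1 hx) (ih hw' γ a b hab)
    have hA : sg γ x.1 • (D.X x.1 x.2.1 x.2.2 * (D.M γ a b * D.pr w)) ∈
        D.FJ (dg l x.2.1 x.2.2 + wd l w - (lev l a - lev l b)) w.length :=
      Submodule.smul_mem _ _ (D.FJ_mono (by omega) (by omega) h1)
    have hB : (kd b x.2.1 * chi l (xor γ x.1) a x.2.2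
        - sg γ x.1 * kd x.2.2 a * chi l (xor γ x.1) x.2.1 b) • D.pr w ∈
        D.FJ (dg l x.2.1 x.2.2 + wd l w - (lev l a - lev l b)) w.length := by
      by_cases hz : kd b x.2.1 * chi l (xor γ x.1) a x.2.2
        - sg γ x.1 * kd x.2.2 a * chi l (xor γ x.1) x.2.1 b = 0
      · rw [hz, zero_smul]; exact zero_mem _
      · apply Submodule.smul_mem
        refine D.FJ_mono ?_ le_rfl hu
        by_cases h1 : b = x.2.1 ∧ lev l a = lev l x.2.2 + 1
        · unfold dg; rw [h1.2, h1.1]; push_cast; omega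
        · by_cases h2 : x.2.2 = a ∧ lev l x.2.1 = lev l b + 1
          · unfold dg; rw [h2.2, h2.1]; push_cast; omega
          · exfalso; apply hz
            have z1 : kd b x.2.1 * chi l (xor γ x.1) a x.2.2 = 0 := by
              by_cases h : b = x.2.1
              · have : chi l (xor γ x.1) a x.2.2 = 0 := by
                  unfold chi; rw [if_neg]; rintro ⟨-, -, h'⟩; exact h1 ⟨h, h'⟩
                rw [this, mul_zero]
              · simp [kd, h]
            have z2 : kd x.2.2 a * chi l (xor γ x.1) x.2.1 b = 0 := by
              by_cases h : x.2.2 = a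
              · have : chi l (xor γ x.1) x.2.1 b = 0 := by
                  unfold chi; rw [if_neg]; rintro ⟨-, -, h'⟩; exact h2 ⟨h, h'⟩
                rw [this, mul_zero]
              · simp [kd, h]
            rw [z1, mul_assoc, z2, mul_zero, sub_zero]
    have hC := D.FJ_mono (d' := dg l x.2.1 x.2.2 + wd l w - (lev l a - lev l b))
      (by omega) (Nat.le_succ _) key
    have := add_mem (add_mem hC hB) hA
    convert this using 1
    abel

/-- `a - χ(a)` lowers the filtration. -/
lemma M_mul_mem {u : R} {d : ℤ} {k : ℕ} (hu : u ∈ D.FJ d k) (γ : Bool) (a b : Fin n)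
    (hab : lev l b < lev l a) :
    D.M γ a b * u ∈ D.FJ (d - (lev l a - lev l b)) (k - 1) := by
  obtain ⟨x, hx, y, hy, rfl⟩ := Submodule.mem_sup.1 hu
  rw [mul_add]
  refine add_mem ?_ (D.J_le_FJ _ _ (D.J_mul _ hy))
  clear hu
  unfold Fil at hx
  induction hx using Submodule.span_induction with
  | mem x h =>
    obtain ⟨w, hw, rfl, h | h⟩ := h
    · exact D.FJ_mono (by omega) (by omega) (D.M_mul_pr hw γ a b hab)
    · exact D.FJ_lt (by omega) (D.M_mul_pr hw γ a b hab)
  | zero => rw [mul_zero]; exact zero_mem _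
  | add x y _ _ hx hy => rw [mul_add]; exact add_mem hx hy
  | smul c x _ hx => rw [mul_smul_comm]; exact Submodule.smul_mem _ _ hx

lemma M_mul_X_mem' {u : R} {d : ℤ} {k : ℕ} (hu : u ∈ D.FJ d k) (γ β : Bool) (a b i j : Fin n) :
    D.M γ a b * (D.X β i j * u) - sg γ β • (D.X β i j * (D.M γ a b * u))
      - (kd b i * chi l (xor γ β) a j - sg γ β * kd j a * chi l (xor γ β) i b) • u
      ∈ D.FJ (d + dg l i j - (lev l a - lev l b)) (k + 1) :=
  D.M_mul_X_mem hu (fun γ a b h => D.FJ_mono le_rfl (Nat.zero_le _) (D.M_mul_mem hu γ a b h))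
    γ β a b i j

/-- Everything lies in the filtration. -/
lemma exists_FJ (y : R) : ∃ d : ℕ, y ∈ D.FJ d 0 := by
  have key : ∀ a ∈ Algebra.adjoin ℂ {x | ∃ β i j, x = D.X β i j}, ∀ y : R,
      (∃ d : ℕ, y ∈ D.FJ d 0) → ∃ d : ℕ, a * y ∈ D.FJ d 0 := by
    intro a ha
    induction ha using Algebra.adjoin_induction with
    | mem x h =>
      obtain ⟨β, i, j, rfl⟩ := h
      rintro y ⟨d, hy⟩
      have := D.bracket_mem hy (fun γ a b h => D.FJ_mono le_rfl (Nat.zero_le _)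
        (D.M_mul_mem hy γ a b h)) β i j
      refine ⟨d + (dg l i j).natAbs, ?_⟩
      have h1 := D.FJ_mono (d' := ((d + (dg l i j).natAbs : ℕ) : ℤ)) (k' := 0)
        (by omega) (by omega) this
      have h2 := D.FJ_mono (d' := ((d + (dg l i j).natAbs : ℕ) : ℤ)) (k' := 0)
        (by omega) (by omega) hy
      have := add_mem h1 (Submodule.smul_mem _ (chi l β i j) h2)
      rwa [sub_add_cancel] at this
    | algebraMap r =>
      rintro y ⟨d, hy⟩
      exact ⟨d, by rw [← Algebra.smul_def]; exact Submodule.smul_mem _ _ hy⟩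
    | add a b _ _ ha hb =>
      rintro y hy
      obtain ⟨d, h1⟩ := ha y hy
      obtain ⟨e, h2⟩ := hb y hy
      refine ⟨d + e, ?_⟩
      rw [add_mul]
      exact add_mem (D.FJ_mono (by push_cast; omega) le_rfl h1)
        (D.FJ_mono (by push_cast; omega) le_rfl h2)
    | mul a b _ _ ha hb =>
      rintro y hy
      rw [mul_assoc]
      exact ha _ (hb y hy)
  have := key y (by rw [D.gen]; trivial) 1 ⟨0, D.Fil_le_FJ _ _ D.one_Fil⟩
  rwa [mul_one] at this

end Dat
end QW

namespace QW

/-! ## Part 3: the Euler operator -/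

lemma mod_succ_eq {l a : ℕ} (h : a % l + 1 < l) : (a + 1) % l = a % l + 1 := by
  rw [Nat.add_mod, Nat.mod_eq_of_lt (show 1 < l by omega), Nat.mod_eq_of_lt h]

lemma mod_pred_eq {l a : ℕ} (hl : 0 < l) (h : 0 < a % l) : (a - 1) % l + 1 = a % l := by
  have h1 := Nat.div_add_mod a l
  have h3 := Nat.mod_lt a hl
  have : a - 1 = (a % l - 1) + l * (a / l) := by omega
  rw [this, Nat.add_mul_mod_self_left, Nat.mod_eq_of_lt (by omega)]
  omega

lemma add_lt_of_dvd {l n a t : ℕ} (hd : l ∣ n) (ha : a < n) (h : a % l + t < l) : a + t < n := by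
  obtain ⟨m, rfl⟩ := hd
  have h1 := Nat.div_add_mod a l
  have h2 : a / l < m := Nat.div_lt_of_lt_mul ha
  have h3 : l * (a / l + 1) ≤ l * m := Nat.mul_le_mul_left _ h2
  rw [Nat.mul_succ] at h3
  omega

/-- Predecessor. -/
def pred {n : ℕ} (i : Fin n) : Fin n := ⟨i.val - 1, by omega⟩

lemma lev_pred {l n : ℕ} (hl : 0 < l) {i : Fin n} (h : 0 < lev l i) :
    lev l (pred i) + 1 = lev l i := mod_pred_eq hl h

lemma lev_pos_val {l n : ℕ} {i : Fin n} (h : 0 < lev l i) : 0 < i.val := by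
  by_contra h'
  have : i.val = 0 := by omega
  simp [lev, this] at h

lemma sg_sq (β γ : Bool) : sg β γ * sg β γ = 1 := by
  cases β <;> cases γ <;> simp

namespace Dat

variable {n l : ℕ} {R : Type} [Ring R] [Algebra ℂ R] (D : Dat n l R)

/-- Dual elements, recursive form. -/
def yv (β : Bool) : ℕ → Fin n → Fin n → R
  | 0, i, c => D.X β i (pred c)
  | t + 1, i, c => D.X β i (pred c) + sg β β • yv β t (pred i) (pred c)

/-- Dual elements. -/
def Y (β : Bool) (i c : Fin n) : R := D.yv β (lev l i) i c

lemma yv_mem (β : Bool) (t : ℕ) (i c : Fin n) (ht : t ≤ lev l i) (h : lev l i < lev l c) :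
    D.yv β t i c ∈ D.Fil (lev l c - lev l i) 1 := by
  induction t generalizing i c with
  | zero =>
    have h1 := lev_pred D.hl (i := c) (by omega)
    exact D.Fil_mono (by unfold dg; omega) le_rfl (D.X_Fil β (i := i) (j := pred c) (by omega))
  | succ t ih =>
    have h1 := lev_pred D.hl (i := c) (by omega)
    have h2 := lev_pred D.hl (i := i) (by omega)
    refine add_mem ?_ (Submodule.smul_mem _ _ ?_)
    · exact D.Fil_mono (by unfold dg; omega) le_rfl (D.X_Fil β (i := i) (j := pred c) (by omega))
    · exact D.Fil_mono (by omega) le_rfl (ih (pred i) (pred c) (by omega) (by omega))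

lemma Y_mem (β : Bool) (i c : Fin n) (h : lev l i < lev l c) :
    D.Y β i c ∈ D.Fil (lev l c - lev l i) 1 := D.yv_mem β _ i c le_rfl h

/-- Supercommutators of letters have lower degree. -/
lemma X_comm (β γ : Bool) (i j k m : Fin n) (h : lev l i ≤ lev l j) (h' : lev l k ≤ lev l m) :
    D.X β i j * D.X γ k m - sg β γ • (D.X γ k m * D.X β i j) ∈
      D.Fil (dg l i j + dg l k m - 1) 0 := by
  rw [D.rel β γ i j k m]
  have e : ∀ a b c : R, a + b - c - a = b - c := by intros; abel
  rw [e]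
  apply sub_mem
  · by_cases hh : j = k
    · subst hh
      apply Submodule.smul_mem
      exact D.Fil_mono (by unfold dg; omega) (by omega) (D.X_Fil (xor β γ) (i := i) (j := m) (by omega))
    · simp [kd, hh]
  · by_cases hh : m = i
    · subst hh
      apply Submodule.smul_mem
      exact D.Fil_mono (by unfold dg; omega) (by omega) (D.X_Fil (xor β γ) (i := k) (j := j) (by omega))
    · simp [kd, hh]

lemma yv_comm (β γ : Bool) (t : ℕ) (i c k m : Fin n) (ht : t ≤ lev l i) (h : lev l i < lev l c)
    (h' : lev l k ≤ lev l m) :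
    D.yv β t i c * D.X γ k m - sg β γ • (D.X γ k m * D.yv β t i c) ∈
      D.Fil ((lev l c - lev l i) + dg l k m - 1) 0 := by
  induction t generalizing i c with
  | zero =>
    have h1 := lev_pred D.hl (i := c) (by omega)
    exact D.Fil_mono (by unfold dg; omega) le_rfl
      (D.X_comm β γ i (pred c) k m (by omega) h')
  | succ t ih =>
    have h1 := lev_pred D.hl (i := c) (by omega)
    have h2 := lev_pred D.hl (i := i) (by omega)
    have hA := D.Fil_mono (d' := (lev l c - lev l i) + dg l k m - 1) (k' := 0)
      (by unfold dg; omega) le_rfl (D.X_comm β γ i (pred c) k m (by omega) h')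
    have hB := D.Fil_mono (d' := (lev l c - lev l i) + dg l k m - 1) (k' := 0)
      (by omega) le_rfl (ih (pred i) (pred c) (by omega) (by omega))
    have := add_mem hA (Submodule.smul_mem _ (sg β β) hB)
    convert this using 1
    simp only [yv, add_mul, mul_add, smul_mul_assoc, mul_smul_comm, smul_sub, smul_add]
    rw [smul_comm (sg β γ) (sg β β)]
    abel

/-- The Euler element. -/
def Ee : R := ∑ g : Bool × Fin n × Fin n,
  if lev l g.2.2 < lev l g.2.1 then D.Y g.1 g.2.2 g.2.1 * D.M g.1 g.2.1 g.2.2 else 0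

lemma Ee_mul (u : R) : D.Ee * u = ∑ g : Bool × Fin n × Fin n,
    if lev l g.2.2 < lev l g.2.1 then D.Y g.1 g.2.2 g.2.1 * (D.M g.1 g.2.1 g.2.2 * u) else 0 := by
  rw [Ee, Finset.sum_mul]
  refine Finset.sum_congr rfl fun g _ => ?_
  split_ifs <;> simp [mul_assoc]

lemma Ee_Inv {u : R} (hu : D.Inv u) : D.Ee * u ∈ D.J := by
  rw [Ee_mul]
  refine sum_mem fun g _ => ?_
  split_ifs with h
  · exact D.J_mul _ (hu _ _ _ h)
  · exact zero_mem _

lemma Ee_mem {u : R} {d : ℤ} {k : ℕ} (hu : u ∈ D.FJ d k) : D.Ee * u ∈ D.FJ d k := by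
  rw [Ee_mul]
  refine sum_mem fun g _ => ?_
  split_ifs with h
  · have := D.FJ_mul (D.Y_mem g.1 _ _ h) (D.M_mul_mem hu g.1 _ _ h)
    exact D.FJ_mono (by omega) (by omega) this
  · exact zero_mem _

lemma duality (β' : Bool) (i' j' : Fin n) (h : lev l i' ≤ lev l j') (h' : lev l j' + 1 < l) :
    (∑ g : Bool × Fin n × Fin n, if lev l g.2.2 < lev l g.2.1 then
      (kd g.2.2 i' * chi l (xor g.1 β') g.2.1 j'
        - sg g.1 β' * kd j' g.2.1 * chi l (xor g.1 β') i' g.2.2) • D.Y g.1 g.2.2 g.2.1 else 0)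
      = D.X β' i' j' := by
  have hs : j'.val + 1 < n := add_lt_of_dvd D.hdvd j'.isLt h'
  have hls : lev l (⟨j'.val + 1, hs⟩ : Fin n) = lev l j' + 1 := mod_succ_eq h'
  have hA : (∑ g : Bool × Fin n × Fin n, if lev l g.2.2 < lev l g.2.1 then
      (kd g.2.2 i' * chi l (xor g.1 β') g.2.1 j') • D.Y g.1 g.2.2 g.2.1 else 0)
      = D.Y β' i' ⟨j'.val + 1, hs⟩ := by
    rw [Finset.sum_eq_single (β', ⟨j'.val + 1, hs⟩, i')]
    · rw [if_pos (by simp only; omega)]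
      simp [kd, chi, hls]
    · rintro ⟨β, c, i⟩ - hne
      by_cases h1 : i = i'
      · have : chi l (xor β β') c j' = 0 := by
          unfold chi; rw [if_neg]
          rintro ⟨h2, h3, h4⟩
          apply hne
          have : β = β' := by revert h2; cases β <;> cases β' <;> simp
          subst this; subst h1
          congr 2
          exact Fin.ext h3
        simp [this]
      · simp [kd, h1]
    · simp
  have hB : (∑ g : Bool × Fin n × Fin n, if lev l g.2.2 < lev l g.2.1 then
      (sg g.1 β' * kd j' g.2.1 * chi l (xor g.1 β') i' g.2.2) • D.Y g.1 g.2.2 g.2.1 else 0)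
      = if 0 < lev l i' then sg β' β' • D.Y β' (pred i') j' else 0 := by
    by_cases h0 : 0 < lev l i'
    · have hp := lev_pred D.hl h0
      have hv := lev_pos_val h0
      rw [if_pos h0, Finset.sum_eq_single (β', j', pred i')]
      · rw [if_pos (by simp only; omega)]
        have : chi l (xor β' β') i' (pred i') = 1 := by
          unfold chi; rw [if_pos]; refine ⟨by simp, ?_, by omega⟩
          simp only [pred]; omega
        rw [this]; simp [kd]
      · rintro ⟨β, c, i⟩ - hne
        by_cases h1 : j' = c
        · have : chi l (xor β β') i' i = 0 := by
            unfold chi; rw [if_neg]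
            rintro ⟨h2, h3, h4⟩
            apply hne
            have : β = β' := by revert h2; cases β <;> cases β' <;> simp
            subst this; subst h1
            congr 2
            apply Fin.ext
            simp only [pred]; omega
          simp [this]
        · simp [kd, h1]
      · simp
    · rw [if_neg h0]
      refine Finset.sum_eq_zero fun g _ => ?_
      have : chi l (xor g.1 β') i' g.2.2 = 0 := by
        unfold chi; rw [if_neg]; rintro ⟨-, -, h4⟩; omega
      simp [this]
  have e : (∑ g : Bool × Fin n × Fin n, if lev l g.2.2 < lev l g.2.1 then
      (kd g.2.2 i' * chi l (xor g.1 β') g.2.1 j'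
        - sg g.1 β' * kd j' g.2.1 * chi l (xor g.1 β') i' g.2.2) • D.Y g.1 g.2.2 g.2.1 else 0)
      = D.Y β' i' ⟨j'.val + 1, hs⟩ -
        if 0 < lev l i' then sg β' β' • D.Y β' (pred i') j' else 0 := by
    rw [← hA, ← hB, ← Finset.sum_sub_distrib]
    refine Finset.sum_congr rfl fun g _ => ?_
    split_ifs
    · rw [sub_smul]
    · rw [sub_zero]
  rw [e]
  have hpp : pred (⟨j'.val + 1, hs⟩ : Fin n) = j' := by
    apply Fin.ext; simp [pred]
  by_cases h0 : 0 < lev l i'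
  · rw [if_pos h0]
    have hp := lev_pred D.hl h0
    unfold Y
    rw [← hp]
    simp only [yv, hpp]
    abel
  · rw [if_neg h0]
    have : lev l i' = 0 := by omega
    unfold Y
    rw [this]
    simp only [yv, hpp]
    abel

lemma Ee_X_mul {u : R} {d : ℤ} {k : ℕ} (hu : u ∈ D.FJ d k) (β' : Bool) (i' j' : Fin n)
    (h : lev l i' ≤ lev l j') (h' : lev l j' + 1 < l) :
    D.Ee * (D.X β' i' j' * u) - D.X β' i' j' * (D.Ee * u) - D.X β' i' j' * u ∈
      D.FJ (d + dg l i' j') (k + 2) := by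
  have e : D.X β' i' j' * u = ∑ g : Bool × Fin n × Fin n, if lev l g.2.2 < lev l g.2.1 then
      D.Y g.1 g.2.2 g.2.1 * ((kd g.2.2 i' * chi l (xor g.1 β') g.2.1 j'
        - sg g.1 β' * kd j' g.2.1 * chi l (xor g.1 β') i' g.2.2) • u) else 0 := by
    conv_lhs => rw [← D.duality β' i' j' h h', Finset.sum_mul]
    refine Finset.sum_congr rfl fun g _ => ?_
    split_ifs
    · rw [smul_mul_assoc, mul_smul_comm]
    · rw [zero_mul]
  conv => enter [2, 2]; rw [e]
  rw [Ee_mul, Ee_mul, Finset.mul_sum, ← Finset.sum_sub_distrib, ← Finset.sum_sub_distrib]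
  refine sum_mem fun g _ => ?_
  split_ifs with hg
  · have h1 := D.FJ_mul (D.Y_mem g.1 _ _ hg) (D.M_mul_X_mem' hu g.1 β' g.2.1 g.2.2 i' j')
    have h2 := D.FJ_mul (D.yv_comm g.1 β' _ g.2.2 g.2.1 i' j' le_rfl hg h)
      (D.M_mul_mem hu g.1 _ _ hg)
    have h1' := D.FJ_mono (d' := d + dg l i' j') (k' := k + 2) (by omega) (by omega) h1
    have h2' := D.FJ_lt (d' := d + dg l i' j') (k' := k + 2) (by omega) h2
    have := add_mem h1' (Submodule.smul_mem _ (sg g.1 β') h2')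
    convert this using 1
    change _ = _ + sg g.1 β' • ((D.Y g.1 g.2.2 g.2.1 * _ - _ • (_ * D.Y g.1 g.2.2 g.2.1)) * _)
    simp only [mul_sub, sub_mul, smul_sub, mul_smul_comm, smul_mul_assoc, smul_smul, sg_sq,
      one_smul, mul_assoc]
    abel
  · simp

end Dat
end QW

namespace QW

/-! ## Part 4: the elements `T` modulo the left ideal -/

namespace Dat

variable {n l : ℕ} {R : Type} [Ring R] [Algebra ℂ R] (D : Dat n l R)

/-- The `p`-part of the recursion. -/
def Sp (s : ℕ) (β : Bool) (i j : Fin n) : R := ∑ γ : Bool, ∑ k : Fin n,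
  if lev l i ≤ lev l k then pw s γ • (D.X γ i k * D.T s (xor β γ) k j) else 0

/-- Lower neighbour term. -/
def Tp (s : ℕ) (β : Bool) (i j : Fin n) : R := if 0 < lev l i then D.T s β (pred i) j else 0

lemma pw_mul_pw (s : ℕ) : pw s true * pw (s + 1) true = -1 := by
  simp only [pw_t, ← pow_add]
  rw [show s + (s + 1) = 2 * s + 1 by ring, pow_succ, pow_mul]; norm_num

lemma recJ (s : ℕ) (β : Bool) (i j : Fin n) (hj : lev l j = 0) :
    D.T (s + 1) β i j - D.Tp s β i j - D.Sp s β i j ∈ D.J := by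
  have hk : ∀ γ k, lev l k < lev l i →
      D.X γ i k * D.T s (xor β γ) k j - pw (s + 1) γ • D.T s β i j
        - chi l γ i k • D.T s β k j ∈ D.J := by
    intro γ k hki
    have hne : j ≠ i := by rintro rfl; omega
    have h1 := D.XT s γ (xor β γ) i k k j
    have h2 := D.J.smul_mem (sg γ (xor β γ)) (D.J_mul (D.T s (xor β γ) k j) (D.M_mem γ hki))
    rw [h1]
    convert h2 using 1
    have e1 : xor (xor β γ) γ = β := by cases β <;> cases γ <;> rfl
    have e2 : chi l γ i k • D.T s β k j = (sg γ (xor β γ) * chi l γ i k) • D.T s (xor β γ) k j := by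
      cases γ
      · cases β <;> simp
      · simp [chi_true]
    rw [e1, e2]
    simp only [kd, hne, if_true, if_false, M, mul_sub, Algebra.algebraMap_eq_smul_one,
      mul_smul_comm, mul_one, smul_sub, smul_smul]
    module
  have e : D.T (s + 1) β i j - D.Tp s β i j - D.Sp s β i j =
      ∑ k : Fin n, if lev l k < lev l i then
        (∑ γ : Bool, pw s γ • (D.X γ i k * D.T s (xor β γ) k j - pw (s + 1) γ • D.T s β i j
        - chi l γ i k • D.T s β k j)) else 0 := by
    have eT : D.Tp s β i j = ∑ k : Fin n, if lev l k < lev l i then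
        chi l false i k • D.T s β k j else 0 := by
      unfold Tp
      by_cases h0 : 0 < lev l i
      · have hp := lev_pred D.hl h0
        have hv := lev_pos_val h0
        rw [if_pos h0, Finset.sum_eq_single (pred i)]
        · rw [if_pos (by omega)]
          have : chi l false i (pred i) = 1 := by
            unfold chi; rw [if_pos]; refine ⟨by simp, ?_, by omega⟩
            simp only [pred]; omega
          rw [this, one_smul]
        · intro k _ hne
          have : chi l false i k = 0 := by
            unfold chi; rw [if_neg]
            rintro ⟨-, h3, h4⟩
            apply hne
            apply Fin.ext
            simp only [pred]; omega
          simp [this]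
        · simp
      · rw [if_neg h0]
        symm
        refine Finset.sum_eq_zero fun k _ => ?_
        rw [if_neg (by omega)]
    rw [D.T_succ, eT, Sp, Finset.sum_comm (γ := Bool), Finset.sum_comm (γ := Bool),
      ← Finset.sum_sub_distrib, ← Finset.sum_sub_distrib]
    refine Finset.sum_congr rfl fun k _ => ?_
    by_cases hki : lev l k < lev l i
    · rw [if_pos hki, if_pos hki]
      have : ¬ lev l i ≤ lev l k := by omega
      simp only [this, if_false, Finset.sum_const_zero, Fintype.sum_bool, chi_true, zero_smul,
        sub_zero, smul_sub, smul_smul, pw_mul_pw]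
      simp only [pw_f]
      module
    · rw [if_neg hki, if_neg hki]
      have : lev l i ≤ lev l k := by omega
      simp [this]
  rw [e]
  refine sum_mem fun k _ => ?_
  split_ifs with hki
  · exact sum_mem fun γ _ => D.J.smul_mem _ (hk γ k hki)
  · exact zero_mem _

lemma T_mem (s : ℕ) (β : Bool) (i j : Fin n) (hj : lev l j = 0) :
    D.T s β i j ∈ D.FJ (s - lev l i) (if lev l i < s then 1 else 0) := by
  induction s generalizing β i with
  | zero =>
    rw [D.T_zero]
    by_cases h : i = j
    · subst h
      rw [Algebra.algebraMap_eq_smul_one]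
      apply Submodule.smul_mem
      exact D.FJ_mono (by omega) (by simp) (D.Fil_le_FJ _ _ D.one_Fil)
    · simp [kd, h]
  | succ s ih =>
    have h := D.recJ s β i j hj
    have h1 : D.Tp s β i j ∈ D.FJ ((s + 1 : ℕ) - lev l i) (if lev l i < s + 1 then 1 else 0) := by
      unfold Tp
      by_cases h0 : 0 < lev l i
      · rw [if_pos h0]
        have hp := lev_pred D.hl h0
        refine D.FJ_mono (by omega) ?_ (ih β (pred i))
        split_ifs <;> omega
      · rw [if_neg h0]
        exact zero_mem _
    have h2 : D.Sp s β i j ∈ D.FJ ((s + 1 : ℕ) - lev l i) (if lev l i < s + 1 then 1 else 0) := by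
      unfold Sp
      refine sum_mem fun γ _ => sum_mem fun k _ => ?_
      by_cases hk : lev l i ≤ lev l k
      · rw [if_pos hk]
        apply Submodule.smul_mem
        have := D.FJ_mul (D.X_Fil γ hk) (ih (xor β γ) k)
        refine D.FJ_mono (by unfold dg; push_cast; omega) ?_ this
        split_ifs <;> omega
      · rw [if_neg hk]
        exact zero_mem _
    have := add_mem (add_mem (D.J_le_FJ _ _ h) h2) h1
    convert this using 1
    abel

lemma T_J (s : ℕ) (β : Bool) (i j : Fin n) (hj : lev l j = 0) (h : s < lev l i) :
    D.T s β i j ∈ D.J := by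
  have := D.T_mem s β i j hj
  rwa [D.FJ_neg _ (by omega)] at this

lemma T_diag (s : ℕ) (β : Bool) (i j : Fin n) (hj : lev l j = 0) (hi : lev l i = s) :
    D.T s β i j - algebraMap ℂ R (if β = false ∧ i.val = j.val + s then 1 else 0) ∈ D.J := by
  induction s generalizing β i with
  | zero =>
    rw [D.T_zero]
    have : (if β = true then 0 else kd i j) = (if β = false ∧ i.val = j.val + 0 then (1 : ℂ) else 0) := by
      cases β <;> simp [kd, Fin.ext_iff]
    rw [this, sub_self]
    exact zero_mem _
  | succ s ih =>
    have h := D.recJ s β i j hj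
    have h0 : 0 < lev l i := by omega
    have hp := lev_pred D.hl h0
    have hv := lev_pos_val h0
    have h1 := ih β (pred i) (by omega)
    have h2 : D.Sp s β i j ∈ D.J := by
      unfold Sp
      refine sum_mem fun γ _ => sum_mem fun k _ => ?_
      split_ifs with hk
      · exact Submodule.smul_mem _ _ (D.J_mul _ (D.T_J _ _ _ _ hj (by omega)))
      · exact zero_mem _
    have e : (β = false ∧ (pred i).val = j.val + s) = (β = false ∧ i.val = j.val + (s + 1)) := by
      simp only [pred, eq_iff_iff]
      constructor <;> rintro ⟨a, b⟩ <;> exact ⟨a, by omega⟩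
    have := add_mem (add_mem h h1) h2
    simp only [e] at this
    rw [Tp, if_pos h0] at this
    convert this using 1
    abel

lemma Sp_term {s : ℕ} (β γ : Bool) (i j k : Fin n) (hj : lev l j = 0) (hk : lev l i ≤ lev l k)
    (hs : lev l k ≠ s) :
    D.X γ i k * D.T s (xor β γ) k j ∈ D.FJ ((s + 1 : ℕ) - lev l i) 2 := by
  by_cases h : lev l k < s
  · have := D.T_mem s (xor β γ) k j hj
    rw [if_pos h] at this
    exact D.FJ_mono (by unfold dg; push_cast; omega) (by omega) (D.FJ_mul (D.X_Fil γ hk) this)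
  · exact D.J_le_FJ _ _ (D.J_mul _ (D.T_J _ _ _ _ hj (by omega)))

lemma step2 {s : ℕ} (hs : l ≤ s) (β : Bool) (i j : Fin n) (hj : lev l j = 0) :
    D.T (s + 1) β i j - D.Tp s β i j ∈ D.FJ ((s + 1 : ℕ) - lev l i) 2 := by
  have h := D.J_le_FJ ((s + 1 : ℕ) - lev l i) 2 (D.recJ s β i j hj)
  have h2 : D.Sp s β i j ∈ D.FJ ((s + 1 : ℕ) - lev l i) 2 := by
    unfold Sp
    refine sum_mem fun γ _ => sum_mem fun k _ => ?_
    split_ifs with hk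
    · have : lev l k < l := Nat.mod_lt _ D.hl
      exact Submodule.smul_mem _ _ (D.Sp_term β γ i j k hj hk (by omega))
    · exact zero_mem _
  have := add_mem h h2
  rwa [sub_add_cancel] at this

lemma step1 {s : ℕ} (β : Bool) (i j k0 : Fin n) (hj : lev l j = 0)
    (his : lev l i ≤ s) (hk0 : k0.val = j.val + s) (hk1 : lev l k0 = s) :
    D.T (s + 1) β i j - D.Tp s β i j - pw s β • D.X β i k0 ∈ D.FJ ((s + 1 : ℕ) - lev l i) 2 := by
  have h := D.J_le_FJ ((s + 1 : ℕ) - lev l i) 2 (D.recJ s β i j hj)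
  have h2 : D.Sp s β i j - pw s β • D.X β i k0 ∈ D.FJ ((s + 1 : ℕ) - lev l i) 2 := by
    have e : pw s β • D.X β i k0 = ∑ γ : Bool, ∑ k : Fin n,
        if γ = β ∧ k = k0 then pw s β • D.X β i k0 else 0 := by
      rw [Finset.sum_eq_single β, Finset.sum_eq_single k0]
      · simp
      · intro k _ hk; simp [hk]
      · simp
      · intro γ _ hk; simp [hk]
      · simp
    unfold Sp
    rw [e, ← Finset.sum_sub_distrib]
    refine sum_mem fun γ _ => ?_
    rw [← Finset.sum_sub_distrib]
    refine sum_mem fun k _ => ?_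
    by_cases hks : lev l k = s
    · rw [if_pos (by omega)]
      apply D.J_le_FJ
      have h1 := D.J.smul_mem (pw s γ) (D.J_mul (D.X γ i k) (D.T_diag s (xor β γ) k j hj hks))
      convert h1 using 1
      by_cases hc : γ = β ∧ k = k0
      · obtain ⟨rfl, rfl⟩ := hc
        simp [hk0, mul_sub, smul_sub]
      · rw [if_neg hc, if_neg, map_zero, sub_zero, sub_zero]
        rintro ⟨h3, h4⟩
        apply hc
        refine ⟨by revert h3; cases β <;> cases γ <;> simp, Fin.ext (by omega)⟩
    · have : ¬ (γ = β ∧ k = k0) := by rintro ⟨-, rfl⟩; exact hks hk1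
      rw [if_neg this, sub_zero]
      split_ifs with hk
      · exact Submodule.smul_mem _ _ (D.Sp_term β γ i j k hj hk hks)
      · exact zero_mem _
  have := add_mem h h2
  convert this using 1
  abel

/-- Linear combinations of letters outside the last column, plus longer words. -/
def V (d : ℤ) : Submodule ℂ R :=
  Submodule.span ℂ {x | ∃ γ p q, lev l p ≤ lev l q ∧ lev l q + 1 < l ∧ dg l p q = d ∧
    x = D.X γ p q} ⊔ D.FJ d 2

lemma FJ_le_V (d : ℤ) : D.FJ d 2 ≤ D.V d := le_sup_right

lemma exists_shift (hd : l ∣ n) (j : Fin n) (s : ℕ) (h : lev l j + s < l) :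
    ∃ k : Fin n, k.val = j.val + s ∧ lev l k = lev l j + s := by
  refine ⟨⟨j.val + s, add_lt_of_dvd hd j.isLt h⟩, rfl, ?_⟩
  change (j.val + s) % l = j.val % l + s
  change j.val % l + s < l at h
  rw [Nat.add_mod, Nat.mod_eq_of_lt (show s < l by omega), Nat.mod_eq_of_lt h]

lemma linA (s : ℕ) (hs : s + 1 ≤ l) (β : Bool) (i j : Fin n) (hj : lev l j = 0)
    (hi : lev l i < s) : D.T s β i j ∈ D.V (s - lev l i) := by
  induction s generalizing i with
  | zero => omega
  | succ s ih =>
    obtain ⟨k0, h1, h2⟩ := exists_shift D.hdvd j s (by omega)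
    have h := D.FJ_le_V _ (D.step1 β i j k0 hj (by omega) h1 (by omega))
    have h3 : D.X β i k0 ∈ D.V ((s + 1 : ℕ) - lev l i) :=
      (le_sup_left : _ ≤ D.V _) (Submodule.subset_span
        ⟨β, i, k0, by omega, by omega, by unfold dg; push_cast; omega, rfl⟩)
    have h4 : D.Tp s β i j ∈ D.V ((s + 1 : ℕ) - lev l i) := by
      unfold Tp
      split_ifs with h0
      · have hp := lev_pred D.hl h0
        have := ih (by omega) (pred i) (by omega)
        convert this using 2
        push_cast; omega
      · exact zero_mem _
    have := add_mem (add_mem h (Submodule.smul_mem _ (pw s β) h3)) h4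
    rwa [sub_add_cancel, sub_add_cancel] at this

lemma linC (t : ℕ) (β : Bool) (i j p q : Fin n) (hj : lev l j = 0) (ht : t ≤ lev l i)
    (hq : q.val + 1 = j.val + l) (hql : lev l q + 1 = l) (hp : p.val + t = i.val) :
    D.T (l + t) β i j - pw (l - 1) β • D.X β p q ∈ D.V ((l + t : ℕ) - lev l i) := by
  have hl := D.hl
  have hil : lev l i < l := Nat.mod_lt _ D.hl
  induction t generalizing i with
  | zero =>
    have hpi : p = i := Fin.ext (by omega)
    subst hpi
    obtain ⟨s, hs⟩ : ∃ s, l = s + 1 := ⟨l - 1, by omega⟩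
    have h := D.FJ_le_V _ (D.step1 (s := s) β p j q hj (by omega) (by omega) (by omega))
    have h4 : D.Tp s β p j ∈ D.V ((s + 1 : ℕ) - lev l p) := by
      unfold Tp
      split_ifs with h0
      · have hp := lev_pred D.hl h0
        have := D.linA s (by omega) β (pred p) j hj (by omega)
        convert this using 2
        push_cast; omega
      · exact zero_mem _
    have := add_mem h h4
    have e1 : l + 0 = s + 1 := by omega
    have e2 : l - 1 = s := by omega
    rw [e1, e2]
    convert this using 1
    abel
  | succ t ih =>
    have h0 : 0 < lev l i := by omega
    have hpr := lev_pred D.hl h0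
    have hv := lev_pos_val h0
    have h := D.FJ_le_V _ (D.step2 (s := l + t) (by omega) β i j hj)
    rw [Tp, if_pos h0] at h
    have h2 := ih (pred i) (by omega) (by simp only [pred]; omega) (by omega)
    have e : (((l + t + 1 : ℕ) : ℤ) - lev l i) = (l + t : ℕ) - lev l (pred i) := by
      push_cast; omega
    rw [e] at h
    rw [show ((l + (t + 1) : ℕ) : ℤ) - lev l i = (l + t : ℕ) - lev l (pred i) by
      push_cast; omega]
    have := add_mem h h2
    rwa [sub_add_sub_cancel] at this

lemma lastcol (β : Bool) (p q : Fin n) (hq : lev l q + 1 = l) :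
    ∃ (c : ℂ) (r : ℕ) (i j : Fin n), lev l i + 1 = l ∧ lev l j = 0 ∧ (r : ℤ) + 1 = dg l p q ∧
      D.X β p q - c • D.T (l + r) β i j ∈ D.V (dg l p q) := by
  have hl := D.hl
  have hpl : lev l p < l := Nat.mod_lt _ D.hl
  obtain ⟨i, hi1, hi2⟩ := exists_shift D.hdvd p (l - 1 - lev l p) (by omega)
  have hdm := Nat.div_add_mod q.val l
  have hql : q.val % l + 1 = l := hq
  have hjlt : q.val + 1 - l < n := by omega
  have hj : lev l (⟨q.val + 1 - l, hjlt⟩ : Fin n) = 0 := by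
    change (q.val + 1 - l) % l = 0
    have : q.val + 1 - l = l * (q.val / l) := by omega
    rw [this]; simp
  have h := D.linC (l - 1 - lev l p) β i ⟨q.val + 1 - l, hjlt⟩ p q hj (by omega)
    (by simp only; omega) hq (by omega)
  have hd : ((l + (l - 1 - lev l p) : ℕ) : ℤ) - lev l i = dg l p q := by unfold dg; omega
  rw [hd] at h
  refine ⟨pw (l - 1) β, l - 1 - lev l p, i, _, by omega, hj, by omega, ?_⟩
  have hsq : pw (l - 1) β * pw (l - 1) β = 1 := by
    cases β
    · simp
    · rw [pw_t, ← mul_pow]; simp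
  have := Submodule.smul_mem _ (- pw (l - 1) β) h
  convert this using 1
  rw [smul_sub, smul_smul, neg_mul, hsq]
  module

end Dat
end QW

namespace QW

/-! ## Part 5: every invariant is congruent to a polynomial in the `T` elements -/

namespace Dat

variable {n l : ℕ} {R : Type} [Ring R] [Algebra ℂ R] (D : Dat n l R)

lemma T_Inv (s : ℕ) (β : Bool) (i j : Fin n) (hi : lev l i + 1 = l) (hj : lev l j = 0) :
    D.Inv (D.T s β i j) := by
  intro γ a b hab
  have hal : lev l a < l := Nat.mod_lt _ D.hl
  have h1 : b ≠ i := by rintro rfl; omega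
  have h2 : j ≠ a := by rintro rfl; omega
  have h3 := D.J.smul_mem (sg γ β) (D.J_mul (D.T s β i j) (D.M_mem γ hab))
  have hc : sg γ β * chi l γ a b = chi l γ a b := by
    cases γ
    · simp [sg]
    · simp [chi_true]
  convert h3 using 1
  simp only [M, sub_mul, mul_sub, D.XT, kd, h1, h2, if_false, mul_zero, zero_smul, add_zero,
    sub_zero, Algebra.algebraMap_eq_smul_one, smul_mul_assoc, mul_smul_comm, one_mul, mul_one,
    smul_sub, smul_smul, hc]

/-- The algebra generated by the invariant `T`'s. -/
def A : Subalgebra ℂ R := Algebra.adjoin ℂ {x | ∃ (r : ℕ) (β : Bool) (i j : Fin n),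
  lev l i + 1 = l ∧ lev l j = 0 ∧ x = D.T (l + r) β i j}

lemma A_Inv {b : R} (hb : b ∈ D.A) : D.Inv b := by
  unfold A at hb
  induction hb using Algebra.adjoin_induction with
  | mem x h => obtain ⟨r, β, i, j, hi, hj, rfl⟩ := h; exact D.T_Inv _ _ _ _ hi hj
  | algebraMap r => rw [Algebra.algebraMap_eq_smul_one]; exact Inv.smul r (Inv.one D)
  | add a b _ _ ha hb => exact ha.add hb
  | mul a b _ _ ha hb => exact ha.mul hb

lemma FJ_mul_Inv {d d' : ℤ} {k k' : ℕ} {x y : R} (hx : x ∈ D.FJ d k) (hy : y ∈ D.FJ d' k')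
    (hi : D.Inv y) : x * y ∈ D.FJ (d + d') (k + k') := by
  obtain ⟨a, ha, b, hb, rfl⟩ := Submodule.mem_sup.1 hx
  rw [add_mul]
  exact add_mem (D.FJ_mul ha hy) (D.J_le_FJ _ _ (hi.J_mul hb))

/-- Monomials in the invariant `T`'s. -/
inductive B : ℤ → ℕ → R → Prop
  | one : B 0 0 1
  | mul {d : ℤ} {k : ℕ} {b : R} (r : ℕ) (β : Bool) (i j : Fin n) (hi : lev l i + 1 = l)
      (hj : lev l j = 0) (hb : B d k b) : B (d + (r + 1)) (k + 1) (D.T (l + r) β i j * b)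

/-- Monomials: `j` letters outside the last column times a monomial in the `T`'s. -/
inductive Gw : ℤ → ℕ → ℕ → R → Prop
  | base {d : ℤ} {k : ℕ} {b : R} (hb : D.B d k b) : Gw d k 0 b
  | step {d : ℤ} {k j : ℕ} {u : R} (γ : Bool) (p q : Fin n) (hpq : lev l p ≤ lev l q)
      (hq : lev l q + 1 < l) (hu : Gw d k j u) :
      Gw (d + dg l p q) (k + 1) (j + 1) (D.X γ p q * u)

lemma B_A {d : ℤ} {k : ℕ} {b : R} (hb : D.B d k b) : b ∈ D.A := by
  induction hb with
  | one => exact one_mem _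
  | mul r β i j hi hj _ ih =>
    exact mul_mem (Algebra.subset_adjoin ⟨r, β, i, j, hi, hj, rfl⟩) ih

lemma T_last_mem (r : ℕ) (β : Bool) (i j : Fin n) (hi : lev l i + 1 = l) (hj : lev l j = 0) :
    D.T (l + r) β i j ∈ D.FJ (r + 1) 1 := by
  have := D.T_mem (l + r) β i j hj
  rw [if_pos (by omega)] at this
  exact D.FJ_mono (by push_cast; omega) le_rfl this

lemma B_mem {d : ℤ} {k : ℕ} {b : R} (hb : D.B d k b) : b ∈ D.FJ d k := by
  induction hb with
  | one => exact D.Fil_le_FJ _ _ D.one_Fil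
  | mul r β i j hi hj hb ih =>
    exact D.FJ_mono (by omega) (by omega)
      (D.FJ_mul_Inv (D.T_last_mem r β i j hi hj) ih (D.A_Inv (D.B_A hb)))

lemma Gw_mem {d : ℤ} {k j : ℕ} {u : R} (hu : D.Gw d k j u) :
    u ∈ D.FJ d k ∧ j ≤ k ∧ D.Ee * u - (j : ℂ) • u ∈ D.FJ d (k + 1) := by
  induction hu with
  | base hb =>
    refine ⟨D.B_mem hb, by omega, ?_⟩
    simp only [Nat.cast_zero, zero_smul, sub_zero]
    exact D.J_le_FJ _ _ (D.Ee_Inv (D.A_Inv (D.B_A hb)))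
  | step γ p q hpq hq hu ih =>
    obtain ⟨h1, h2, h3⟩ := ih
    refine ⟨?_, by omega, ?_⟩
    · exact D.FJ_mono (by omega) (by omega) (D.FJ_mul (D.X_Fil γ hpq) h1)
    · have h4 := D.Ee_X_mul h1 γ p q hpq hq
      have h5 := D.FJ_mul (D.X_Fil γ hpq) h3
      have := add_mem h4 (D.FJ_mono (by omega) (by omega) h5)
      convert this using 1
      rw [mul_sub, mul_smul_comm]
      push_cast
      module

/-- Span of the standard monomials plus longer words. -/
def H (d : ℤ) (k : ℕ) : Submodule ℂ R :=
  Submodule.span ℂ {u | ∃ j, D.Gw d k j u} ⊔ D.FJ d (k + 1)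

lemma Gw_H {d : ℤ} {k j : ℕ} {u : R} (hu : D.Gw d k j u) : u ∈ D.H d k :=
  (le_sup_left : _ ≤ D.H d k) (Submodule.subset_span ⟨j, hu⟩)

lemma FJ_le_H (d : ℤ) (k : ℕ) : D.FJ d (k + 1) ≤ D.H d k := le_sup_right

lemma H_ind {d d' : ℤ} {k k' : ℕ} (x : R) (hG : ∀ j u, D.Gw d k j u → x * u ∈ D.H d' k')
    (hF : ∀ u ∈ D.FJ d (k + 1), x * u ∈ D.H d' k') {u : R} (hu : u ∈ D.H d k) :
    x * u ∈ D.H d' k' := by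
  obtain ⟨a, ha, b, hb, rfl⟩ := Submodule.mem_sup.1 hu
  rw [mul_add]
  refine add_mem ?_ (hF b hb)
  clear hu
  induction ha using Submodule.span_induction with
  | mem x h => obtain ⟨j, h⟩ := h; exact hG j x h
  | zero => rw [mul_zero]; exact zero_mem _
  | add x y _ _ hx hy => rw [mul_add]; exact add_mem hx hy
  | smul c x _ hx => rw [mul_smul_comm]; exact Submodule.smul_mem _ _ hx

lemma X_FJ_H (γ : Bool) {p q : Fin n} (hpq : lev l p ≤ lev l q) {d : ℤ} {k : ℕ} {u : R}
    (hu : u ∈ D.FJ d (k + 1)) : D.X γ p q * u ∈ D.H (d + dg l p q) (k + 1) :=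
  D.FJ_le_H _ _ (D.FJ_mono (by omega) (by omega) (D.FJ_mul (D.X_Fil γ hpq) hu))

lemma X_H_low (γ : Bool) {p q : Fin n} (hpq : lev l p ≤ lev l q) (hq : lev l q + 1 < l)
    {d : ℤ} {k : ℕ} {u : R} (hu : u ∈ D.H d k) : D.X γ p q * u ∈ D.H (d + dg l p q) (k + 1) :=
  D.H_ind _ (fun _ _ h => D.Gw_H (Gw.step γ p q hpq hq h)) (fun _ h => D.X_FJ_H γ hpq h) hu

lemma X_B_H (γ : Bool) {p q : Fin n} (hq : lev l q + 1 = l)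
    {d : ℤ} {k : ℕ} {b : R} (hb : D.B d k b) : D.X γ p q * b ∈ D.H (d + dg l p q) (k + 1) := by
  obtain ⟨c, r, i, j, hi, hj, hr, hV⟩ := D.lastcol γ p q hq
  have hw : D.T (l + r) γ i j * b ∈ D.H (d + dg l p q) (k + 1) := by
    rw [← hr]; exact D.Gw_H (Gw.base (B.mul r γ i j hi hj hb))
  have hv : (D.X γ p q - c • D.T (l + r) γ i j) * b ∈ D.H (d + dg l p q) (k + 1) := by
    obtain ⟨v, hv, f, hf, e⟩ := Submodule.mem_sup.1 hV
    rw [← e, add_mul]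
    apply add_mem
    · clear e
      induction hv using Submodule.span_induction with
      | mem x h =>
        obtain ⟨γ', p', q', h1, h2, h3, rfl⟩ := h
        rw [← h3]
        exact D.Gw_H (Gw.step γ' p' q' h1 h2 (Gw.base hb))
      | zero => rw [zero_mul]; exact zero_mem _
      | add x y _ _ hx hy => rw [add_mul]; exact add_mem hx hy
      | smul c x _ hx => rw [smul_mul_assoc]; exact Submodule.smul_mem _ _ hx
    · exact D.FJ_le_H _ _ (D.FJ_mono (by omega) (by omega)
        (D.FJ_mul_Inv hf (D.B_mem hb) (D.A_Inv (D.B_A hb))))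
  have := add_mem hv (Submodule.smul_mem _ c hw)
  convert this using 1
  rw [sub_mul, smul_mul_assoc, sub_add_cancel]

lemma X_Gw_H (γ : Bool) {p q : Fin n} (hpq : lev l p ≤ lev l q) (hq : lev l q + 1 = l)
    {d : ℤ} {k j : ℕ} {u : R} (hu : D.Gw d k j u) :
    D.X γ p q * u ∈ D.H (d + dg l p q) (k + 1) := by
  induction hu with
  | base hb => exact D.X_B_H γ hq hb
  | @step d k j u γ' p' q' hpq' hq' hu ih =>
    have h1 := D.X_H_low γ' hpq' hq' ih
    have h2 := D.FJ_mul (D.X_comm γ γ' p q p' q' hpq hpq') (D.Gw_mem hu).1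
    have h3 := D.FJ_le_H (d + dg l p' q' + dg l p q) (k + 1 + 1) (D.FJ_lt (by omega) h2)
    rw [add_right_comm] at h1
    have := add_mem h3 (Submodule.smul_mem _ (sg γ γ') h1)
    convert this using 1
    rw [sub_mul, smul_mul_assoc, mul_assoc, mul_assoc, sub_add_cancel]

lemma X_H (γ : Bool) {p q : Fin n} (hpq : lev l p ≤ lev l q)
    {d : ℤ} {k : ℕ} {u : R} (hu : u ∈ D.H d k) : D.X γ p q * u ∈ D.H (d + dg l p q) (k + 1) := by
  have hql : lev l q < l := Nat.mod_lt _ D.hl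
  by_cases hq : lev l q + 1 < l
  · exact D.X_H_low γ hpq hq hu
  · exact D.H_ind _ (fun _ _ h => D.X_Gw_H γ hpq (by omega) h) (fun _ h => D.X_FJ_H γ hpq h) hu

lemma pr_H {w : Wd n} (hw : ok l w) : D.pr w ∈ D.H (wd l w) w.length := by
  induction w with
  | nil =>
    simp only [pr, wd, List.map_nil, List.prod_nil, List.sum_nil, List.length_nil]
    exact D.Gw_H (Gw.base B.one)
  | cons x w ih =>
    have hw' : ok l w := fun d hd => hw d (by simp [hd])
    have hx := hw x (by simp)
    have e : D.pr (x :: w) = D.X x.1 x.2.1 x.2.2 * D.pr w := by simp [pr]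
    have e' : wd l (x :: w) = wd l w + dg l x.2.1 x.2.2 := by simp [wd, add_comm]
    rw [e, e', List.length_cons]
    exact D.X_H x.1 hx (ih hw')

lemma FJ_le_H' (d : ℤ) (k : ℕ) : D.FJ d k ≤ D.H d k := by
  refine sup_le ?_ ((D.J_le_FJ _ _).trans (D.FJ_le_H d k))
  rw [Fil, Submodule.span_le]
  rintro x ⟨w, hw, rfl, h⟩
  have h1 := D.Fil_le_FJ _ _ (D.pr_mem hw)
  by_cases hd : wd l w < d
  · exact D.FJ_le_H _ _ (D.FJ_lt hd h1)
  · have hd' : wd l w = d := by omega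
    by_cases hk : w.length = k
    · have := D.pr_H hw
      rwa [hd', hk] at this
    · exact D.FJ_le_H _ _ (D.FJ_mono hd'.le (by omega) h1)

/-- The product of `Ee - j` for `1 ≤ j ≤ k`. -/
def Pk : ℕ → R
  | 0 => 1
  | k + 1 => (D.Ee - algebraMap ℂ R (k + 1)) * Pk k

lemma Pk_comm (k : ℕ) (c : ℂ) : Commute (D.Ee - algebraMap ℂ R c) (D.Pk k) := by
  induction k with
  | zero => exact Commute.one_right _
  | succ k ih =>
    refine Commute.mul_right ?_ ih
    apply Commute.sub_left
    · exact Commute.sub_right (Commute.refl _) (Algebra.commutes _ _).symm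
    · exact Algebra.commutes _ _

lemma Ees_mem {u : R} {d : ℤ} {k : ℕ} (c : ℂ) (hu : u ∈ D.FJ d k) :
    (D.Ee - algebraMap ℂ R c) * u ∈ D.FJ d k := by
  rw [sub_mul, ← Algebra.smul_def]
  exact sub_mem (D.Ee_mem hu) (Submodule.smul_mem _ _ hu)

lemma Pk_mem {u : R} {d : ℤ} {k : ℕ} (m : ℕ) (hu : u ∈ D.FJ d k) : D.Pk m * u ∈ D.FJ d k := by
  induction m with
  | zero => rw [Pk, one_mul]; exact hu
  | succ m ih => rw [Pk, mul_assoc]; exact D.Ees_mem _ ih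

lemma Pk_kill {u : R} {d : ℤ} {k : ℕ} (m j : ℕ) (hj : 1 ≤ j) (hjm : j ≤ m)
    (hu : D.Ee * u - (j : ℂ) • u ∈ D.FJ d k) : D.Pk m * u ∈ D.FJ d k := by
  induction m with
  | zero => omega
  | succ m ih =>
    by_cases h : j ≤ m
    · rw [Pk, mul_assoc]; exact D.Ees_mem _ (ih h)
    · have : j = m + 1 := by omega
      subst this
      rw [Pk, (D.Pk_comm m _).eq, mul_assoc]
      apply D.Pk_mem
      rw [sub_mul, ← Algebra.smul_def]
      exact_mod_cast hu

/-- The scalar by which `Pk` acts on invariants. -/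
def ck : ℕ → ℂ
  | 0 => 1
  | k + 1 => -((k : ℂ) + 1) * ck k

lemma ck_ne (k : ℕ) : ck k ≠ 0 := by
  induction k with
  | zero => simp [ck]
  | succ k ih =>
    refine mul_ne_zero (neg_ne_zero.2 ?_) ih
    exact_mod_cast Nat.succ_ne_zero k

lemma Pk_Inv {v : R} (hv : D.Ee * v ∈ D.J) (k : ℕ) : D.Pk k * v - ck k • v ∈ D.J := by
  induction k with
  | zero => simp [Pk, ck]
  | succ k ih =>
    have h1 := D.J_mul (D.Ee - algebraMap ℂ R (k + 1)) ih
    have := add_mem h1 (D.J.smul_mem (ck k) hv)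
    convert this using 1
    simp only [Pk, ck, mul_sub, sub_mul, Algebra.algebraMap_eq_smul_one, smul_mul_assoc, one_mul,
      mul_smul_comm, smul_sub, smul_smul, mul_assoc]
    module

lemma approx {v : R} (hv : D.Inv v) {d : ℤ} {k : ℕ} (h : v ∈ D.FJ d k) :
    ∃ b ∈ D.A, v - b ∈ D.FJ d (k + 1) := by
  obtain ⟨u, hu, f, hf, e⟩ := Submodule.mem_sup.1 (D.FJ_le_H' d k h)
  have key : ∃ b ∈ D.A, D.Pk k * u - b ∈ D.FJ d (k + 1) := by
    clear e
    induction hu using Submodule.span_induction with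
    | mem x hx =>
      obtain ⟨j, hx⟩ := hx
      obtain ⟨h1, h2, h3⟩ := D.Gw_mem hx
      by_cases hj : 1 ≤ j
      · exact ⟨0, zero_mem _, by rw [sub_zero]; exact D.Pk_kill k j hj h2 h3⟩
      · have : j = 0 := by omega
        subst this
        cases hx with
        | base hb =>
          exact ⟨ck k • x, Subalgebra.smul_mem _ (D.B_A hb) _,
            D.J_le_FJ _ _ (D.Pk_Inv (D.Ee_Inv (D.A_Inv (D.B_A hb))) k)⟩
    | zero => exact ⟨0, zero_mem _, by simp⟩
    | add x y _ _ hx hy =>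
      obtain ⟨a, ha, ha'⟩ := hx
      obtain ⟨b, hb, hb'⟩ := hy
      refine ⟨a + b, add_mem ha hb, ?_⟩
      rw [mul_add, add_sub_add_comm]
      exact add_mem ha' hb'
    | smul c x _ hx =>
      obtain ⟨a, ha, ha'⟩ := hx
      refine ⟨c • a, Subalgebra.smul_mem _ ha _, ?_⟩
      rw [mul_smul_comm, ← smul_sub]
      exact Submodule.smul_mem _ _ ha'
  obtain ⟨b, hb, hb'⟩ := key
  refine ⟨(ck k)⁻¹ • b, Subalgebra.smul_mem _ hb _, ?_⟩
  have h1 := D.J_le_FJ d (k + 1) (D.Pk_Inv (D.Ee_Inv hv) k)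
  have h2 := D.Pk_mem k hf
  have h3 := Submodule.smul_mem _ (ck k)⁻¹ (sub_mem (add_mem hb' h2) h1)
  convert h3 using 1
  rw [← e]
  have hc : (ck k)⁻¹ * ck k = 1 := inv_mul_cancel₀ (ck_ne k)
  simp only [mul_add, smul_sub, smul_add, smul_smul, hc, one_smul]
  abel

/-- The upper bound. -/
theorem upper {v : R} (hv : D.Inv v) : ∃ b ∈ D.A, v - b ∈ D.J := by
  have key : ∀ (d : ℕ) (v : R), D.Inv v → v ∈ D.FJ ((d : ℤ) - 1) 0 → ∃ b ∈ D.A, v - b ∈ D.J := by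
    intro d
    induction d with
    | zero =>
      intro v _ h
      rw [D.FJ_neg _ (by simp)] at h
      exact ⟨0, zero_mem _, by rwa [sub_zero]⟩
    | succ d ih =>
      intro v hv h
      rw [show ((d + 1 : ℕ) : ℤ) - 1 = d by push_cast; ring] at h
      have h1 : ∀ k : ℕ, ∃ b ∈ D.A, v - b ∈ D.FJ d k := by
        intro k
        induction k with
        | zero => exact ⟨0, zero_mem _, by rwa [sub_zero]⟩
        | succ k ihk =>
          obtain ⟨b, hb, hb'⟩ := ihk
          obtain ⟨c, hc, hc'⟩ := D.approx (hv.sub (D.A_Inv hb)) hb'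
          exact ⟨b + c, add_mem hb hc, by rwa [← sub_sub]⟩
      obtain ⟨b, hb, hb'⟩ := h1 (d + 1)
      have h2 := D.FJ_long (by push_cast; omega) hb'
      obtain ⟨c, hc, hc'⟩ := ih _ (hv.sub (D.A_Inv hb)) h2
      exact ⟨b + c, add_mem hb hc, by rwa [← sub_sub]⟩
  obtain ⟨d, hd⟩ := D.exists_FJ v
  exact key (d + 1) v hv (by rw [show ((d + 1 : ℕ) : ℤ) - 1 = d by push_cast; ring]; exact hd)

end Dat
end QW

namespace QW

/-! ## Part 6: the module `U(Q(n))/I_χ` realized on `U(p)` -/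

/-- Presentation data for `U(p)`. -/
structure PD (n l : ℕ) (P : Type) [Ring P] [Algebra ℂ P] where
  Z : Bool → Fin n → Fin n → P
  Zm : ∀ β i j, lev l j < lev l i → Z β i j = 0
  Zrel : ∀ (β γ : Bool) (i j k m : Fin n), lev l i ≤ lev l j → lev l k ≤ lev l m →
    Z β i j * Z γ k m = sg β γ • (Z γ k m * Z β i j) + kd j k • Z (xor β γ) i m
      - (sg β γ * kd m i) • Z (xor β γ) k j
  lift : ∀ (A : Type) [Ring A] [Algebra ℂ A] (f : Bool → Fin n → Fin n → A),
    (∀ β i j, lev l j < lev l i → f β i j = 0) →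
    (∀ (β γ : Bool) (i j k m : Fin n), lev l i ≤ lev l j → lev l k ≤ lev l m →
      f β i j * f γ k m = sg β γ • (f γ k m * f β i j) + kd j k • f (xor β γ) i m
      - (sg β γ * kd m i) • f (xor β γ) k j) →
    ∃ F : P →ₐ[ℂ] A, ∀ β i j, F (Z β i j) = f β i j
  gen : Algebra.adjoin ℂ {x | ∃ β i j, x = Z β i j} = ⊤

lemma adjoin_ind {S : Type} [Ring S] [Algebra ℂ S] {s : Set S}
    (hs : Algebra.adjoin ℂ s = ⊤) (p : S → Prop) (h1 : p 1)
    (hm : ∀ x ∈ s, ∀ u, p u → p (x * u)) (ha : ∀ u v, p u → p v → p (u + v))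
    (hc : ∀ (c : ℂ) u, p u → p (c • u)) (u : S) : p u := by
  have key : ∀ a ∈ Algebra.adjoin ℂ s, ∀ u, p u → p (a * u) := by
    intro a ha'
    induction ha' using Algebra.adjoin_induction with
    | mem x h => exact hm x h
    | algebraMap r => intro u hu; rw [← Algebra.smul_def]; exact hc r u hu
    | add a b _ _ h1 h2 => intro u hu; rw [add_mul]; exact ha _ _ (h1 u hu) (h2 u hu)
    | mul a b _ _ h1 h2 => intro u hu; rw [mul_assoc]; exact h1 _ (h2 u hu)
  have := key u (by rw [hs]; trivial) 1 h1
  rwa [mul_one] at this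

namespace PD

variable {n l : ℕ} {P : Type} [Ring P] [Algebra ℂ P] (D : PD n l P)

/-- The action of a letter on functions. -/
def mop (β : Bool) (i j : Fin n) :
    (Bool → Fin n → Fin n → P) →ₗ[ℂ] (Bool → Fin n → Fin n → P) where
  toFun φ := fun γ a b => sg γ β • (D.Z β i j * φ γ a b) + kd b i • φ (xor γ β) a j
    - (sg γ β * kd j a) • φ (xor γ β) i b
  map_add' φ ψ := by
    funext γ a b
    simp only [Pi.add_apply, mul_add]
    module
  map_smul' c φ := by
    funext γ a b
    simp only [Pi.smul_apply, mul_smul_comm, RingHom.id_apply]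
    module

lemma mop_apply (β : Bool) (i j : Fin n) (φ : Bool → Fin n → Fin n → P) (γ : Bool) (a b : Fin n) :
    D.mop β i j φ γ a b = sg γ β • (D.Z β i j * φ γ a b) + kd b i • φ (xor γ β) a j
    - (sg γ β * kd j a) • φ (xor γ β) i b := rfl

lemma mop_rel (β γ : Bool) (i j k m : Fin n) (h : lev l i ≤ lev l j) (h' : lev l k ≤ lev l m) :
    D.mop β i j * D.mop γ k m = sg β γ • (D.mop γ k m * D.mop β i j) + kd j k • D.mop (xor β γ) i m
      - (sg β γ * kd m i) • D.mop (xor β γ) k j := by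
  apply LinearMap.ext
  intro φ
  funext δ a b
  simp only [Module.End.mul_apply, LinearMap.add_apply, LinearMap.sub_apply, LinearMap.smul_apply,
    Pi.add_apply, Pi.sub_apply, Pi.smul_apply, mop_apply, mul_add, mul_sub, mul_smul_comm,
    ← mul_assoc, D.Zrel β γ i j k m h h', add_mul, sub_mul, smul_mul_assoc]
  cases β <;> cases γ <;> cases δ <;>
    simp only [sg_ff, sg_ft, sg_tf, sg_tt, Bool.xor_false, Bool.xor_true, Bool.not_true,
      Bool.not_false] <;> module

lemma exists_m : ∃ m : P →ₐ[ℂ] Module.End ℂ (Bool → Fin n → Fin n → P),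
    ∀ β i j, lev l i ≤ lev l j → m (D.Z β i j) = D.mop β i j := by
  obtain ⟨F, hF⟩ := D.lift (Module.End ℂ (Bool → Fin n → Fin n → P))
    (fun β i j => if lev l i ≤ lev l j then D.mop β i j else 0)
    (fun β i j h => if_neg (by omega))
    (by
      intro β γ i j k m h h'
      rw [if_pos h, if_pos h', D.mop_rel β γ i j k m h h']
      congr 1
      · congr 1
        by_cases e : j = k
        · subst e; rw [if_pos (by omega)]
        · simp [kd, e]
      · by_cases e : m = i
        · subst e; rw [if_pos (by omega)]
        · simp [kd, e])
  exact ⟨F, fun β i j h => by rw [hF, if_pos h]⟩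

/-- The multiplication operators. -/
def mm : P →ₐ[ℂ] Module.End ℂ (Bool → Fin n → Fin n → P) := D.exists_m.choose

lemma mm_Z (β : Bool) (i j : Fin n) (h : lev l i ≤ lev l j) :
    D.mm (D.Z β i j) = D.mop β i j := D.exists_m.choose_spec β i j h

/-- Value of the action on `1`. -/
def phi0 (γ : Bool) (a b : Fin n) : P := D.Z γ a b + algebraMap ℂ P (chi l γ a b)

/-- The action of a generator. -/
def rho (γ : Bool) (a b : Fin n) : P →ₗ[ℂ] P where
  toFun u := D.mm u D.phi0 γ a b
  map_add' u v := by simp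
  map_smul' c u := by simp

lemma rho_one (γ : Bool) (a b : Fin n) : D.rho γ a b 1 = D.phi0 γ a b := by
  change D.mm 1 D.phi0 γ a b = _
  rw [map_one]; rfl

lemma rho_Z (γ : Bool) (a b : Fin n) (β : Bool) (i j : Fin n) (h : lev l i ≤ lev l j) (u : P) :
    D.rho γ a b (D.Z β i j * u) = sg γ β • (D.Z β i j * D.rho γ a b u)
      + kd b i • D.rho (xor γ β) a j u - (sg γ β * kd j a) • D.rho (xor γ β) i b u := by
  change D.mm (D.Z β i j * u) D.phi0 γ a b = _
  rw [map_mul, D.mm_Z β i j h]; rfl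

lemma ind (p : P → Prop) (h1 : p 1)
    (hm : ∀ β i j, lev l i ≤ lev l j → ∀ u, p u → p (D.Z β i j * u))
    (ha : ∀ u v, p u → p v → p (u + v))
    (hc : ∀ (c : ℂ) u, p u → p (c • u)) (u : P) : p u := by
  refine adjoin_ind D.gen p h1 ?_ ha hc u
  rintro _ ⟨β, i, j, rfl⟩ u hu
  by_cases h : lev l i ≤ lev l j
  · exact hm β i j h u hu
  · rw [D.Zm β i j (by omega), zero_mul]
    have := hc 0 1 h1
    rwa [zero_smul] at this

lemma rho_p (γ : Bool) (a b : Fin n) (hab : lev l a ≤ lev l b) (u : P) :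
    D.rho γ a b u = D.Z γ a b * u := by
  revert γ a b
  refine D.ind (fun u => ∀ γ a b, lev l a ≤ lev l b → D.rho γ a b u = D.Z γ a b * u)
    ?_ ?_ ?_ ?_ u
  · intro γ a b h
    rw [rho_one, phi0, Dat.chi_eq_zero_of_le h, map_zero, add_zero, mul_one]
  · intro β i j hij u ih γ a b hab
    rw [D.rho_Z _ _ _ _ _ _ hij, ih γ a b hab, ← mul_assoc (D.Z γ a b),
      D.Zrel γ β a b i j hab hij]
    have e1 : kd b i • D.rho (xor γ β) a j u = kd b i • (D.Z (xor γ β) a j * u) := by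
      by_cases e : b = i
      · subst e; rw [ih _ _ _ (by omega)]
      · simp [kd, e]
    have e2 : (sg γ β * kd j a) • D.rho (xor γ β) i b u
        = (sg γ β * kd j a) • (D.Z (xor γ β) i b * u) := by
      by_cases e : j = a
      · subst e; rw [ih _ _ _ (by omega)]
      · simp [kd, e]
    rw [e1, e2]
    simp only [add_mul, sub_mul, smul_mul_assoc, mul_assoc]
  · intro u v hu hv γ a b h
    rw [map_add, hu _ _ _ h, hv _ _ _ h, mul_add]
  · intro c u hu γ a b h
    rw [map_smul, hu _ _ _ h, mul_smul_comm]

lemma rho_rel_one (β γ : Bool) (i j k m : Fin n) :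
    D.rho β i j (D.rho γ k m 1) = sg β γ • D.rho γ k m (D.rho β i j 1)
      + kd j k • D.rho (xor β γ) i m 1 - (sg β γ * kd m i) • D.rho (xor β γ) k j 1 := by
  by_cases h' : lev l k ≤ lev l m
  · rw [D.rho_p γ k m h', D.rho_Z β i j γ k m h', D.rho_p γ k m h']
  · by_cases h : lev l i ≤ lev l j
    · rw [D.rho_p β i j h (D.rho γ k m 1), D.rho_p β i j h 1, D.rho_Z γ k m β i j h]
      have : sg γ β = sg β γ := by cases β <;> cases γ <;> rfl
      have h2 : xor γ β = xor β γ := Bool.xor_comm _ _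
      rw [this, h2, smul_sub, smul_add, smul_smul, smul_smul, smul_smul, sg_sq,
        ← mul_assoc, sg_sq]
      module
    · simp only [rho_one, phi0, D.Zm γ k m (by omega), D.Zm β i j (by omega), zero_add]
      simp only [Algebra.algebraMap_eq_smul_one, map_smul, rho_one, phi0, D.Zm γ k m (by omega),
        D.Zm β i j (by omega), zero_add]
      have e1 : kd j k • (D.Z (xor β γ) i m + chi l (xor β γ) i m • (1 : P)) = 0 := by
        by_cases e : j = k
        · subst e
          have : chi l (xor β γ) i m = 0 := by
            unfold chi; rw [if_neg]; rintro ⟨-, -, h4⟩; omega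
          rw [this, D.Zm _ _ _ (by omega)]; simp
        · simp [kd, e]
      have e2 : (sg β γ * kd m i) • (D.Z (xor β γ) k j + chi l (xor β γ) k j • (1 : P)) = 0 := by
        by_cases e : m = i
        · subst e
          have : chi l (xor β γ) k j = 0 := by
            unfold chi; rw [if_neg]; rintro ⟨-, -, h4⟩; omega
          rw [this, D.Zm _ _ _ (by omega)]; simp
        · simp [kd, e]
      rw [e1, e2]
      cases β
      · simp only [sg]; cases γ <;> simp <;> module
      · simp [Dat.chi_true]

lemma rho_rel (u : P) (β γ : Bool) (i j k m : Fin n) :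
    D.rho β i j (D.rho γ k m u) = sg β γ • D.rho γ k m (D.rho β i j u)
      + kd j k • D.rho (xor β γ) i m u - (sg β γ * kd m i) • D.rho (xor β γ) k j u := by
  revert β γ i j k m
  refine D.ind (fun u => ∀ (β γ : Bool) (i j k m : Fin n),
    D.rho β i j (D.rho γ k m u) = sg β γ • D.rho γ k m (D.rho β i j u)
      + kd j k • D.rho (xor β γ) i m u - (sg β γ * kd m i) • D.rho (xor β γ) k j u)
    ?_ ?_ ?_ ?_ u
  · intro β γ i j k m
    exact D.rho_rel_one β γ i j k m
  · intro δ a b hab u ih β γ i j k m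
    simp only [D.rho_Z _ _ _ δ a b hab, map_add, map_sub, map_smul]
    rw [ih β γ i j k m, ih (xor β δ) γ i b k m, ih (xor β δ) γ a j k m,
      ih β (xor γ δ) i j k b, ih β (xor γ δ) i j a m]
    simp only [mul_add, mul_sub, mul_smul_comm]
    cases β <;> cases γ <;> cases δ <;>
      simp only [sg_ff, sg_ft, sg_tf, sg_tt, Bool.xor_false, Bool.xor_true, Bool.not_true,
        Bool.not_false] <;> module
  · intro u v hu hv β γ i j k m
    simp only [map_add]
    rw [hu β γ i j k m, hv β γ i j k m]
    module
  · intro c u hu β γ i j k m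
    simp only [map_smul]
    rw [hu β γ i j k m]
    module

end PD
end QW

namespace QW

/-! ## Part 7: the retraction `Θ` -/

/-- Relations of `U(p)`. -/
inductive PRel (n l : ℕ) : FreeAlgebra ℂ (Bool × Fin n × Fin n) →
    FreeAlgebra ℂ (Bool × Fin n × Fin n) → Prop
  | rel (β γ : Bool) (i j k m : Fin n) (h : lev l i ≤ lev l j) (h' : lev l k ≤ lev l m) : PRel n l
      (FreeAlgebra.ι ℂ (β, i, j) * FreeAlgebra.ι ℂ (γ, k, m))
      (sg β γ • (FreeAlgebra.ι ℂ (γ, k, m) * FreeAlgebra.ι ℂ (β, i, j))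
        + kd j k • FreeAlgebra.ι ℂ (xor β γ, i, m)
        - (sg β γ * kd m i) • FreeAlgebra.ι ℂ (xor β γ, k, j))
  | zero (β : Bool) (i j : Fin n) (h : lev l j < lev l i) : PRel n l
      (FreeAlgebra.ι ℂ (β, i, j)) 0

lemma gen_of_surj {σ A : Type} [Ring A] [Algebra ℂ A] (F : FreeAlgebra ℂ σ →ₐ[ℂ] A)
    (hF : Function.Surjective F) (s : Set A) (hs : ∀ x, F (FreeAlgebra.ι ℂ x) ∈ s) :
    Algebra.adjoin ℂ s = ⊤ := by
  rw [eq_top_iff]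
  have h1 : (⊤ : Subalgebra ℂ A) = Subalgebra.map F ⊤ := by
    rw [Algebra.map_top]; exact ((AlgHom.range_eq_top F).2 hF).symm
  rw [h1, ← FreeAlgebra.adjoin_range_ι, AlgHom.map_adjoin]
  apply Algebra.adjoin_mono
  rintro _ ⟨_, ⟨x, rfl⟩, rfl⟩
  exact hs x

/-- The presentation of `U(p)`. -/
def pdMk (n l : ℕ) : PD n l (RingQuot (PRel n l)) where
  Z β i j := RingQuot.mkAlgHom ℂ (PRel n l) (FreeAlgebra.ι ℂ (β, i, j))
  Zm β i j h := by
    have := RingQuot.mkAlgHom_rel ℂ (PRel.zero (l := l) β i j h)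
    rw [this, map_zero]
  Zrel β γ i j k m h h' := by
    have := RingQuot.mkAlgHom_rel ℂ (PRel.rel (l := l) β γ i j k m h h')
    simp only [map_sub, map_add, map_mul, map_smul] at this
    exact this
  lift A _ _ f h0 hr := by
    refine ⟨RingQuot.liftAlgHom ℂ ⟨FreeAlgebra.lift ℂ (fun d => f d.1 d.2.1 d.2.2), ?_⟩, ?_⟩
    · intro x y hxy
      cases hxy with
      | rel β γ i j k m h h' =>
        simp only [map_sub, map_add, map_mul, map_smul, FreeAlgebra.lift_ι_apply]
        exact hr β γ i j k m h h'
      | zero β i j h =>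
        simp only [map_zero, FreeAlgebra.lift_ι_apply]
        exact h0 β i j h
    · intro β i j
      rw [RingQuot.liftAlgHom_mkAlgHom_apply, FreeAlgebra.lift_ι_apply]
  gen := gen_of_surj (RingQuot.mkAlgHom ℂ (PRel n l)) (RingQuot.mkAlgHom_surjective ℂ _) _
    (fun x => ⟨x.1, x.2.1, x.2.2, rfl⟩)

/-- Lifting property of `U(Q(n))`. -/
lemma UQ_lift (n : ℕ) (A : Type) [Ring A] [Algebra ℂ A] (f : Bool → Fin n → Fin n → A)
    (hf : ∀ (β γ : Bool) (i j k m : Fin n),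
      f β i j * f γ k m = sg β γ • (f γ k m * f β i j) + kd j k • f (xor β γ) i m
      - (sg β γ * kd m i) • f (xor β γ) k j) :
    ∃ F : UQ n →ₐ[ℂ] A, ∀ β i j, F (X β i j) = f β i j := by
  refine ⟨RingQuot.liftAlgHom ℂ ⟨FreeAlgebra.lift ℂ (fun d => match d with
    | QGen.E i j => f false i j
    | QGen.F i j => f true i j), ?_⟩, ?_⟩
  · intro x y hxy
    cases hxy with
    | ee i j k m =>
      simp only [map_sub, map_add, map_mul, map_smul, FreeAlgebra.lift_ι_apply]
      rw [hf false false i j k m]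
      simp only [sg_ff, one_mul, one_smul, Bool.xor_false]
      abel
    | ef i j k m =>
      simp only [map_sub, map_add, map_mul, map_smul, FreeAlgebra.lift_ι_apply]
      rw [hf false true i j k m]
      simp only [sg_ft, one_mul, one_smul, Bool.false_xor]
      abel
    | ff i j k m =>
      simp only [map_sub, map_add, map_mul, map_smul, FreeAlgebra.lift_ι_apply]
      rw [hf true true i j k m]
      simp only [sg_tt, Bool.xor_self]
      module
  · intro β i j
    cases β
    · change RingQuot.liftAlgHom ℂ _ (RingQuot.mkAlgHom ℂ (QRel n) (FreeAlgebra.ι ℂ (QGen.E i j))) = _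
      rw [RingQuot.liftAlgHom_mkAlgHom_apply, FreeAlgebra.lift_ι_apply]
    · change RingQuot.liftAlgHom ℂ _ (RingQuot.mkAlgHom ℂ (QRel n) (FreeAlgebra.ι ℂ (QGen.F i j))) = _
      rw [RingQuot.liftAlgHom_mkAlgHom_apply, FreeAlgebra.lift_ι_apply]

lemma UQ_gen (n : ℕ) : Algebra.adjoin ℂ {x : UQ n | ∃ β i j, x = X β i j} = ⊤ :=
  gen_of_surj (RingQuot.mkAlgHom ℂ (QRel n)) (RingQuot.mkAlgHom_surjective ℂ _) _
    (fun x => match x with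
      | QGen.E i j => ⟨false, i, j, rfl⟩
      | QGen.F i j => ⟨true, i, j, rfl⟩)

/-- The concrete data. -/
def datUQ (n l : ℕ) (hl : 0 < l) (h : l ∣ n) : Dat n l (UQ n) where
  hl := hl
  hdvd := h
  X := X
  T := T
  rel := Xrel
  T_zero := T_zero
  T_succ := T_succ
  XT := XT
  gen := UQ_gen n

/-- Slot generators. -/
def xX {m l : ℕ} (β : Bool) (a : Fin l) (p q : Fin m) : TQ m l :=
  match β with
  | false => xT a p q
  | true => xiT a p q

lemma xXrel {m l : ℕ} (β γ : Bool) (a b : Fin l) (p q r s : Fin m) :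
    xX β a p q * xX γ b r s = sg β γ • (xX γ b r s * xX β a p q)
      + (kdl a b * kd q r) • xX (xor β γ) a p s
      - (sg β γ * (kdl a b * kd s p)) • xX (xor β γ) b r q := by
  have hk : kdl a b = kdl b a := by simp [kdl, eq_comm]
  cases β <;> cases γ
  · have := RingQuot.mkAlgHom_rel ℂ (TRel.xx a b p q r s)
    simp only [map_sub, map_mul, map_smul] at this
    simp only [xX, xT, sg_ff, Bool.xor_false, one_smul, one_mul]
    rw [add_sub_assoc, ← this]; abel
  · have := RingQuot.mkAlgHom_rel ℂ (TRel.xxi a b p q r s)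
    simp only [map_sub, map_mul, map_smul] at this
    simp only [xX, xT, xiT, sg_ft, Bool.false_xor, one_smul, one_mul]
    rw [add_sub_assoc, ← this]; abel
  · have := RingQuot.mkAlgHom_rel ℂ (TRel.xxi b a r s p q)
    simp only [map_sub, map_mul, map_smul] at this
    simp only [xX, xT, xiT, sg_tf, Bool.xor_false, one_smul, one_mul]
    rw [hk, add_sub_assoc, ← neg_sub ((kdl b a * kd s p) • _), ← this]; abel
  · have := RingQuot.mkAlgHom_rel ℂ (TRel.xixi a b p q r s)
    simp only [map_add, map_mul, map_smul] at this
    simp only [xX, xT, xiT, sg_tt, Bool.xor_self]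
    linear_combination (norm := module) this

lemma TQ_gen (m l : ℕ) : Algebra.adjoin ℂ {x : TQ m l | ∃ β a p q, x = xX β a p q} = ⊤ :=
  gen_of_surj (RingQuot.mkAlgHom ℂ (TRel m l)) (RingQuot.mkAlgHom_surjective ℂ _) _
    (fun x => match x with
      | TGen.X a i j => ⟨false, a, i, j, rfl⟩
      | TGen.Xi a i j => ⟨true, a, i, j, rfl⟩)

lemma TQ_lift (m l : ℕ) (A : Type) [Ring A] [Algebra ℂ A] (f : Bool → Fin l → Fin m → Fin m → A)
    (hf : ∀ (β γ : Bool) (a b : Fin l) (p q r s : Fin m),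
      f β a p q * f γ b r s = sg β γ • (f γ b r s * f β a p q)
      + (kdl a b * kd q r) • f (xor β γ) a p s
      - (sg β γ * (kdl a b * kd s p)) • f (xor β γ) b r q) :
    ∃ F : TQ m l →ₐ[ℂ] A, ∀ β a p q, F (xX β a p q) = f β a p q := by
  refine ⟨RingQuot.liftAlgHom ℂ ⟨FreeAlgebra.lift ℂ (fun d => match d with
    | TGen.X a i j => f false a i j
    | TGen.Xi a i j => f true a i j), ?_⟩, ?_⟩
  · intro x y hxy
    cases hxy with
    | xx a b i j k m =>
      simp only [map_sub, map_add, map_mul, map_smul, FreeAlgebra.lift_ι_apply]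
      rw [hf false false a b i j k m]
      simp only [sg_ff, one_mul, one_smul, Bool.xor_false]
      abel
    | xxi a b i j k m =>
      simp only [map_sub, map_add, map_mul, map_smul, FreeAlgebra.lift_ι_apply]
      rw [hf false true a b i j k m]
      simp only [sg_ft, one_mul, one_smul, Bool.false_xor]
      abel
    | xixi a b i j k m =>
      simp only [map_sub, map_add, map_mul, map_smul, FreeAlgebra.lift_ι_apply]
      rw [hf true true a b i j k m]
      simp only [sg_tt, Bool.xor_self]
      module
  · intro β a i j
    cases β
    · change RingQuot.liftAlgHom ℂ _ (RingQuot.mkAlgHom ℂ (TRel m l) (FreeAlgebra.ι ℂ (TGen.X a i j))) = _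
      rw [RingQuot.liftAlgHom_mkAlgHom_apply, FreeAlgebra.lift_ι_apply]
    · change RingQuot.liftAlgHom ℂ _ (RingQuot.mkAlgHom ℂ (TRel m l) (FreeAlgebra.ι ℂ (TGen.Xi a i j))) = _
      rw [RingQuot.liftAlgHom_mkAlgHom_apply, FreeAlgebra.lift_ι_apply]

end QW

namespace QW

/-! ## Part 8: block indices and the retraction -/

lemma pw_xor (a : ℕ) (β γ : Bool) : pw a β * pw a γ = pw a (xor β γ) := by
  have h : (-1 : ℂ) ^ a * (-1) ^ a = 1 := by rw [← mul_pow]; simp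
  cases β <;> cases γ <;> simp [h]

lemma pw_sq (a : ℕ) (β : Bool) : pw a β * pw a β = 1 := by rw [pw_xor]; simp

lemma pw_add (a b : ℕ) (β : Bool) : pw (a + b) β = pw a β * pw b β := by
  cases β <;> simp [pow_add]

section bid
variable {n l : ℕ} (h : l ∣ n)

lemma lev_bidx (p : Fin (n / l)) (a : Fin l) : lev l (bidx h p a) = a.val := by
  simp [lev, bidx, Nat.mod_eq_of_lt a.isLt]

lemma bidx_inj {p q : Fin (n / l)} {a b : Fin l} (e : bidx h p a = bidx h q b) : p = q ∧ a = b := by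
  have e1 : a = b := by
    apply Fin.ext
    rw [← lev_bidx h p a, e, lev_bidx]
  subst e1
  have e2 := congrArg Fin.val e
  simp only [bidx] at e2
  have hl : 0 < l := a.pos
  have e3 : l * p.val = l * q.val := by omega
  exact ⟨Fin.ext (Nat.eq_of_mul_eq_mul_left hl e3), rfl⟩

lemma exists_bidx (hl : 0 < l) (i : Fin n) : ∃ (p : Fin (n / l)) (a : Fin l), i = bidx h p a := by
  refine ⟨⟨i.val / l, ?_⟩, ⟨i.val % l, Nat.mod_lt _ hl⟩, ?_⟩
  · rw [Nat.div_lt_iff_lt_mul hl, Nat.div_mul_cancel h]; exact i.isLt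
  · apply Fin.ext
    simp only [bidx]
    exact (Nat.div_add_mod i.val l).symm

lemma kd_bidx (p q : Fin (n / l)) (a b : Fin l) :
    kd (bidx h p a) (bidx h q b) = kdl a b * kd p q := by
  unfold kd kdl
  by_cases e : p = q
  · by_cases e' : a = b
    · simp [e, e']
    · rw [if_neg, if_neg e', zero_mul]
      intro hh; exact e' (bidx_inj h hh).2
  · rw [if_neg, if_neg e, mul_zero]
    intro hh; exact e (bidx_inj h hh).1

/-- block number. -/
def blk (hl : 0 < l) (i : Fin n) : Fin (n / l) := (exists_bidx h hl i).choose
/-- level as a finite index. -/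
def fl (hl : 0 < l) (i : Fin n) : Fin l := (exists_bidx h hl i).choose_spec.choose

lemma bidx_blk (hl : 0 < l) (i : Fin n) : i = bidx h (blk h hl i) (fl h hl i) :=
  (exists_bidx h hl i).choose_spec.choose_spec

lemma blk_bidx (hl : 0 < l) (p : Fin (n / l)) (a : Fin l) : blk h hl (bidx h p a) = p :=
  (bidx_inj h (bidx_blk h hl (bidx h p a))).1.symm
lemma fl_bidx (hl : 0 < l) (p : Fin (n / l)) (a : Fin l) : fl h hl (bidx h p a) = a :=
  (bidx_inj h (bidx_blk h hl (bidx h p a))).2.symm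

end bid

/-- Values of the projection `U(p) → U(g₀)` on generators. -/
def rv {n l : ℕ} (h : l ∣ n) (hl : 0 < l) {S : Type} [Ring S] [Algebra ℂ S]
    (x : Bool → Fin l → Fin (n / l) → Fin (n / l) → S) (β : Bool) (i j : Fin n) : S :=
  if fl h hl i = fl h hl j then pw (fl h hl i).val β • x β (fl h hl i) (blk h hl i) (blk h hl j)
  else 0

lemma rv_bidx {n l : ℕ} (h : l ∣ n) (hl : 0 < l) {S : Type} [Ring S] [Algebra ℂ S]
    (x : Bool → Fin l → Fin (n / l) → Fin (n / l) → S) (β : Bool) (p q : Fin (n / l)) (a b : Fin l) :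
    rv h hl x β (bidx h p a) (bidx h q b) = if a = b then pw a.val β • x β a p q else 0 := by
  simp only [rv, fl_bidx, blk_bidx]

lemma rv_rel {n l : ℕ} (h : l ∣ n) (hl : 0 < l) {S : Type} [Ring S] [Algebra ℂ S]
    (x : Bool → Fin l → Fin (n / l) → Fin (n / l) → S)
    (hx : ∀ (β γ : Bool) (a b : Fin l) (p q r s : Fin (n / l)),
      x β a p q * x γ b r s = sg β γ • (x γ b r s * x β a p q)
      + (kdl a b * kd q r) • x (xor β γ) a p s
      - (sg β γ * (kdl a b * kd s p)) • x (xor β γ) b r q)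
    (β γ : Bool) (i j k m : Fin n) (hij : lev l i ≤ lev l j) (hkm : lev l k ≤ lev l m) :
    rv h hl x β i j * rv h hl x γ k m = sg β γ • (rv h hl x γ k m * rv h hl x β i j)
      + kd j k • rv h hl x (xor β γ) i m - (sg β γ * kd m i) • rv h hl x (xor β γ) k j := by
  obtain ⟨p, a, rfl⟩ := exists_bidx h hl i
  obtain ⟨q, b, rfl⟩ := exists_bidx h hl j
  obtain ⟨r, c, rfl⟩ := exists_bidx h hl k
  obtain ⟨s, d, rfl⟩ := exists_bidx h hl m
  rw [lev_bidx, lev_bidx] at hij hkm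
  simp only [rv_bidx, kd_bidx]
  by_cases hab : a = b
  · by_cases hcd : c = d
    · subst hab; subst hcd
      by_cases hac : a = c
      · subst hac
        simp only [if_true, smul_mul_assoc, mul_smul_comm, hx β γ a a p q r s, smul_sub, smul_add,
          smul_smul, ← pw_xor]
        module
      · simp only [if_true, if_neg hac, if_neg (Ne.symm hac), smul_zero, smul_mul_assoc,
          mul_smul_comm, hx β γ a c p q r s, kdl, zero_mul, mul_zero, zero_smul, smul_smul]
        module
    · have hcd' : c.val < d.val := lt_of_le_of_ne hkm (fun e => hcd (Fin.ext e))
      subst hab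
      rw [if_neg hcd, mul_zero, zero_mul, smul_zero]
      by_cases e1 : a = c
      · subst e1
        rw [if_neg hcd]
        simp [kdl, Ne.symm hcd]
      · by_cases e2 : d = a
        · subst e2; simp [kdl, hcd, e1]
        · simp [kdl, e1, e2]
  · have hab' : a.val < b.val := lt_of_le_of_ne hij (fun e => hab (Fin.ext e))
    rw [if_neg hab, mul_zero, zero_mul, smul_zero]
    have t1 : (kdl b c * kd q r) • (if a = d then pw a.val (xor β γ) • x (xor β γ) a p s else 0) = 0 := by
      by_cases e : b = c
      · rw [if_neg (by rintro rfl; subst e; omega), smul_zero]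
      · simp [kdl, e]
    have t2 : (sg β γ * (kdl d a * kd s p)) •
        (if c = b then pw c.val (xor β γ) • x (xor β γ) c r q else 0) = 0 := by
      by_cases e : d = a
      · rw [if_neg (by rintro rfl; subst e; omega), smul_zero]
      · simp [kdl, e]
    rw [t1, t2]; simp

namespace Dat
variable {n l : ℕ} {R : Type} [Ring R] [Algebra ℂ R] (D : Dat n l R)

/-- The subalgebra `U(p)`. -/
def Up : Subalgebra ℂ R := Algebra.adjoin ℂ {x | ∃ β i j, lev l i ≤ lev l j ∧ x = D.X β i j}

/-- `U(p) n`. -/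
def Ls : Submodule ℂ R := Submodule.span ℂ {x | ∃ u ∈ D.Up, ∃ β i j, lev l i < lev l j ∧
  x = u * D.X β i j}

theorem iota_inj {P S : Type} [Ring P] [Algebra ℂ P] [Ring S] [Algebra ℂ S] (E : PD n l P)
    (x : Bool → Fin l → Fin (n / l) → Fin (n / l) → S)
    (hx : ∀ (β γ : Bool) (a b : Fin l) (p q r s : Fin (n / l)),
      x β a p q * x γ b r s = sg β γ • (x γ b r s * x β a p q)
      + (kdl a b * kd q r) • x (xor β γ) a p s
      - (sg β γ * (kdl a b * kd s p)) • x (xor β γ) b r q)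
    (hxg : Algebra.adjoin ℂ {y | ∃ β a p q, y = x β a p q} = ⊤)
    (rep : R →ₐ[ℂ] Module.End ℂ P) (hrep : ∀ β i j, rep (D.X β i j) = E.rho β i j)
    (ι : S →ₐ[ℂ] R) (hι : ∀ β a p q, ι (x β a p q) =
      pw a.val β • D.X β (bidx D.hdvd p a) (bidx D.hdvd q a))
    (t : S) (ht : ι t ∈ D.J ⊔ D.Ls) : t = 0 := by
  obtain ⟨F, hF⟩ := E.lift S (rv D.hdvd D.hl x)
    (by
      intro β i j hij
      obtain ⟨p, a, rfl⟩ := exists_bidx D.hdvd D.hl i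
      obtain ⟨q, b, rfl⟩ := exists_bidx D.hdvd D.hl j
      rw [lev_bidx, lev_bidx] at hij
      rw [rv_bidx, if_neg]
      rintro rfl; omega)
    (rv_rel D.hdvd D.hl x hx)
  have hJ : ∀ y ∈ D.J, rep y 1 = 0 := by
    intro y hy
    have hy' : y ∈ Submodule.span R {x | ∃ β i j, lev l j < lev l i ∧ x = D.M β i j} := hy
    induction hy' using Submodule.span_induction with
    | mem x h =>
      obtain ⟨β, i, j, h, rfl⟩ := h
      rw [Dat.M, map_sub, hrep, LinearMap.sub_apply, E.rho_one, PD.phi0, E.Zm β i j h,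
        AlgHom.commutes, Module.algebraMap_end_apply, Algebra.algebraMap_eq_smul_one, zero_add, sub_self]
    | zero => rw [map_zero]; rfl
    | add a b ha hb iha ihb => rw [map_add, LinearMap.add_apply, iha ha, ihb hb, add_zero]
    | smul a b hb ih => rw [smul_eq_mul, map_mul, Module.End.mul_apply, ih hb, map_zero]
  have hUp : ∀ u ∈ D.Up, ∀ v, F v = 0 → F (rep u v) = 0 := by
    intro u hu
    have hu' : u ∈ Algebra.adjoin ℂ {x | ∃ β i j, lev l i ≤ lev l j ∧ x = D.X β i j} := hu
    clear hu
    induction hu' using Algebra.adjoin_induction with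
    | mem x h =>
      obtain ⟨β, i, j, h, rfl⟩ := h
      intro v hv
      rw [hrep, E.rho_p β i j h, map_mul, hv, mul_zero]
    | algebraMap r =>
      intro v hv
      rw [AlgHom.commutes, Module.algebraMap_end_apply, map_smul, hv, smul_zero]
    | add a b _ _ h1 h2 =>
      intro v hv
      rw [map_add, LinearMap.add_apply, map_add, h1 v hv, h2 v hv, add_zero]
    | mul a b _ _ h1 h2 =>
      intro v hv
      rw [map_mul, Module.End.mul_apply]
      exact h1 _ (h2 v hv)
  have hL : ∀ y ∈ D.Ls, F (rep y 1) = 0 := by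
    intro y hy
    have hy' : y ∈ Submodule.span ℂ {x | ∃ u ∈ D.Up, ∃ β i j, lev l i < lev l j ∧
      x = u * D.X β i j} := hy
    clear hy
    induction hy' using Submodule.span_induction with
    | mem z hz =>
      obtain ⟨u, hu, β, i, j, hij, rfl⟩ := hz
      rw [map_mul, Module.End.mul_apply]
      apply hUp u hu
      rw [hrep, E.rho_p β i j hij.le, mul_one, hF]
      obtain ⟨p, a, rfl⟩ := exists_bidx D.hdvd D.hl i
      obtain ⟨q, b, rfl⟩ := exists_bidx D.hdvd D.hl j
      rw [lev_bidx, lev_bidx] at hij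
      rw [rv_bidx, if_neg]
      rintro rfl; omega
    | zero => rw [map_zero, LinearMap.zero_apply, map_zero]
    | add a b _ _ iha ihb => rw [map_add, LinearMap.add_apply, map_add, iha, ihb, add_zero]
    | smul a b _ ih => rw [map_smul, LinearMap.smul_apply, map_smul, ih, smul_zero]
  have hI : ∀ t : S, ∀ v, F (rep (ι t) v) = t * F v := by
    intro t
    refine adjoin_ind hxg (fun t => ∀ v, F (rep (ι t) v) = t * F v) ?_ ?_ ?_ ?_ t
    · intro v; rw [map_one, map_one, one_mul]; rfl
    · rintro _ ⟨β, a, p, q, rfl⟩ u hu v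
      rw [map_mul, map_mul, Module.End.mul_apply, mul_assoc, ← hu v, hι, map_smul, hrep,
        LinearMap.smul_apply, E.rho_p, map_smul, map_mul, hF, rv_bidx, if_pos rfl, smul_mul_assoc,
        smul_smul, pw_sq, one_smul]
      rw [lev_bidx, lev_bidx]
    · intro u w hu hw v
      rw [map_add, map_add, LinearMap.add_apply, map_add, hu, hw, add_mul]
    · intro c u hu v
      rw [map_smul, map_smul, LinearMap.smul_apply, map_smul, hu, smul_mul_assoc]
  obtain ⟨y, hy, z, hz, e⟩ := Submodule.mem_sup.1 ht
  have h1 := hI t 1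
  rw [map_one F, mul_one, ← e, map_add, LinearMap.add_apply, map_add, hJ y hy, hL z hz, map_zero,
    add_zero] at h1
  exact h1.symm

end Dat

end QW

namespace QW

/-! ## Part 9: computing the Harish-Chandra projection of the generators -/

namespace Dat
variable {n l : ℕ} {R : Type} [Ring R] [Algebra ℂ R] (D : Dat n l R)

/-- The kernel of the Harish-Chandra projection. -/
def K : Submodule ℂ R := D.J ⊔ D.Ls

lemma J_le_K : D.J ≤ D.K := le_sup_left
lemma Ls_le_K : D.Ls ≤ D.K := le_sup_right

lemma X_Up (β : Bool) {i j : Fin n} (h : lev l i ≤ lev l j) : D.X β i j ∈ D.Up :=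
  Algebra.subset_adjoin ⟨β, i, j, h, rfl⟩

lemma Up_Ls {u : R} (hu : u ∈ D.Up) {y : R} (hy : y ∈ D.Ls) : u * y ∈ D.Ls := by
  have hy' : y ∈ Submodule.span ℂ {x | ∃ u ∈ D.Up, ∃ β i j, lev l i < lev l j ∧
      x = u * D.X β i j} := hy
  clear hy
  induction hy' using Submodule.span_induction with
  | mem z hz =>
    obtain ⟨v, hv, β, i, j, hij, rfl⟩ := hz
    rw [← mul_assoc]
    exact Submodule.subset_span ⟨u * v, D.Up.mul_mem hu hv, β, i, j, hij, rfl⟩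
  | zero => rw [mul_zero]; exact D.Ls.zero_mem
  | add a b _ _ iha ihb => rw [mul_add]; exact D.Ls.add_mem iha ihb
  | smul a b _ ih => rw [mul_smul_comm]; exact D.Ls.smul_mem _ ih

lemma Up_K {u : R} (hu : u ∈ D.Up) {y : R} (hy : y ∈ D.K) : u * y ∈ D.K := by
  obtain ⟨a, ha, b, hb, rfl⟩ := Submodule.mem_sup.1 hy
  rw [mul_add]
  exact D.K.add_mem (D.J_le_K (D.J_mul u ha)) (D.Ls_le_K (D.Up_Ls hu hb))

lemma N_mem (β : Bool) {i j : Fin n} (h : lev l i < lev l j) : D.X β i j ∈ D.Ls := by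
  have := Submodule.subset_span (R := ℂ) (s := {x | ∃ u ∈ D.Up, ∃ β i j, lev l i < lev l j ∧
      x = u * D.X β i j}) ⟨1, D.Up.one_mem, β, i, j, h, (one_mul _).symm⟩
  exact this

lemma N_Up {u : R} (hu : u ∈ D.Up) : ∀ (β : Bool) (i j : Fin n), lev l i < lev l j →
    D.X β i j * u ∈ D.Ls := by
  have hu' : u ∈ Algebra.adjoin ℂ {x | ∃ β i j, lev l i ≤ lev l j ∧ x = D.X β i j} := hu
  clear hu
  induction hu' using Algebra.adjoin_induction with
  | mem x h =>
    obtain ⟨γ, k, m, hkm, rfl⟩ := h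
    intro β i j hij
    rw [D.rel β γ i j k m]
    refine D.Ls.sub_mem (D.Ls.add_mem (D.Ls.smul_mem _ (D.Up_Ls (D.X_Up γ hkm) (D.N_mem β hij))) ?_) ?_
    · by_cases e : j = k
      · subst e; exact D.Ls.smul_mem _ (D.N_mem _ (by omega))
      · simp [kd, e]
    · by_cases e : m = i
      · subst e; exact D.Ls.smul_mem _ (D.N_mem _ (by omega))
      · simp [kd, e]
  | algebraMap r =>
    intro β i j hij
    rw [← Algebra.commutes, ← Algebra.smul_def]
    exact D.Ls.smul_mem _ (D.N_mem β hij)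
  | add a b _ _ h1 h2 =>
    intro β i j hij
    rw [mul_add]; exact D.Ls.add_mem (h1 β i j hij) (h2 β i j hij)
  | mul a b _ _ h1 h2 =>
    intro β i j hij
    rw [← mul_assoc]
    have key : ∀ y ∈ D.Ls, y * b ∈ D.Ls := by
      intro y hy
      have hy' : y ∈ Submodule.span ℂ {x | ∃ u ∈ D.Up, ∃ β i j, lev l i < lev l j ∧
          x = u * D.X β i j} := hy
      clear hy
      induction hy' using Submodule.span_induction with
      | mem z hz =>
        obtain ⟨v, hv, β, i, j, hij, rfl⟩ := hz
        rw [mul_assoc]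
        exact D.Up_Ls hv (h2 β i j hij)
      | zero => rw [zero_mul]; exact D.Ls.zero_mem
      | add a b _ _ iha ihb => rw [add_mul]; exact D.Ls.add_mem iha ihb
      | smul a b _ ih => rw [smul_mul_assoc]; exact D.Ls.smul_mem _ ih
    exact key _ (h1 β i j hij)

lemma pr_Up {w : Wd n} (hw : ok l w) : D.pr w ∈ D.Up := by
  apply Subalgebra.list_prod_mem
  intro x hx
  obtain ⟨d, hd, rfl⟩ := List.mem_map.1 hx
  exact D.X_Up _ (hw d hd)

lemma Up_J (y : R) : ∃ u ∈ D.Up, y - u ∈ D.J := by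
  obtain ⟨d, hd⟩ := D.exists_FJ y
  obtain ⟨a, ha, b, hb, rfl⟩ := Submodule.mem_sup.1 hd
  refine ⟨a, ?_, by rwa [add_sub_cancel_left]⟩
  have : D.Fil d 0 ≤ Subalgebra.toSubmodule D.Up := by
    apply Submodule.span_le.2
    rintro x ⟨w, hw, rfl, -⟩
    exact D.pr_Up hw
  exact this ha

lemma N_mul (β : Bool) {i j : Fin n} (h : lev l i < lev l j) (y : R) : D.X β i j * y ∈ D.K := by
  obtain ⟨u, hu, hy⟩ := D.Up_J y
  have e : D.X β i j * y = D.X β i j * u + D.X β i j * (y - u) := by rw [mul_sub]; abel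
  rw [e]
  exact D.K.add_mem (D.Ls_le_K (D.N_Up hu β i j h)) (D.J_le_K (D.J_mul _ hy))

lemma Ls_mul {x : R} (hx : x ∈ D.Ls) (y : R) : x * y ∈ D.K := by
  have hx' : x ∈ Submodule.span ℂ {x | ∃ u ∈ D.Up, ∃ β i j, lev l i < lev l j ∧
          x = u * D.X β i j} := hx
  clear hx
  induction hx' using Submodule.span_induction with
  | mem z hz =>
    obtain ⟨v, hv, β, i, j, hij, rfl⟩ := hz
    rw [mul_assoc]
    exact D.Up_K hv (D.N_mul β hij y)
  | zero => rw [zero_mul]; exact D.K.zero_mem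
  | add a b _ _ iha ihb => rw [add_mul]; exact D.K.add_mem iha ihb
  | smul a b _ ih => rw [smul_mul_assoc]; exact D.K.smul_mem _ ih

lemma K_mul {x y : R} (hx : x ∈ D.K) (hy : D.Inv y) : x * y ∈ D.K := by
  obtain ⟨a, ha, b, hb, rfl⟩ := Submodule.mem_sup.1 hx
  rw [add_mul]
  exact D.K.add_mem (D.J_le_K (hy.J_mul ha)) (D.Ls_mul hb y)

lemma sum_lev (p : Fin (n / l)) (a : Fin l) (g : Fin n → R) :
    ∑ k : Fin n, (if lev l k = a.val then g k else 0) = ∑ r, g (bidx D.hdvd r a) := by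
  rw [← Finset.sum_filter]
  symm
  apply Finset.sum_bij (fun r _ => bidx D.hdvd r a)
  · intro r _; simp [lev_bidx]
  · intro r _ r' _ e; exact (bidx_inj _ e).1
  · intro k hk
    obtain ⟨r, c, rfl⟩ := exists_bidx D.hdvd D.hl k
    have : lev l (bidx D.hdvd r c) = a.val := (Finset.mem_filter.1 hk).2
    rw [lev_bidx] at this
    exact ⟨r, Finset.mem_univ _, by rw [Fin.ext this]⟩
  · intro r _; rfl

lemma recK (s : ℕ) (β : Bool) (p : Fin (n / l)) (a : Fin l) (j : Fin n) (hj : lev l j = 0) :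
    D.T (s + 1) β (bidx D.hdvd p a) j - D.Tp s β (bidx D.hdvd p a) j -
      ∑ γ : Bool, ∑ r, pw s γ • (D.X γ (bidx D.hdvd p a) (bidx D.hdvd r a) *
        D.T s (xor β γ) (bidx D.hdvd r a) j) ∈ D.K := by
  have h1 := D.J_le_K (D.recJ s β (bidx D.hdvd p a) j hj)
  have h2 : D.Sp s β (bidx D.hdvd p a) j - ∑ γ : Bool, ∑ r, pw s γ •
      (D.X γ (bidx D.hdvd p a) (bidx D.hdvd r a) * D.T s (xor β γ) (bidx D.hdvd r a) j) ∈ D.K := by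
    rw [Sp, ← Finset.sum_sub_distrib]
    apply Submodule.sum_mem
    intro γ _
    rw [← D.sum_lev p a (fun k => pw s γ • (D.X γ (bidx D.hdvd p a) k * D.T s (xor β γ) k j)),
      ← Finset.sum_sub_distrib]
    apply Submodule.sum_mem
    intro k _
    rw [lev_bidx]
    by_cases e : lev l k = a.val
    · rw [if_pos e.ge, if_pos e, sub_self]; exact D.K.zero_mem
    · rw [if_neg e, sub_zero]
      split_ifs with e'
      · exact D.K.smul_mem _ (D.N_mul _ (by rw [lev_bidx]; omega) _)
      · exact D.K.zero_mem
  have := D.K.add_mem h1 h2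
  rwa [sub_add_sub_cancel] at this

lemma hc_main (q : Fin (n / l)) (H : ℕ → ℕ → Bool → Fin (n / l) → R)
    (h0 : ∀ a, a < l → ∀ β p, H a 0 β p = algebraMap ℂ R (if β = false ∧ p = q then 1 else 0))
    (h1 : ∀ (a : Fin l) r β p, H a.val (r + 1) β p =
      (if 0 < a.val then H (a.val - 1) (r + 1) β p else 0) +
      ∑ γ : Bool, ∑ k, pw r γ • (pw a.val γ • D.X γ (bidx D.hdvd p a) (bidx D.hdvd k a)
        * H a.val r (xor β γ) k)) :
    ∀ (a : ℕ) (ha : a < l) (r : ℕ) β p,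
      D.T (a + r) β (bidx D.hdvd p ⟨a, ha⟩) (bidx D.hdvd q ⟨0, D.hl⟩) - H a r β p ∈ D.K := by
  intro a
  induction a with
  | zero =>
    intro ha r
    induction r with
    | zero =>
      intro β p
      rw [h0 0 ha, D.T_zero]
      have : (if β = true then 0 else kd (bidx D.hdvd p ⟨0, ha⟩) (bidx D.hdvd q ⟨0, D.hl⟩)) =
        if β = false ∧ p = q then (1 : ℂ) else 0 := by
        rw [kd_bidx]; cases β <;> simp [kdl, kd]
      rw [this, sub_self]; exact D.K.zero_mem
    | succ r ih =>
      intro β p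
      have e1 := D.recK (0 + r) β p ⟨0, ha⟩ (bidx D.hdvd q ⟨0, D.hl⟩) (lev_bidx _ _ _)
      rw [Tp, if_neg (by rw [lev_bidx]; simp), sub_zero] at e1
      have e2 := h1 ⟨0, ha⟩ r β p
      rw [if_neg (by simp), zero_add] at e2
      have e3 : (∑ γ : Bool, ∑ k, pw (0 + r) γ • (D.X γ (bidx D.hdvd p ⟨0, ha⟩) (bidx D.hdvd k ⟨0, ha⟩) *
        D.T (0 + r) (xor β γ) (bidx D.hdvd k ⟨0, ha⟩) (bidx D.hdvd q ⟨0, D.hl⟩))) - H 0 (r + 1) β p ∈ D.K := by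
        rw [e2, ← Finset.sum_sub_distrib]
        refine Submodule.sum_mem _ fun γ _ => ?_
        rw [← Finset.sum_sub_distrib]
        refine Submodule.sum_mem _ fun k _ => ?_
        have e4 := D.K.smul_mem (pw r γ) (D.Up_K (D.X_Up γ (i := bidx D.hdvd p ⟨0, ha⟩)
          (j := bidx D.hdvd k ⟨0, ha⟩) (by rw [lev_bidx, lev_bidx])) (ih (xor β γ) k))
        have e5 : pw 0 γ = 1 := by cases γ <;> simp
        rw [mul_sub, smul_sub] at e4
        simp only [e5, one_smul, zero_add] at e4 ⊢
        exact e4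
      have := D.K.add_mem e1 e3
      rwa [sub_add_sub_cancel] at this
  | succ a iha =>
    intro ha r
    induction r with
    | zero =>
      intro β p
      rw [h0 _ ha]
      have e1 := D.J_le_K (D.T_diag (a + 1) β (bidx D.hdvd p ⟨a + 1, ha⟩) (bidx D.hdvd q ⟨0, D.hl⟩)
        (lev_bidx _ _ _) (lev_bidx _ _ _))
      have e2 : (bidx D.hdvd p ⟨a + 1, ha⟩).val = (bidx D.hdvd q ⟨0, D.hl⟩).val + (a + 1) ↔ p = q := by
        constructor
        · intro e
          have e' : bidx D.hdvd p ⟨a + 1, ha⟩ = bidx D.hdvd q ⟨a + 1, ha⟩ := by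
            apply Fin.ext; rw [e]; simp [bidx]
          exact (bidx_inj _ e').1
        · rintro rfl; simp [bidx]
      simp only [e2] at e1
      exact e1
    | succ r ih =>
      intro β p
      have e1 := D.recK (a + 1 + r) β p ⟨a + 1, ha⟩ (bidx D.hdvd q ⟨0, D.hl⟩) (lev_bidx _ _ _)
      have e0 : pred (bidx D.hdvd p ⟨a + 1, ha⟩) = bidx D.hdvd p ⟨a, by omega⟩ := by
        apply Fin.ext; simp only [pred, bidx]; omega
      rw [Tp, if_pos (by rw [lev_bidx]; simp), e0] at e1
      have e2 := h1 ⟨a + 1, ha⟩ r β p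
      rw [if_pos (by simp)] at e2
      have e6 := iha (by omega) (r + 1) β p
      have e3 : (∑ γ : Bool, ∑ k, pw (a + 1 + r) γ • (D.X γ (bidx D.hdvd p ⟨a + 1, ha⟩)
        (bidx D.hdvd k ⟨a + 1, ha⟩) *
        D.T (a + 1 + r) (xor β γ) (bidx D.hdvd k ⟨a + 1, ha⟩) (bidx D.hdvd q ⟨0, D.hl⟩))) -
        (H (a + 1) (r + 1) β p - H a (r + 1) β p) ∈ D.K := by
        have e7 : H (a + 1) (r + 1) β p - H a (r + 1) β p =
          ∑ γ : Bool, ∑ k, pw r γ • (pw (a + 1) γ • D.X γ (bidx D.hdvd p ⟨a + 1, ha⟩)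
            (bidx D.hdvd k ⟨a + 1, ha⟩) * H (a + 1) r (xor β γ) k) := by
          rw [e2]; simp only [Nat.add_sub_cancel]; abel
        rw [e7, ← Finset.sum_sub_distrib]
        refine Submodule.sum_mem _ fun γ _ => ?_
        rw [← Finset.sum_sub_distrib]
        refine Submodule.sum_mem _ fun k _ => ?_
        have e4 := D.K.smul_mem (pw (a + 1 + r) γ) (D.Up_K (D.X_Up γ (i := bidx D.hdvd p ⟨a + 1, ha⟩)
          (j := bidx D.hdvd k ⟨a + 1, ha⟩) (by rw [lev_bidx, lev_bidx])) (ih (xor β γ) k))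
        rw [mul_sub, smul_sub] at e4
        rw [smul_mul_assoc, smul_smul, mul_comm (pw r γ), ← pw_add]
        exact e4
      have e8 : a + 1 + r = a + (r + 1) := by omega
      have := D.K.add_mem (D.K.add_mem e1 e3) e6
      rw [← e8] at this
      convert this using 1
      rw [show a + 1 + (r + 1) = a + 1 + r + 1 from rfl]
      abel

end Dat

/-- The convolution identity. -/
lemma conv {m : ℕ} {S : Type} [Ring S] [Algebra ℂ S] (x : Bool → Fin m → Fin m → S)
    (TT : ℕ → Bool → Fin m → Fin m → S)
    (hT0 : ∀ γ p k, TT 0 γ p k = algebraMap ℂ S (if γ then 0 else kd p k))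
    (hT : ∀ s γ p k, TT (s + 1) γ p k = ∑ δ : Bool, ∑ j, pw s δ • (x δ p j * TT s (xor γ δ) j k))
    (g C : ℕ → Bool → Fin m → S)
    (hC : ∀ s β p, C s β p = ∑ t : Fin (s + 1), ∑ γ : Bool, ∑ k, pw t.val γ •
      (TT (s - t.val) γ p k * g t.val (xor β γ) k)) :
    (∀ β p, C 0 β p = g 0 β p) ∧ ∀ s β p, C (s + 1) β p = g (s + 1) β p +
      ∑ δ : Bool, ∑ j, pw s δ • (x δ p j * C s (xor β δ) j) := by
  have top : ∀ s β p, ∑ γ : Bool, ∑ k, pw s γ • (TT 0 γ p k * g s (xor β γ) k) = g s β p := by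
    intro s β p
    rw [Fintype.sum_bool]
    simp [hT0, kd, ite_smul, apply_ite]
  constructor
  · intro β p
    rw [hC, Fin.sum_univ_one]
    exact top 0 β p
  · intro s β p
    rw [hC, Fin.sum_univ_castSucc, add_comm]
    congr 1
    · simp only [Fin.val_last, Nat.sub_self]
      exact top (s + 1) β p
    · simp only [hC, Finset.mul_sum, Finset.smul_sum]
      have lhs : ∀ t : Fin (s + 1), ∑ γ : Bool, ∑ k, pw t.castSucc.val γ •
          (TT (s + 1 - t.castSucc.val) γ p k * g t.castSucc.val (xor β γ) k) =
          ∑ δ : Bool, ∑ j, ∑ γ : Bool, ∑ k, pw s δ • (x δ p j * (pw t.val γ •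
            (TT (s - t.val) γ j k * g t.val (xor (xor β δ) γ) k))) := by
        intro t
        have e : s + 1 - t.val = (s - t.val) + 1 := by
          have := t.isLt; omega
        have ht : pw s = pw ((s - t.val) + t.val) := by
          congr 1; have := t.isLt; omega
        have a1 : ∀ δ : Bool, ∀ j, ∑ γ : Bool, ∑ k, pw s δ • (x δ p j * (pw t.val γ •
            (TT (s - t.val) γ j k * g t.val (xor (xor β δ) γ) k))) =
            ∑ γ : Bool, ∑ k, pw t.val γ • (pw (s - t.val) δ • (x δ p j * TT (s - t.val) (xor γ δ) j k)
              * g t.val (xor β γ) k) := by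
          intro δ j
          rw [← Equiv.sum_comp (Equiv.mk (fun γ => xor γ δ) (fun γ => xor γ δ)
            (fun γ => by simp) (fun γ => by simp))]
          refine Finset.sum_congr rfl fun γ _ => Finset.sum_congr rfl fun k _ => ?_
          have b1 : xor (xor β δ) (xor γ δ) = xor β γ := by cases β <;> cases γ <;> cases δ <;> rfl
          simp only [Equiv.coe_fn_mk, b1]
          rw [mul_smul_comm, smul_smul, ht, pw_add, ← pw_xor t.val γ δ, smul_mul_assoc, smul_smul]
          congr 1
          · have := pw_sq t.val δ
            linear_combination (pw (s - t.val) δ * pw t.val γ) * this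
          · rw [mul_assoc]
        simp only [a1, e, hT, Fin.val_castSucc]
        simp only [Finset.sum_mul, Finset.smul_sum]
        rw [Finset.sum_congr rfl (fun γ _ => Finset.sum_comm)]
        rw [Finset.sum_comm]
        refine Finset.sum_congr rfl fun δ _ => ?_
        rw [Finset.sum_congr rfl (fun γ _ => Finset.sum_comm)]
        rw [Finset.sum_comm]
      rw [Finset.sum_congr rfl (fun t _ => lhs t), Finset.sum_comm]
      refine Finset.sum_congr rfl fun δ _ => ?_
      rw [Finset.sum_comm]

end QW

namespace QW

/-! ## Part 10: the abstract comparison and the concrete bridge -/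

namespace Dat
variable {n l : ℕ} {R : Type} [Ring R] [Algebra ℂ R] (D : Dat n l R)

lemma Inv_iff (y : R) : D.Inv y ↔ ∀ β i j, lev l j < lev l i →
    D.X β i j * y - y * D.X β i j ∈ D.J ∨ (chi l β i j = 0 ∧ D.X β i j * y ∈ D.J) := by
  constructor
  · intro hy β i j h
    left
    have h1 := hy β i j h
    have h2 := D.J_mul y (D.M_mem β h)
    have e : D.X β i j * y - y * D.X β i j = D.M β i j * y - y * D.M β i j := by
      rw [M, sub_mul, mul_sub, Algebra.commutes]; abel
    rw [e]
    exact D.J.sub_mem h1 h2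
  · intro hy β i j h
    rcases hy β i j h with h1 | ⟨h0, h1⟩
    · have h2 := D.J_mul y (D.M_mem β h)
      have e : D.M β i j * y = (D.X β i j * y - y * D.X β i j) + y * D.M β i j := by
        rw [M, sub_mul, mul_sub, Algebra.commutes]; abel
      rw [e]
      exact D.J.add_mem h1 h2
    · rw [M, h0, map_zero, sub_zero]; exact h1

/-- `y` is an invariant with Harish-Chandra projection `t`. -/
def Rl {S : Type} [Ring S] [Algebra ℂ S] (ι : S →ₐ[ℂ] R) (t : S) : Prop :=
  ∃ y, D.Inv y ∧ y - ι t ∈ D.K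

lemma rl_mul {S : Type} [Ring S] [Algebra ℂ S] (ι : S →ₐ[ℂ] R) (hU : ∀ t, ι t ∈ D.Up)
    {y y' : R} {t t' : S} (hy : D.Inv y ∧ y - ι t ∈ D.K) (hy' : D.Inv y' ∧ y' - ι t' ∈ D.K) :
    D.Inv (y * y') ∧ y * y' - ι (t * t') ∈ D.K := by
  refine ⟨hy.1.mul hy'.1, ?_⟩
  have e : y * y' - ι (t * t') = (y - ι t) * y' + ι t * (y' - ι t') := by
    rw [map_mul, sub_mul, mul_sub]; abel
  rw [e]
  exact D.K.add_mem (D.K_mul hy.2 hy'.1) (D.Up_K (hU t) hy'.2)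

theorem compare {S Y : Type} [Ring S] [Algebra ℂ S] [Ring Y] [Algebra ℂ Y]
    (ι : S →ₐ[ℂ] R) (hU : ∀ t, ι t ∈ D.Up) (hinj : ∀ t, ι t ∈ D.K → t = 0)
    (Gl : Y →ₐ[ℂ] S)
    (k1 : ∀ r β i j, lev l i + 1 = l → lev l j = 0 → ∃ τ, D.T (l - 1 + r) β i j - ι (Gl τ) ∈ D.K)
    (s : Set Y) (hs : Algebra.adjoin ℂ s = ⊤)
    (k2 : ∀ y ∈ s, ∃ v, D.Inv v ∧ v - ι (Gl y) ∈ D.K) :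
    {t : S | ∃ y, D.Inv y ∧ y - ι t ∈ D.K} = Set.range Gl := by
  ext t
  constructor
  · rintro ⟨y, hy, hyt⟩
    obtain ⟨b, hb, hyb⟩ := D.upper hy
    have key : ∃ τ, D.Inv b ∧ b - ι (Gl τ) ∈ D.K := by
      have hb' : b ∈ Algebra.adjoin ℂ {x | ∃ (r : ℕ) (β : Bool) (i j : Fin n),
        lev l i + 1 = l ∧ lev l j = 0 ∧ x = D.T (l + r) β i j} := hb
      clear hb hyb
      induction hb' using Algebra.adjoin_induction with
      | mem x h =>
        obtain ⟨r, β, i, j, hi, hj, rfl⟩ := h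
        obtain ⟨τ, hτ⟩ := k1 (r + 1) β i j hi hj
        have := D.hl
        rw [show l - 1 + (r + 1) = l + r by omega] at hτ
        exact ⟨τ, D.T_Inv _ β i j hi hj, hτ⟩
      | algebraMap r =>
        refine ⟨algebraMap ℂ Y r, ?_, ?_⟩
        · rw [Algebra.algebraMap_eq_smul_one]; exact (Inv.one D).smul r
        · rw [AlgHom.commutes, AlgHom.commutes, sub_self]; exact D.K.zero_mem
      | add a b _ _ h1 h2 =>
        obtain ⟨τ1, h1, h1'⟩ := h1
        obtain ⟨τ2, h2, h2'⟩ := h2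
        refine ⟨τ1 + τ2, h1.add h2, ?_⟩
        rw [map_add, map_add, add_sub_add_comm]
        exact D.K.add_mem h1' h2'
      | mul a b _ _ h1 h2 =>
        obtain ⟨τ1, h1⟩ := h1
        obtain ⟨τ2, h2⟩ := h2
        refine ⟨τ1 * τ2, ?_⟩
        rw [map_mul]
        exact D.rl_mul ι hU h1 h2
    obtain ⟨τ, -, hτ⟩ := key
    refine ⟨τ, ?_⟩
    have e : ι (t - Gl τ) = (y - b) + (b - ι (Gl τ)) - (y - ι t) := by rw [map_sub]; abel
    have := hinj (t - Gl τ) (by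
      rw [e]; exact D.K.sub_mem (D.K.add_mem (D.J_le_K hyb) hτ) hyt)
    exact (sub_eq_zero.1 this).symm
  · rintro ⟨τ, rfl⟩
    have : τ ∈ Algebra.adjoin ℂ s := by rw [hs]; trivial
    change ∃ y, D.Inv y ∧ y - ι (Gl τ) ∈ D.K
    induction this using Algebra.adjoin_induction with
    | mem x h => exact k2 x h
    | algebraMap r =>
      refine ⟨algebraMap ℂ R r, ?_, ?_⟩
      · rw [Algebra.algebraMap_eq_smul_one]; exact (Inv.one D).smul r
      · rw [AlgHom.commutes, AlgHom.commutes, sub_self]; exact D.K.zero_mem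
    | add a b _ _ h1 h2 =>
      obtain ⟨τ1, h1, h1'⟩ := h1
      obtain ⟨τ2, h2, h2'⟩ := h2
      refine ⟨τ1 + τ2, h1.add h2, ?_⟩
      rw [map_add, map_add, add_sub_add_comm]
      exact D.K.add_mem h1' h2'
    | mul a b _ _ h1 h2 =>
      obtain ⟨τ1, h1⟩ := h1
      obtain ⟨τ2, h2⟩ := h2
      refine ⟨τ1 * τ2, ?_⟩
      rw [map_mul]
      exact D.rl_mul ι hU h1 h2

/-- Values of the partial embeddings. -/
def pv {k : ℕ} (β : Bool) (b : Fin k) (p q : Fin (n / l)) : R :=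
  if hb : b.val < l then pw b.val β • D.X β (bidx D.hdvd p ⟨b.val, hb⟩) (bidx D.hdvd q ⟨b.val, hb⟩)
  else 0

lemma pv_rel {k : ℕ} (β γ : Bool) (a b : Fin k) (p q r s : Fin (n / l)) :
    D.pv β a p q * D.pv γ b r s = sg β γ • (D.pv γ b r s * D.pv β a p q)
      + (kdl a b * kd q r) • D.pv (xor β γ) a p s
      - (sg β γ * (kdl a b * kd s p)) • D.pv (xor β γ) b r q := by
  by_cases hab : a = b
  · subst hab
    unfold pv
    by_cases ha : a.val < l
    · simp only [dif_pos ha, smul_mul_assoc, mul_smul_comm, D.rel β γ, smul_sub, smul_add,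
        smul_smul, ← pw_xor, kd_bidx, kdl, if_true, one_mul]
      module
    · simp [dif_neg ha]
  · unfold pv
    simp only [kdl, if_neg hab, zero_mul, mul_zero, zero_smul, add_zero, sub_zero]
    by_cases ha : a.val < l
    · by_cases hb : b.val < l
      · have hab' : (⟨a.val, ha⟩ : Fin l) ≠ ⟨b.val, hb⟩ := by
          intro e; rw [Fin.mk.injEq] at e; exact hab (Fin.ext e)
        simp only [dif_pos ha, dif_pos hb, smul_mul_assoc, mul_smul_comm, D.rel β γ, smul_sub,
          smul_add, smul_smul, kd_bidx, kdl, if_neg hab', if_neg hab'.symm, zero_mul, mul_zero,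
          zero_smul]
        module
      · simp [dif_neg hb]
    · simp [dif_neg ha]

end Dat

section bridge
variable (n l : ℕ) (hl : 0 < l) (h : l ∣ n)

lemma chi_bidx (p q : Fin (n / l)) (a b : Fin l) :
    chi l false (bidx h p a) (bidx h q b) = if a.val = b.val + 1 ∧ p = q then 1 else 0 := by
  unfold chi
  rw [lev_bidx, lev_bidx]
  congr 1
  apply propext
  constructor
  · rintro ⟨-, h1, h2⟩
    refine ⟨h2, ?_⟩
    simp only [bidx] at h1
    have e : l * p.val = l * q.val := by omega
    exact Fin.ext (Nat.eq_of_mul_eq_mul_left a.pos e)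
  · rintro ⟨h1, rfl⟩
    refine ⟨rfl, ?_, h1⟩
    simp only [bidx]; omega

lemma Ichi_eq : (Ichi n l h).restrictScalars ℂ = (datUQ n l hl h).J := by
  have : mSet n l h = {x | ∃ β i j, lev l j < lev l i ∧ x = (datUQ n l hl h).M β i j} := by
    ext x
    constructor
    · rintro ⟨p, q, a, b, hab, rfl | rfl⟩
      · refine ⟨false, bidx h p a, bidx h q b, by rw [lev_bidx, lev_bidx]; exact hab, ?_⟩
        unfold Dat.M
        rw [chi_bidx]; rfl
      · refine ⟨true, bidx h p a, bidx h q b, by rw [lev_bidx, lev_bidx]; exact hab, ?_⟩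
        unfold Dat.M
        rw [Dat.chi_true, map_zero, sub_zero]; rfl
    · rintro ⟨β, i, j, hij, rfl⟩
      obtain ⟨p, a, rfl⟩ := exists_bidx h hl i
      obtain ⟨q, b, rfl⟩ := exists_bidx h hl j
      rw [lev_bidx, lev_bidx] at hij
      refine ⟨p, q, a, b, hij, ?_⟩
      unfold Dat.M
      cases β
      · left; rw [chi_bidx]; rfl
      · right; rw [Dat.chi_true, map_zero, sub_zero]; rfl
  unfold Ichi Dat.J Dat.I
  rw [this]

lemma Up_eq : Algebra.adjoin ℂ (pSet n l h) = (datUQ n l hl h).Up := by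
  have : pSet n l h = {x | ∃ β i j, lev l i ≤ lev l j ∧ x = (datUQ n l hl h).X β i j} := by
    ext x
    constructor
    · rintro ⟨p, q, a, b, hab, rfl | rfl⟩
      · exact ⟨false, bidx h p a, bidx h q b, by rw [lev_bidx, lev_bidx]; exact hab, rfl⟩
      · exact ⟨true, bidx h p a, bidx h q b, by rw [lev_bidx, lev_bidx]; exact hab, rfl⟩
    · rintro ⟨β, i, j, hij, rfl⟩
      obtain ⟨p, a, rfl⟩ := exists_bidx h hl i
      obtain ⟨q, b, rfl⟩ := exists_bidx h hl j
      rw [lev_bidx, lev_bidx] at hij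
      refine ⟨p, q, a, b, hij, ?_⟩
      cases β
      · left; rfl
      · right; rfl
  unfold Dat.Up
  rw [this]

lemma Lspan_eq : Lspan n l h = (datUQ n l hl h).Ls := by
  unfold Lspan Dat.Ls
  congr 1
  ext x
  rw [Set.mem_ofPred_eq, Set.mem_ofPred_eq, Up_eq n l hl h]
  constructor
  · rintro ⟨u, hu, g, ⟨p, q, a, b, hab, rfl | rfl⟩, rfl⟩
    · exact ⟨u, hu, false, bidx h p a, bidx h q b, by rw [lev_bidx, lev_bidx]; exact hab, rfl⟩
    · exact ⟨u, hu, true, bidx h p a, bidx h q b, by rw [lev_bidx, lev_bidx]; exact hab, rfl⟩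
  · rintro ⟨u, hu, β, i, j, hij, rfl⟩
    refine ⟨u, hu, _, ?_, rfl⟩
    obtain ⟨p, a, rfl⟩ := exists_bidx h hl i
    obtain ⟨q, b, rfl⟩ := exists_bidx h hl j
    rw [lev_bidx, lev_bidx] at hij
    refine ⟨p, q, a, b, hij, ?_⟩
    cases β
    · left; rfl
    · right; rfl

lemma mem_Ichi (x : UQ n) : x ∈ Ichi n l h ↔ x ∈ (datUQ n l hl h).J := by
  rw [← Ichi_eq n l hl h, Submodule.restrictScalars_mem]

lemma Wcond_iff (σ : UQ n →ₐ[ℂ] UQ n) (y : UQ n) : Wcond h σ y ↔ (datUQ n l hl h).Inv y := by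
  have hf : ∀ (p q : Fin (n / l)) (a b : Fin l), b.val < a.val →
      σ y * Uf (bidx h p a) (bidx h q b) ∈ (datUQ n l hl h).J := by
    intro p q a b hab
    refine (datUQ n l hl h).J_mul (σ y) ?_
    rw [← mem_Ichi n l hl h]
    exact Submodule.subset_span ⟨p, q, a, b, hab, Or.inr rfl⟩
  constructor
  · intro hy
    rw [Dat.Inv_iff]
    intro β i j hij
    obtain ⟨p, a, rfl⟩ := exists_bidx h hl i
    obtain ⟨q, b, rfl⟩ := exists_bidx h hl j
    rw [lev_bidx, lev_bidx] at hij
    have h1 := hy p q a b hij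
    rw [mem_Ichi n l hl h, mem_Ichi n l hl h] at h1
    cases β
    · left; exact h1.1
    · right
      refine ⟨Dat.chi_true .., ?_⟩
      have := (datUQ n l hl h).J.add_mem h1.2 (hf p q a b hij)
      rw [sub_add_cancel] at this
      exact this
  · intro hy p q a b hab
    have hab' : lev l (bidx h q b) < lev l (bidx h p a) := by rw [lev_bidx, lev_bidx]; exact hab
    rw [mem_Ichi n l hl h, mem_Ichi n l hl h]
    constructor
    · rcases (Dat.Inv_iff _ y).1 hy false _ _ hab' with h1 | ⟨h0, h1⟩
      · exact h1
      · have h2 := (datUQ n l hl h).J_mul y ((datUQ n l hl h).M_mem false hab')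
        unfold Dat.M at h2
        rw [h0, map_zero, sub_zero] at h2
        exact (datUQ n l hl h).J.sub_mem h1 h2
    · refine (datUQ n l hl h).J.sub_mem ?_ (hf p q a b hab)
      have h1 := hy true _ _ hab'
      unfold Dat.M at h1
      rw [Dat.chi_true, map_zero, sub_zero] at h1
      exact h1

end bridge
end QW

namespace QW

/-! ## Part 11: the Yangian side -/

lemma TY_zero {m : ℕ} (i j : QIdx m) : TY 0 i j = algebraMap ℂ (YQ m) (kdq i j) := by
  unfold TY Tf
  exact AlgHom.commutes _ _

lemma TY_par {m : ℕ} (t : ℕ) (β γ : Bool) (q k : Fin m) :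
    TY t (β, q) (γ, k) = pw t γ • TY t (xor β γ, q) (false, k) := by
  cases γ
  · rw [pw_f, one_smul, Bool.xor_false]
  · cases t with
    | zero =>
      rw [TY_zero, TY_zero, pw_t, pow_zero, one_smul]
      congr 1
      unfold kdq
      cases β <;> simp
    | succ t =>
      have := RingQuot.mkAlgHom_rel ℂ (YRel.par t ((!β, q) : QIdx m) (false, k))
      rw [map_smul] at this
      have e : qneg ((!β, q) : QIdx m) = (β, q) := by simp [qneg]
      rw [e] at this
      rw [Bool.xor_true]
      exact this

lemma YQ_gen (m : ℕ) : Algebra.adjoin ℂ {x : YQ m | ∃ r i j, x = TY r i j} = ⊤ :=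
  gen_of_surj (RingQuot.mkAlgHom ℂ (YRel m)) (RingQuot.mkAlgHom_surjective ℂ _) _
    (fun x => match x with
      | YGen.T r i j => ⟨r + 1, i, j, rfl⟩)

lemma Uval_eq {m : ℕ} (r : ℕ) (γ : Bool) (k p : Fin m) :
    Uval r (γ, k) (false, p) = (-1 : ℂ) ^ r • T r γ p k := by
  unfold Uval T
  cases γ
  · exact one_smul ℂ _
  · exact one_smul ℂ _

lemma TQ_ext {m k : ℕ} {A : Type} [Ring A] [Algebra ℂ A] (F F' : TQ m k →ₐ[ℂ] A)
    (hF : ∀ β a p q, F (xX β a p q) = F' (xX β a p q)) : F = F' := by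
  apply AlgHom.ext_of_adjoin_eq_top (TQ_gen m k)
  rintro _ ⟨β, a, p, q, rfl⟩
  exact hF β a p q

section rec
variable {m : ℕ}
    (emb : ∀ k : ℕ, Fin k → (UQ m →ₐ[ℂ] TQ m k))
    (ish : ∀ k : ℕ, TQ m k →ₐ[ℂ] TQ m (k + 1))
    (G : ∀ k : ℕ, YQ m →ₐ[ℂ] TQ m k)
    (q : Fin m)

/-- Normalized images of the Yangian generators. -/
def gg (k r : ℕ) (β : Bool) (p : Fin m) : TQ m k := (-1 : ℂ) ^ r • G k (TY r (β, q) (false, p))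

lemma gg_zero (k : ℕ) (β : Bool) (p : Fin m) :
    gg G q k 0 β p = algebraMap ℂ _ (if β = false ∧ p = q then 1 else 0) := by
  unfold gg
  rw [pow_zero, one_smul, TY_zero, AlgHom.commutes]
  congr 1
  unfold kdq
  congr 1
  simp [eq_comm]

lemma embT_succ (hemb : ∀ (k : ℕ) β (a : Fin k) (i j : Fin m), emb k a (X β i j) = xX β a i j)
    (k : ℕ) (a : Fin k) (s : ℕ) (β : Bool) (p j : Fin m) :
    emb k a (T (s + 1) β p j) = ∑ δ : Bool, ∑ i, pw s δ • (xX δ a p i * emb k a (T s (xor β δ) i j)) := by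
  rw [T_succ, map_sum]
  refine Finset.sum_congr rfl fun δ _ => ?_
  rw [map_sum]
  refine Finset.sum_congr rfl fun i _ => ?_
  rw [map_smul, map_mul, hemb]

lemma gg_one (hemb : ∀ (k : ℕ) β (a : Fin k) (i j : Fin m), emb k a (X β i j) = xX β a i j)
    (hG1 : ∀ (s : ℕ) (i j : QIdx m), G 1 (TY s i j) = emb 1 0 (Uval s i j))
    (s : ℕ) (β : Bool) (p : Fin m) :
    gg G q 1 (s + 1) β p = ∑ δ : Bool, ∑ i, pw s δ • (xX δ 0 p i * gg G q 1 s (xor β δ) i) := by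
  have e : ∀ s β p, gg G q 1 s β p = emb 1 0 (T s β p q) := by
    intro s β p
    unfold gg
    rw [hG1, Uval_eq, map_smul, smul_smul, ← mul_pow]
    simp
  rw [e, embT_succ emb hemb]
  simp only [e]

lemma gg_conv (hGstep : ∀ (k : ℕ), 1 ≤ k → ∀ (s : ℕ) (i j : QIdx m),
      G (k + 1) (TY s i j) =
        ∑ t : Fin (s + 1), ∑ kk : QIdx m,
          emb (k + 1) (Fin.last k) (Uval (s - t.val) kk j) *
            ish k (G k (TY t.val i kk)))
    (k : ℕ) (hk : 1 ≤ k) (s : ℕ) (β : Bool) (p : Fin m) :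
    gg G q (k + 1) s β p = ∑ t : Fin (s + 1), ∑ γ : Bool, ∑ i, pw t.val γ •
      (emb (k + 1) (Fin.last k) (T (s - t.val) γ p i) * ish k (gg G q k t.val (xor β γ) i)) := by
  unfold gg
  rw [hGstep k hk, Finset.smul_sum]
  refine Finset.sum_congr rfl fun t _ => ?_
  rw [Fintype.sum_prod_type, Finset.smul_sum]
  refine Finset.sum_congr rfl fun γ _ => ?_
  rw [Finset.smul_sum]
  refine Finset.sum_congr rfl fun i _ => ?_
  rw [Uval_eq, TY_par t.val β γ q i]
  rw [map_smul, map_smul, map_smul, map_smul, smul_mul_assoc, mul_smul_comm, mul_smul_comm,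
    smul_smul, smul_smul, smul_smul]
  congr 1
  have h1 : (-1 : ℂ) ^ s = (-1) ^ (s - t.val) * (-1) ^ t.val := by
    rw [← pow_add]; congr 1; have := t.isLt; omega
  have h2 : (-1 : ℂ) ^ (s - t.val) * (-1) ^ (s - t.val) = 1 := by rw [← mul_pow]; simp
  rw [h1]
  linear_combination ((-1) ^ t.val * pw t.val γ) * h2

lemma gg_succ (hemb : ∀ (k : ℕ) β (a : Fin k) (i j : Fin m), emb k a (X β i j) = xX β a i j)
    (hGstep : ∀ (k : ℕ), 1 ≤ k → ∀ (s : ℕ) (i j : QIdx m),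
      G (k + 1) (TY s i j) =
        ∑ t : Fin (s + 1), ∑ kk : QIdx m,
          emb (k + 1) (Fin.last k) (Uval (s - t.val) kk j) *
            ish k (G k (TY t.val i kk)))
    (k : ℕ) (hk : 1 ≤ k) (s : ℕ) (β : Bool) (p : Fin m) :
    gg G q (k + 1) (s + 1) β p = ish k (gg G q k (s + 1) β p) +
      ∑ δ : Bool, ∑ i, pw s δ • (xX δ (Fin.last k) p i * gg G q (k + 1) s (xor β δ) i) := by
  exact (conv (fun δ p i => xX δ (Fin.last k) p i) (fun s γ p i => emb (k + 1) (Fin.last k) (T s γ p i))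
    (fun γ p i => by rw [T_zero, AlgHom.commutes])
    (fun s γ p i => embT_succ emb hemb (k + 1) (Fin.last k) s γ p i)
    (fun s β p => ish k (gg G q k s β p)) (fun s β p => gg G q (k + 1) s β p)
    (fun s β p => gg_conv emb ish G q hGstep k hk s β p)).2 s β p

end rec

lemma TQ_lift' (n l : ℕ) (hl : 0 < l) (h : l ∣ n) (k : ℕ) : ∃ F : TQ (n / l) k →ₐ[ℂ] UQ n,
    ∀ β (a : Fin k) p q, F (xX β a p q) = (datUQ n l hl h).pv β a p q :=
  TQ_lift (n / l) k (UQ n) (fun β a p q => (datUQ n l hl h).pv β a p q)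
    (fun β γ a b p q r s => (datUQ n l hl h).pv_rel β γ a b p q r s)

theorem hc_gen (n l' : ℕ) (h : l' + 1 ∣ n)
    (ι₀ : TQ (n / (l' + 1)) (l' + 1) →ₐ[ℂ] UQ n)
    (hι : ∀ β a p q, ι₀ (xX β a p q) = pw a.val β • X β (bidx h p a) (bidx h q a))
    (emb : ∀ k : ℕ, Fin k → (UQ (n / (l' + 1)) →ₐ[ℂ] TQ (n / (l' + 1)) k))
    (hemb : ∀ (k : ℕ) β (a : Fin k) i j, emb k a (X β i j) = xX β a i j)
    (ish : ∀ k : ℕ, TQ (n / (l' + 1)) k →ₐ[ℂ] TQ (n / (l' + 1)) (k + 1))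
    (hish : ∀ (k : ℕ) β (a : Fin k) i j, ish k (xX β a i j) = xX β a.castSucc i j)
    (G : ∀ k : ℕ, YQ (n / (l' + 1)) →ₐ[ℂ] TQ (n / (l' + 1)) k)
    (hG1 : ∀ (s : ℕ) i j, G 1 (TY s i j) = emb 1 0 (Uval s i j))
    (hGstep : ∀ (k : ℕ), 1 ≤ k → ∀ (s : ℕ) i j,
      G (k + 1) (TY s i j) =
        ∑ t : Fin (s + 1), ∑ kk : QIdx (n / (l' + 1)),
          emb (k + 1) (Fin.last k) (Uval (s - t.val) kk j) *
            ish k (G k (TY t.val i kk)))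
    (q : Fin (n / (l' + 1))) (r : ℕ) (β : Bool) (p : Fin (n / (l' + 1))) :
    T (l' + r) β (bidx h p ⟨l', Nat.lt_succ_self l'⟩) (bidx h q ⟨0, Nat.succ_pos l'⟩) -
      ι₀ (G (l' + 1) ((-1 : ℂ) ^ r • TY r (β, q) (false, p))) ∈
        (datUQ n (l' + 1) (Nat.succ_pos l') h).K := by
  choose ψ hψ using TQ_lift' n (l' + 1) (Nat.succ_pos l') h
  have hψι : ψ (l' + 1) = ι₀ := by
    apply TQ_ext
    intro β a p q
    rw [hψ, hι, Dat.pv, dif_pos a.isLt]; rfl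
  have hψi : ∀ k, (ψ (k + 1)).comp (ish k) = ψ k := by
    intro k
    apply TQ_ext
    intro β a p q
    rw [AlgHom.comp_apply, hish, hψ, hψ]; rfl
  have hψi' : ∀ k x, ψ (k + 1) (ish k x) = ψ k x := fun k x => by rw [← hψi k]; rfl
  have main := (datUQ n (l' + 1) (Nat.succ_pos l') h).hc_main q
    (fun a r β p => ψ (a + 1) (gg G q (a + 1) r β p))
    (fun a _ β p => by
      change ψ (a + 1) (gg G q (a + 1) 0 β p) = _
      rw [gg_zero, AlgHom.commutes])
    (fun a r β p => by
      change ψ (a.val + 1) (gg G q (a.val + 1) (r + 1) β p) = (if 0 < a.val then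
        ψ (a.val - 1 + 1) (gg G q (a.val - 1 + 1) (r + 1) β p) else 0) + _
      have hx : ∀ (b : Fin (a.val + 1)) δ i, b.val = a.val → ψ (a.val + 1) (xX δ b p i) =
          pw a.val δ • (datUQ n (l' + 1) (Nat.succ_pos l') h).X δ (bidx h p a) (bidx h i a) := by
        intro b δ i hb
        rw [hψ, Dat.pv, dif_pos (by rw [hb]; exact a.isLt)]
        simp only [hb]
      have step : ∀ b : Fin (a.val + 1), b.val = a.val →
          ψ (a.val + 1) (∑ δ : Bool, ∑ i, pw r δ • (xX δ b p i * gg G q (a.val + 1) r (xor β δ) i)) =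
          ∑ γ : Bool, ∑ k, pw r γ • (pw a.val γ • (datUQ n (l' + 1) (Nat.succ_pos l') h).X γ
            (bidx h p a) (bidx h k a) * ψ (a.val + 1) (gg G q (a.val + 1) r (xor β γ) k)) := by
        intro b hb
        rw [map_sum]
        refine Finset.sum_congr rfl fun δ _ => ?_
        rw [map_sum]
        refine Finset.sum_congr rfl fun i _ => ?_
        rw [map_smul, map_mul, hx b δ i hb]
      rcases Nat.eq_zero_or_pos a.val with ha | ha
      · rw [if_neg (by omega), zero_add]
        refine Eq.trans ?_ (step 0 ?_)
        · congr 1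
          have e := gg_one emb G q hemb hG1 r β p
          revert e
          generalize a.val = c at ha ⊢
          subst ha
          exact id
        · exact ha.symm
      · rw [if_pos ha]
        refine Eq.trans ?_ (congrArg (fun z => ψ (a.val - 1 + 1) (gg G q (a.val - 1 + 1) (r + 1) β p) + z)
          (step (Fin.last a.val) rfl))
        clear step hx
        generalize a.val = d at ha ⊢
        obtain ⟨c, rfl⟩ : ∃ c, d = c + 1 := ⟨d - 1, by omega⟩
        change ψ (c + 1 + 1) (gg G q (c + 1 + 1) (r + 1) β p) =
          ψ (c + 1) (gg G q (c + 1) (r + 1) β p) + _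
        rw [gg_succ emb ish G q hemb hGstep (c + 1) (by omega) r β p, map_add, hψi']
        )
    l' (Nat.lt_succ_self l') r β p
  have e : ι₀ (G (l' + 1) ((-1 : ℂ) ^ r • TY r (β, q) (false, p))) =
      ψ (l' + 1) (gg G q (l' + 1) r β p) := by
    rw [hψι]; unfold gg; rw [map_smul, map_smul]
  rw [e]
  exact main

end QW

namespace QW

lemma smul_sub_mem {R : Type} [Ring R] [Algebra ℂ R] (K : Submodule ℂ R) (c : ℂ) {x y : R}
    (hxy : x - y ∈ K) : c • x - c • y ∈ K := by
  rw [← smul_sub]; exact K.smul_mem c hxy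

/-- The comparison of the two subalgebras in uniform notation. -/
theorem final (n l' : ℕ) (h : l' + 1 ∣ n)
    (ι₀ : TQ (n / (l' + 1)) (l' + 1) →ₐ[ℂ] UQ n)
    (hι : ∀ β a p q, ι₀ (xX β a p q) = pw a.val β • X β (bidx h p a) (bidx h q a))
    (Gl : YQ (n / (l' + 1)) →ₐ[ℂ] TQ (n / (l' + 1)) (l' + 1))
    (key : ∀ q r β p, T (l' + r) β (bidx h p ⟨l', Nat.lt_succ_self l'⟩)
      (bidx h q ⟨0, Nat.succ_pos l'⟩) -
      ι₀ (Gl ((-1 : ℂ) ^ r • TY r (β, q) (false, p))) ∈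
        (datUQ n (l' + 1) (Nat.succ_pos l') h).K) :
    {t | ∃ y, (datUQ n (l' + 1) (Nat.succ_pos l') h).Inv y ∧
      y - ι₀ t ∈ (datUQ n (l' + 1) (Nat.succ_pos l') h).K} = Set.range Gl := by
  have hU : ∀ t, ι₀ t ∈ (datUQ n (l' + 1) (Nat.succ_pos l') h).Up := by
    intro t
    have ht : t ∈ Algebra.adjoin ℂ {y | ∃ β a p q, y = (xX β a p q : TQ (n / (l' + 1)) (l' + 1))} := by
      rw [TQ_gen]; trivial
    have hle : Algebra.adjoin ℂ {y | ∃ β a p q, y = (xX β a p q : TQ (n / (l' + 1)) (l' + 1))} ≤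
        (datUQ n (l' + 1) (Nat.succ_pos l') h).Up.comap ι₀ := by
      apply Algebra.adjoin_le
      rintro _ ⟨β, a, p, q, rfl⟩
      change ι₀ (xX β a p q) ∈ (datUQ n (l' + 1) (Nat.succ_pos l') h).Up
      rw [hι]
      refine Subalgebra.smul_mem _ ?_ _
      refine (datUQ n (l' + 1) (Nat.succ_pos l') h).X_Up β ?_
      rw [lev_bidx, lev_bidx]
    exact hle ht
  obtain ⟨rep, hrep⟩ := UQ_lift n (Module.End ℂ (RingQuot (PRel n (l' + 1))))
    (pdMk n (l' + 1)).rho (by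
      intro β γ i j k m
      refine LinearMap.ext fun u => ?_
      exact (pdMk n (l' + 1)).rho_rel u β γ i j k m)
  have hinj : ∀ t, ι₀ t ∈ (datUQ n (l' + 1) (Nat.succ_pos l') h).K → t = 0 := fun t ht =>
    (datUQ n (l' + 1) (Nat.succ_pos l') h).iota_inj (pdMk n (l' + 1)) xX xXrel
      (TQ_gen _ _) rep hrep ι₀ hι t ht
  refine (datUQ n (l' + 1) (Nat.succ_pos l') h).compare ι₀ hU hinj Gl ?_ _ (YQ_gen _) ?_
  · intro r β i j hi hj
    obtain ⟨p, a, rfl⟩ := exists_bidx h (Nat.succ_pos l') i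
    obtain ⟨q, b, rfl⟩ := exists_bidx h (Nat.succ_pos l') j
    rw [lev_bidx] at hi hj
    obtain rfl : a = ⟨l', Nat.lt_succ_self l'⟩ := Fin.ext (Nat.succ.inj hi)
    obtain rfl : b = ⟨0, Nat.succ_pos l'⟩ := Fin.ext hj
    exact ⟨_, key q r β p⟩
  · rintro _ ⟨r, ⟨β, q⟩, ⟨γ, p⟩, rfl⟩
    refine ⟨(pw r γ * (-1) ^ r) • T (l' + r) (xor β γ) (bidx h p ⟨l', Nat.lt_succ_self l'⟩)
      (bidx h q ⟨0, Nat.succ_pos l'⟩), ?_, ?_⟩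
    · refine Dat.Inv.smul _ ?_
      refine (datUQ n (l' + 1) (Nat.succ_pos l') h).T_Inv _ _ _ _ ?_ ?_
      · rw [lev_bidx]
      · rw [lev_bidx]
    · have e : ι₀ (Gl (TY r (β, q) (γ, p))) =
          (pw r γ * (-1) ^ r) • ι₀ (Gl ((-1 : ℂ) ^ r • TY r (xor β γ, q) (false, p))) := by
        rw [TY_par r β γ q p, map_smul, map_smul, map_smul, map_smul, smul_smul, mul_assoc,
          ← mul_pow, neg_one_mul, neg_neg, one_pow, mul_one]
      rw [e]
      exact smul_sub_mem _ _ (key q r (xor β γ) p)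

end QW

/-- Let `l ∣ n` and let `χ` correspond to the even nilpotent element of
`Q(n)` with all Jordan blocks of size `l`.  Under the Harish-Chandra embedding `ϑ` and the
identification `U(g₀) ≅ U(Q(n/l))^{⊗l}`, the finite W-algebra `W_χ` maps isomorphically
onto the image of `Y(Q(n/l))` under `U^{⊗l}∘Δ_l^{op}`:  `ϑ(W_χ)` equals that image.
`ϑ` is expressed via the PBW decomposition `U(Q(n)) = (U(g₀) ⊕ U(p)n) ⊕ I_χ`:
for `π(y) ∈ W_χ`, `ϑ(π(y)) = t` iff `y - ι₀(t) ∈ I_χ + U(p)n`, where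
`ι₀ : U(Q(n/l))^{⊗l} ≅ U(g₀) ⊆ U(Q(n))` is the canonical embedding; `σ` is the parity
involution of `U(Q(n))`, and the family `G j = U^{⊗j}∘Δ_j^{op}` is characterized on the
generators as in Statement 10. -/
theorem statement2 (n l : ℕ) (hn : 0 < n) (hl : 0 < l) (h : l ∣ n)
    (σ : UQ n →ₐ[ℂ] UQ n)
    (hσe : ∀ i j : Fin n, σ (Ue i j) = Ue i j)
    (hσf : ∀ i j : Fin n, σ (Uf i j) = -Uf i j)
    (ι₀ : TQ (n / l) l →ₐ[ℂ] UQ n)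
    (hι₀x : ∀ (i : Fin l) (a b : Fin (n / l)),
      ι₀ (xT i a b) = Ue (bidx h a i) (bidx h b i))
    (hι₀xi : ∀ (i : Fin l) (a b : Fin (n / l)),
      ι₀ (xiT i a b) = ((-1 : ℂ) ^ i.val) • Uf (bidx h a i) (bidx h b i))
    (emb : ∀ k : ℕ, Fin k → (UQ (n / l) →ₐ[ℂ] TQ (n / l) k))
    (hembx : ∀ (k : ℕ) (a : Fin k) (i j : Fin (n / l)), emb k a (Ue i j) = xT a i j)
    (hembxi : ∀ (k : ℕ) (a : Fin k) (i j : Fin (n / l)), emb k a (Uf i j) = xiT a i j)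
    (ish : ∀ k : ℕ, TQ (n / l) k →ₐ[ℂ] TQ (n / l) (k + 1))
    (hishx : ∀ (k : ℕ) (a : Fin k) (i j : Fin (n / l)),
      ish k (xT a i j) = xT a.castSucc i j)
    (hishxi : ∀ (k : ℕ) (a : Fin k) (i j : Fin (n / l)),
      ish k (xiT a i j) = xiT a.castSucc i j)
    (G : ∀ k : ℕ, YQ (n / l) →ₐ[ℂ] TQ (n / l) k)
    (hG1 : ∀ (s : ℕ) (i j : QIdx (n / l)), G 1 (TY s i j) = emb 1 0 (Uval s i j))
    (hGstep : ∀ (k : ℕ), 1 ≤ k → ∀ (s : ℕ) (i j : QIdx (n / l)),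
      G (k + 1) (TY s i j) =
        ∑ t : Fin (s + 1), ∑ kk : QIdx (n / l),
          emb (k + 1) (Fin.last k) (Uval (s - t.val) kk j) *
            ish k (G k (TY t.val i kk))) :
    { t : TQ (n / l) l | ∃ y : UQ n, Wcond h σ y ∧
        y - ι₀ t ∈ (Ichi n l h).restrictScalars ℂ ⊔ Lspan n l h } =
      Set.range ⇑(G l) := by
  obtain ⟨l', rfl⟩ : ∃ l', l = l' + 1 := ⟨l - 1, by omega⟩
  have hι : ∀ β a p q, ι₀ (QW.xX β a p q) =
      QW.pw a.val β • QW.X β (bidx h p a) (bidx h q a) := by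
    intro β a p q
    cases β
    · exact (hι₀x a p q).trans (one_smul ℂ _).symm
    · exact hι₀xi a p q
  have hemb : ∀ (k : ℕ) β (a : Fin k) i j, emb k a (QW.X β i j) = QW.xX β a i j := by
    intro k β a i j
    cases β
    · exact hembx k a i j
    · exact hembxi k a i j
  have hish : ∀ (k : ℕ) β (a : Fin k) i j,
      ish k (QW.xX β a i j) = QW.xX β a.castSucc i j := by
    intro k β a i j
    cases β
    · exact hishx k a i j
    · exact hishxi k a i j
  have key := QW.final n l' h ι₀ hι (G (l' + 1))
    (QW.hc_gen n l' h ι₀ hι emb hemb ish hish G hG1 hGstep)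
  rw [← key, QW.Ichi_eq n (l' + 1) hl h, QW.Lspan_eq n (l' + 1) hl h]
  ext t
  constructor
  · rintro ⟨y, hy, hyt⟩
    exact ⟨y, (QW.Wcond_iff n (l' + 1) hl h σ y).1 hy, hyt⟩
  · rintro ⟨y, hy, hyt⟩
    exact ⟨y, (QW.Wcond_iff n (l' + 1) hl h σ y).2 hy, hyt⟩
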